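/- Let (R,m) be a d-dimensional analytically normal Cohen-Macaulay local domain and I an ideal of R such that dim R/I ≥ 2 and there exists a minimal prime Q of R/I (i.e., Q minimal over I) with dim R/Q = 1. Then Hom_R(R/I, H^{d-1}_I(R)) is not a finitely generated R-module. -/

import Mathlib

open CategoryTheory

noncomputable section

universe u

/-- The Krull dimension of a module: `dim R/ann(M)`. -/
def moduleDim (R : Type u) [CommRing R] (M : Type*) [AddCommGroup M] [Module R M] :
    WithBot (WithTop ℕ) :=
  ringKrullDim (R ⧸ Module.annihilator R M)

/-- The depth of `M` with respect to an ideal `J`: the supremum of the lengths of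
`M`-regular sequences consisting of elements of `J`. -/
def moduleDepth (R : Type u) [CommRing R] (J : Ideal R) (M : Type*) [AddCommGroup M]
    [Module R M] : ℕ∞ :=
  sSup {n : ℕ∞ | ∃ rs : List R, (rs.length : ℕ∞) = n ∧ (∀ r ∈ rs, r ∈ J) ∧
    RingTheory.Sequence.IsRegular M rs}

/-- Serre's condition `S_ℓ` : for every prime `p` in the support of `M`,
`depth M_p ≥ min (ℓ, dim M_p)`. -/
def SerreCondition (R : Type u) [CommRing R] (ℓ : ℕ) (M : Type u) [AddCommGroup M]
    [Module R M] : Prop :=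
  ∀ p ∈ Module.support R M,
    min ((ℓ : ℕ∞) : WithBot ℕ∞)
        (moduleDim (Localization.AtPrime p.asIdeal) (LocalizedModule p.asIdeal.primeCompl M)) ≤
      ((moduleDepth (Localization.AtPrime p.asIdeal)
          (IsLocalRing.maximalIdeal (Localization.AtPrime p.asIdeal))
          (LocalizedModule p.asIdeal.primeCompl M) : ℕ∞) : WithBot ℕ∞)

/-- A module `N` over `S` is `J`-cofinite if its support is contained in `V(J)` and all the
modules `Ext^i_S(S/J, N)` are finitely generated. -/
def IsCofinite (S : Type u) [CommRing S] (J : Ideal S) (N : ModuleCat.{u} S) : Prop :=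
  Module.support S N ⊆ PrimeSpectrum.zeroLocus (J : Set S) ∧
  ∀ i : ℕ, Module.Finite S
    (((Ext S (ModuleCat.{u} S) i).obj (Opposite.op (ModuleCat.of S (S ⧸ J)))).obj N)

/-- A ring is catenary if any two saturated chains of primes with the same endpoints have
the same length. -/
def IsCatenaryRing (R : Type u) [CommRing R] : Prop :=
  ∀ c₁ c₂ : LTSeries (PrimeSpectrum R),
    c₁.head = c₂.head → c₁.last = c₂.last →
    (∀ i : Fin c₁.length, c₁.toFun i.castSucc ⋖ c₁.toFun i.succ) →
    (∀ i : Fin c₂.length, c₂.toFun i.castSucc ⋖ c₂.toFun i.succ) →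
    c₁.length = c₂.length

/-- A module is indecomposable if it is nonzero and is not the internal direct sum of two
nonzero submodules. -/
def ModuleIndecomposable (R : Type u) [CommRing R] (M : Type*) [AddCommGroup M]
    [Module R M] : Prop :=
  Nontrivial M ∧ ∀ N₁ N₂ : Submodule R M, IsCompl N₁ N₂ → N₁ = ⊥ ∨ N₂ = ⊥

/-- A module is equidimensional if `dim R/P = dim M` for every minimal prime `P`
of its support (equivalently, of its annihilator). -/
def Equidimensional (R : Type u) [CommRing R] (M : Type*) [AddCommGroup M]
    [Module R M] : Prop :=
  ∀ P ∈ (Module.annihilator R M).minimalPrimes, ringKrullDim (R ⧸ P) = moduleDim R M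

/-- A local ring is Cohen-Macaulay if its depth equals its Krull dimension. -/
def IsCMLocalRing (S : Type u) [CommRing S] [IsLocalRing S] : Prop :=
  ((moduleDepth S (IsLocalRing.maximalIdeal S) S : ℕ∞) : WithBot ℕ∞) = ringKrullDim S

/-- A ring is Cohen-Macaulay if all its localizations at primes are Cohen-Macaulay local
rings. -/
def IsCMRing (S : Type u) [CommRing S] : Prop :=
  ∀ p : PrimeSpectrum S, IsCMLocalRing (Localization.AtPrime p.asIdeal)

/-- A ring `S` that is complete along `I`, with `S/I` a quotient of a Noetherian ring and `I`
finitely generated, is Noetherian. -/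
theorem isNoetherianRing_of_isAdicComplete {R S : Type*} [CommRing R] [CommRing S] [Algebra R S]
    [IsNoetherianRing R] (I : Ideal S) [IsAdicComplete I S] (hI : I.FG)
    (h : Function.Surjective ((Ideal.Quotient.mk I).comp (algebraMap R S))) :
    IsNoetherianRing S := by
  obtain ⟨n, a, ha⟩ := Submodule.fg_iff_exists_fin_generating_family.mp hI
  let J := MvPolynomial.idealOfVars (Fin n) R
  obtain ⟨ψ, hψX, hψC⟩ : ∃ ψ : MvPolynomial (Fin n) R →+* S,
      (∀ i, ψ (MvPolynomial.X i) = a i) ∧ ∀ r, ψ (MvPolynomial.C r) = algebraMap R S r :=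
    ⟨MvPolynomial.eval₂Hom (algebraMap R S) a, by simp, by simp⟩
  have hJ : J.map ψ = I := by
    rw [← ha]
    change Ideal.map _ (Ideal.span _) = Ideal.span _
    rw [Ideal.map_span, ← Set.range_comp]
    congr 2
    ext i
    simp [hψX]
  have hJk : ∀ k, J ^ k ≤ (I ^ k).comap ψ := fun k => by
    rw [← Ideal.map_le_iff_le_comap, Ideal.map_pow, hJ]
  let g : (k : ℕ) → MvPowerSeries (Fin n) R →+* S ⧸ I ^ k := fun k =>
    (Ideal.quotientMap (I ^ k) ψ (hJk k)).comp
      (MvPowerSeries.truncTotalAlgHom (Fin n) R k).toRingHom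
  have hgv : ∀ k p, g k p = Ideal.Quotient.mk (I ^ k) (ψ (MvPowerSeries.truncTotal k p)) :=
    fun _ _ => rfl
  have hg : ∀ {m k : ℕ} (hle : m ≤ k), (Ideal.Quotient.factorPow I hle).comp (g k) = g m := by
    intro m k hle
    ext p
    rw [RingHom.comp_apply, hgv, hgv]
    refine (Ideal.Quotient.mk_eq_mk_iff_sub_mem _ _).mpr ?_
    rw [← map_sub]
    exact hJk m (MvPowerSeries.truncTotal_sub_truncTotal_mem_pow_idealOfVars hle le_rfl p)
  let F := IsAdicComplete.liftRingHom I g hg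
  have hF : ∀ p : MvPolynomial (Fin n) R, F (p : MvPowerSeries (Fin n) R) = ψ p := by
    intro p
    refine sub_eq_zero.mp (IsHausdorff.haus (I := I) inferInstance _ fun k => ?_)
    rw [SModEq.zero, smul_eq_mul, Ideal.mul_top, ← Ideal.Quotient.eq]
    rw [IsAdicComplete.mk_liftRingHom, hgv]
    refine (Ideal.Quotient.mk_eq_mk_iff_sub_mem _ _).mpr ?_
    rw [← map_sub]
    refine hJk k ?_
    refine (MvPolynomial.mem_pow_idealOfVars_iff' ..).mpr fun x hx ↦ ?_
    simp [MvPowerSeries.coeff_truncTotal _ hx]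
  let K : Ideal (MvPowerSeries (Fin n) R) := Ideal.span (Set.range MvPowerSeries.X)
  have hK : K.map F = I := by
    rw [← ha, Ideal.map_span, ← Set.range_comp]
    change Ideal.span _ = Ideal.span _
    congr 2
    ext i
    have := hF (MvPolynomial.X i)
    simpa [hψX] using this
  have : IsHausdorff (K.map F) S := by rw [hK]; infer_instance
  have hs : Function.Surjective F := by
    apply surjective_of_mk_map_comp_surjective (I := K)
    rw [hK]
    intro y
    obtain ⟨r, rfl⟩ := h y
    refine ⟨((MvPolynomial.C r : MvPolynomial (Fin n) R) : MvPowerSeries (Fin n) R), ?_⟩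
    rw [RingHom.comp_apply, hF, hψC]
    rfl
  exact isNoetherianRing_of_surjective _ _ F hs

theorem isNoetherianRing_adicCompletion_maximalIdeal (R : Type*) [CommRing R] [IsNoetherianRing R]
    [IsLocalRing R] : IsNoetherianRing (AdicCompletion (IsLocalRing.maximalIdeal R) R) := by
  apply isNoetherianRing_of_isAdicComplete (R := R)
    (IsLocalRing.maximalIdeal (AdicCompletion (IsLocalRing.maximalIdeal R) R))
  · rw [AdicCompletion.maximalIdeal_eq_map]
    exact Ideal.FG.map (IsNoetherian.noetherian (IsLocalRing.maximalIdeal R)) _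
  · intro y
    obtain ⟨x, rfl⟩ := (AdicCompletion.residueField_map_bijective R).2 y
    obtain ⟨r, rfl⟩ := IsLocalRing.residue_surjective x
    exact ⟨r, rfl⟩

/-- Every module embeds into an injective module. -/
theorem exists_injective_embedding (A : Type u) [CommRing A] (M : Type u) [AddCommGroup M]
    [Module A M] : ∃ (E : Type u) (_ : AddCommGroup E) (_ : Module A E) (f : M →ₗ[A] E),
      Module.Injective A E ∧ Function.Injective f := by
  let E := Injective.under (ModuleCat.of A M)
  refine ⟨E, inferInstance, inferInstance, (Injective.ι (ModuleCat.of A M)).hom, ?_, ?_⟩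
  · have : Injective (ModuleCat.of A E) := inferInstanceAs (Injective (Injective.under _))
    exact Module.injective_module_of_injective_object A E
  · exact (ModuleCat.mono_iff_injective _).mp inferInstance

/-- A local ring has an injective module with an essential simple socle (the injective hull of
the residue field). -/
theorem exists_injective_hull_residueField (A : Type u) [CommRing A] [IsLocalRing A] :
    ∃ (E : Type u) (_ : AddCommGroup E) (_ : Module A E) (σ : E), Module.Injective A E ∧ σ ≠ 0 ∧
      (∀ a ∈ IsLocalRing.maximalIdeal A, a • σ = 0) ∧ ∀ e : E, e ≠ 0 → ∃ a : A, a • e = σ := by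
  obtain ⟨E, _, _, i, hE, hi⟩ := exists_injective_embedding A (IsLocalRing.ResidueField A)
  set σ : E := i 1 with hσ
  have hσ0 : σ ≠ 0 := by
    rw [hσ, Ne, map_eq_zero_iff i hi]
    exact one_ne_zero
  have hmσ : ∀ a ∈ IsLocalRing.maximalIdeal A, a • σ = 0 := by
    intro a ha
    rw [hσ, ← map_smul, Algebra.smul_def, IsLocalRing.ResidueField.algebraMap_eq,
      (IsLocalRing.residue_eq_zero_iff a).mpr ha, zero_mul, map_zero]
  let 𝒱 : Set (Submodule A E) := {V | σ ∈ V ∧ ∀ e ∈ V, e ≠ 0 → ∃ a : A, a • e = σ}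
  obtain ⟨V, -, hV⟩ : ∃ V, Submodule.span A {σ} ≤ V ∧ Maximal (· ∈ 𝒱) V := by
    refine zorn_le_nonempty₀ 𝒱 ?_ _ ?_
    · intro c hc hchain V₀ hV₀
      refine ⟨sSup c, ⟨?_, ?_⟩, fun V hV => le_sSup hV⟩
      · exact (le_sSup hV₀ : V₀ ≤ sSup c) (hc hV₀).1
      · intro e he
        obtain ⟨V, hV, heV⟩ := (Submodule.mem_sSup_of_directed ⟨V₀, hV₀⟩ hchain.directedOn).mp he
        exact (hc hV).2 e heV
    · refine ⟨Submodule.mem_span_singleton_self σ, fun e he h0 => ?_⟩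
      obtain ⟨a, rfl⟩ := Submodule.mem_span_singleton.mp he
      have ha : IsUnit a := by
        by_contra h
        exact h0 (hmσ a ((IsLocalRing.mem_maximalIdeal a).mpr h))
      obtain ⟨b, hb⟩ := ha.exists_left_inv
      exact ⟨b, by rw [smul_smul, hb, one_smul]⟩
  obtain ⟨F, -, hF⟩ : ∃ F : Submodule A E, ⊥ ≤ F ∧ Maximal (· ∈ {F : Submodule A E | σ ∉ F}) F := by
    refine zorn_le_nonempty₀ _ ?_ _ (by simpa using hσ0)
    intro c hc hchain F₀ hF₀
    refine ⟨sSup c, fun h => ?_, fun V hV => le_sSup hV⟩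
    obtain ⟨V, hV, heV⟩ := (Submodule.mem_sSup_of_directed ⟨F₀, hF₀⟩ hchain.directedOn).mp h
    exact hc hV heV
  have hVF : ∀ v ∈ V, v ∈ F → v = 0 := by
    intro v hv hvF
    by_contra h
    obtain ⟨a, ha⟩ := hV.prop.2 v hv h
    exact hF.prop (ha ▸ F.smul_mem a hvF)
  have hquot : ∀ e : E, e ∉ F → ∃ a : A, F.mkQ (a • e) = F.mkQ σ := by
    intro e he
    have : σ ∈ F ⊔ Submodule.span A {e} := by
      by_contra h
      have := hF.le_of_ge (y := F ⊔ Submodule.span A {e}) h le_sup_left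
      exact he (this (Submodule.mem_sup_right (Submodule.mem_span_singleton_self e)))
    obtain ⟨f, hf, e', he', hs⟩ := Submodule.mem_sup.mp this
    obtain ⟨a, rfl⟩ := Submodule.mem_span_singleton.mp he'
    refine ⟨a, ?_⟩
    rw [← hs, map_add, (Submodule.mkQ_apply F f), (Submodule.Quotient.mk_eq_zero F).mpr hf, zero_add]
  obtain ⟨φ, hφ⟩ := hE.out (F.mkQ ∘ₗ V.subtype) (by
    rw [injective_iff_map_eq_zero]
    rintro ⟨v, hv⟩ h
    ext
    exact hVF v hv ((Submodule.Quotient.mk_eq_zero F).mp h)) V.subtype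
  have hφV : ∀ v ∈ V, φ (F.mkQ v) = v := fun v hv => hφ ⟨v, hv⟩
  have hφr : ∀ e, φ (F.mkQ e) ∈ V := by
    have : φ.range ≤ V := by
      refine hV.le_of_ge (y := φ.range) ⟨⟨F.mkQ σ, hφV σ hV.prop.1⟩, ?_⟩
        fun v hv => ⟨F.mkQ v, hφV v hv⟩
      rintro _ ⟨e, rfl⟩ h0
      obtain ⟨e, rfl⟩ := F.mkQ_surjective e
      obtain ⟨a, ha⟩ := hquot e fun h => h0 (by
        rw [Submodule.mkQ_apply, (Submodule.Quotient.mk_eq_zero F).mpr h, map_zero])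
      exact ⟨a, by rw [← map_smul, ← map_smul, ha, hφV σ hV.prop.1]⟩
    exact fun e => this ⟨_, rfl⟩
  refine ⟨V, inferInstance, inferInstance, ⟨σ, hV.prop.1⟩, ⟨?_⟩, ?_, ?_, ?_⟩
  · intro X Y _ _ _ _ f hf g
    obtain ⟨h, hh⟩ := hE.out f hf (V.subtype ∘ₗ g)
    refine ⟨LinearMap.codRestrict V (φ ∘ₗ F.mkQ ∘ₗ h) fun y => hφr _, fun x => ?_⟩
    ext
    change φ (F.mkQ (h (f x))) = _
    rw [hh]
    exact hφV _ (g x).2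
  · simpa [Subtype.ext_iff] using hσ0
  · intro a ha
    ext
    exact hmσ a ha
  · rintro ⟨e, he⟩ h0
    obtain ⟨a, ha⟩ := hV.prop.2 e he (by simpa [Subtype.ext_iff] using h0)
    exact ⟨a, Subtype.ext ha⟩

section PowIdeal
variable {A : Type*} [CommRing A] {κ : Type*}

/-- The ideal generated by the powers `z i ^ n i`. -/
def powIdeal (z : κ → A) (n : κ → ℕ) : Ideal A := Ideal.span (Set.range fun i => z i ^ n i)

/-- Each `z i` is a nonzerodivisor modulo powers of the other members of the family. -/
def PowIndependent (z : κ → A) : Prop :=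
  ∀ (i : κ) (n : κ → ℕ) (a : A), z i * a ∈ Ideal.span ((fun j => z j ^ n j) '' {i}ᶜ) →
    a ∈ Ideal.span ((fun j => z j ^ n j) '' {i}ᶜ)

theorem pow_mem_powIdeal (z : κ → A) (n : κ → ℕ) (i : κ) : z i ^ n i ∈ powIdeal z n :=
  Ideal.subset_span ⟨i, rfl⟩

theorem powIdeal_le {z : κ → A} {n : κ → ℕ} {J : Ideal A} :
    powIdeal z n ≤ J ↔ ∀ i, z i ^ n i ∈ J := by
  rw [powIdeal, Ideal.span_le, Set.range_subset_iff]
  rfl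

theorem mul_mem_of_mem_powIdeal {z : κ → A} {n : κ → ℕ} {J : Ideal A} {c a : A}
    (h : ∀ i, c * z i ^ n i ∈ J) (ha : a ∈ powIdeal z n) : c * a ∈ J := by
  have : powIdeal z n ≤ Submodule.comap (LinearMap.mulLeft A c) J := powIdeal_le.mpr h
  exact this ha

theorem powIdeal_update [DecidableEq κ] (z : κ → A) (n : κ → ℕ) (i : κ) (m : ℕ) :
    powIdeal z (Function.update n i m) =
      Ideal.span {z i ^ m} ⊔ Ideal.span ((fun j => z j ^ n j) '' {i}ᶜ) := by
  rw [← Ideal.span_union, powIdeal]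
  congr 1
  ext a
  constructor
  · rintro ⟨j, rfl⟩
    by_cases h : j = i
    · subst h; simp
    · right; exact ⟨j, h, by simp [h]⟩
  · rintro (h | ⟨j, h, rfl⟩)
    · exact ⟨i, by simpa using h.symm⟩
    · exact ⟨j, by simp [show j ≠ i from h]⟩

theorem PowIndependent.pow_mul_mem {z : κ → A} (hz : PowIndependent z) (i : κ) (n : κ → ℕ) (k : ℕ)
    {a : A} (h : z i ^ k * a ∈ Ideal.span ((fun j => z j ^ n j) '' {i}ᶜ)) :
    a ∈ Ideal.span ((fun j => z j ^ n j) '' {i}ᶜ) := by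
  induction k with
  | zero => simpa using h
  | succ k ih => exact ih (hz i n _ (by rwa [← mul_assoc, ← pow_succ']))

theorem PowIndependent.cancel [DecidableEq κ] {z : κ → A} (hz : PowIndependent z) (i : κ)
    (n : κ → ℕ) (m k : ℕ) {a : A} (h : z i ^ k * a ∈ powIdeal z (Function.update n i (k + m))) :
    a ∈ powIdeal z (Function.update n i m) := by
  rw [powIdeal_update] at h ⊢
  obtain ⟨b, c, hc, hbc⟩ := Ideal.mem_span_singleton_sup.mp h
  rw [pow_add] at hbc
  have : z i ^ k * (a - b * z i ^ m) ∈ Ideal.span ((fun j => z j ^ n j) '' {i}ᶜ) := by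
    convert hc using 1
    linear_combination -hbc
  exact Ideal.mem_span_singleton_sup.mpr ⟨b, _, hz.pow_mul_mem i n k this, by simp⟩

theorem PowIndependent.cancel_prod [DecidableEq κ] {z : κ → A} (hz : PowIndependent z)
    (T : Finset κ) (n : κ → ℕ) (k : ℕ) (hk : ∀ i ∈ T, k ≤ n i) {a : A}
    (h : (∏ i ∈ T, z i ^ k) * a ∈ powIdeal z n) :
    a ∈ powIdeal z (fun i => if i ∈ T then n i - k else n i) := by
  induction T using Finset.induction_on generalizing a n with
  | empty => simpa using h
  | insert i T hi ih =>
    rw [Finset.prod_insert hi, mul_assoc] at h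
    have h1 : (∏ i ∈ T, z i ^ k) * a ∈ powIdeal z (Function.update n i (n i - k)) := by
      apply hz.cancel i n (n i - k) k
      rwa [Nat.add_sub_cancel' (hk i (Finset.mem_insert_self i T)), Function.update_eq_self]
    have h2 := ih _ (fun j hj => by
      have : j ≠ i := fun h => hi (h ▸ hj)
      simpa [this] using hk j (Finset.mem_insert_of_mem hj)) h1
    convert h2 using 2
    ext j
    by_cases hj : j = i
    · subst hj; simp [hi]
    · simp [hj]

theorem PowIndependent.mem_of_prod_pow_mul_mem [Fintype κ] {z : κ → A} (hz : PowIndependent z)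
    (n k : ℕ) {a : A} (h : (∏ i, z i) ^ k * a ∈ powIdeal z (fun _ => n + k)) :
    a ∈ powIdeal z (fun _ => n) := by
  classical
  rw [← Finset.prod_pow] at h
  simpa using hz.cancel_prod Finset.univ _ k (by simp) h

theorem PowIndependent.mem_sup_of_pow_mul_mem [DecidableEq κ] {z : κ → A} (hz : PowIndependent z)
    (T : Finset κ) {m N : ℕ} (hmN : m ≤ N) {a : A}
    (h : ∀ i ∈ T, z i ^ m * a ∈ powIdeal z (fun _ => N)) :
    a ∈ Ideal.span {∏ i ∈ T, z i ^ (N - m)} ⊔ powIdeal z (fun _ => N) := by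
  induction T using Finset.induction_on with
  | empty => simp
  | insert i T hi ih =>
    obtain ⟨b, c, hc, rfl⟩ := Ideal.mem_span_singleton_sup.mp
      (ih fun j hj => h j (Finset.mem_insert_of_mem hj))
    have h1 : (∏ j ∈ T, z j ^ (N - m)) * (z i ^ m * b) ∈ powIdeal z (fun _ => N) := by
      have := Ideal.sub_mem _ (h i (Finset.mem_insert_self i T))
        (Ideal.mul_mem_left _ (z i ^ m) hc)
      convert this using 1
      ring
    have h2 := hz.cancel_prod T _ (N - m) (by simp) h1
    have h3 : b ∈ powIdeal z (Function.update (fun j => if j ∈ T then m else N) i (N - m)) := by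
      apply hz.cancel i _ (N - m) m
      convert h2 using 2
      ext j
      by_cases hj : j = i
      · subst hj; simp [hi, hmN]
      · simp only [Function.update_of_ne hj]
        split_ifs <;> omega
    have h4 : (∏ j ∈ T, z j ^ (N - m)) * b ∈
        Ideal.span {∏ j ∈ insert i T, z j ^ (N - m)} ⊔ powIdeal z (fun _ => N) := by
      refine mul_mem_of_mem_powIdeal (fun j => ?_) h3
      by_cases hj : j = i
      · subst hj
        apply Ideal.mem_sup_left
        rw [Function.update_self, Finset.prod_insert hi, mul_comm]
        exact Ideal.mem_span_singleton_self _
      · apply Ideal.mem_sup_right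
        rw [Function.update_of_ne hj]
        split_ifs with hjT
        · rw [← Finset.mul_prod_erase T _ hjT, mul_right_comm, ← pow_add, Nat.sub_add_cancel hmN]
          exact Ideal.mul_mem_right _ _ (pow_mem_powIdeal z (fun _ => N) j)
        · exact Ideal.mul_mem_left _ _ (pow_mem_powIdeal z (fun _ => N) j)
    refine Ideal.add_mem _ ?_ (Ideal.mem_sup_right hc)
    rwa [mul_comm]

end PowIdeal

theorem ringKrullDim_quotient_sup_span_singleton_succ_le {A : Type*} [CommRing A] {J : Ideal A}
    {r : A} (hr : ∀ a, r * a ∈ J → a ∈ J) :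
    ringKrullDim (A ⧸ (J ⊔ Ideal.span {r})) + 1 ≤ ringKrullDim (A ⧸ J) := by
  have h : Ideal.Quotient.mk J r ∈ nonZeroDivisors (A ⧸ J) := by
    rw [mem_nonZeroDivisors_iff_right]
    intro x hx
    obtain ⟨a, rfl⟩ := Ideal.Quotient.mk_surjective x
    rw [← map_mul, Ideal.Quotient.eq_zero_iff_mem, mul_comm] at hx
    exact Ideal.Quotient.eq_zero_iff_mem.mpr (hr a hx)
  have := ringKrullDim_quotient_succ_le_of_nonZeroDivisor h
  rwa [← Set.image_singleton, ← Ideal.map_span,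
    ringKrullDim_eq_of_ringEquiv (DoubleQuot.quotQuotEquivQuotSup J (Ideal.span {r}))] at this

theorem exists_prod_pow_mem_of_ringKrullDim_lt {A : Type*} [CommRing A] [IsNoetherianRing A]
    {κ : Type*} [DecidableEq κ] (z : κ → A) (T : Finset κ) (J : Ideal A)
    (h : ringKrullDim (A ⧸ J) < (T.card : ℕ)) (k : ℕ) :
    ∃ N ≥ k, (∏ i ∈ T, z i) ^ (N - k) ∈ J ⊔ Ideal.span ((fun i => z i ^ N) '' (T : Set κ)) := by
  induction T using Finset.induction_on generalizing J k with
  | empty =>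
    have : J = ⊤ := by
      by_contra hJ
      have := Ideal.Quotient.nontrivial_iff.mpr hJ
      exact absurd (ringKrullDim_nonneg_of_nontrivial (R := A ⧸ J)) (not_le.mpr (by simpa using h))
    exact ⟨k, le_rfl, by simp [this]⟩
  | insert i T hi ih =>
    let f : ℕ →o Ideal A := ⟨fun c => Submodule.comap (LinearMap.mulLeft A (z i ^ c)) J, by
      intro a b hab x hx
      simp only [Submodule.mem_comap, LinearMap.mulLeft_apply] at hx ⊢
      obtain ⟨c, rfl⟩ := Nat.exists_eq_add_of_le' hab
      rw [pow_add, mul_assoc]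
      exact Ideal.mul_mem_left _ _ hx⟩
    have hf : ∀ c x, x ∈ f c ↔ z i ^ c * x ∈ J := fun _ _ => Iff.rfl
    obtain ⟨c, hc⟩ := monotone_stabilizes_iff_noetherian.mpr ‹IsNoetherianRing A› f
    have hJ' : ∀ n a, z i ^ n * a ∈ f c → a ∈ f c := by
      intro n a ha
      rw [hf, ← mul_assoc, ← pow_add, ← hf] at ha
      rwa [hc (c + n) (by omega)]
    have hJle : J ≤ f c := fun a ha => Ideal.mul_mem_left _ _ ha
    have hdim : ringKrullDim (A ⧸ (f c ⊔ Ideal.span {z i ^ k})) < (T.card : ℕ) := by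
      have h1 := ringKrullDim_quotient_sup_span_singleton_succ_le (hJ' k)
      have h2 : ringKrullDim (A ⧸ f c) ≤ ringKrullDim (A ⧸ J) :=
        ringKrullDim_le_of_surjective (Ideal.Quotient.factor hJle)
          (Ideal.Quotient.factor_surjective hJle)
      rw [Finset.card_insert_of_notMem hi] at h
      have h3 := (h1.trans h2).trans_lt h
      push_cast at h3
      exact lt_of_add_lt_add_right h3
    obtain ⟨N, hN, hmem⟩ := ih _ hdim k
    refine ⟨N + c, by omega, ?_⟩
    set S : Ideal A := J ⊔ Ideal.span ((fun i => z i ^ (N + c)) '' (insert i T : Finset κ)) with hS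
    have hzS : ∀ j ∈ insert i T, z j ^ (N + c) ∈ S := fun j hj =>
      Ideal.mem_sup_right (Ideal.subset_span ⟨j, hj, rfl⟩)
    have key : f c ⊔ Ideal.span {z i ^ k} ⊔ Ideal.span ((fun i => z i ^ N) '' (T : Set κ)) ≤
        Submodule.comap (LinearMap.mulLeft A (z i ^ (N + c - k) * (∏ j ∈ T, z j) ^ c)) S := by
      refine sup_le (sup_le ?_ ?_) ?_
      · intro x hx
        rw [Submodule.mem_comap, LinearMap.mulLeft_apply, mul_right_comm]
        refine Ideal.mul_mem_right _ _ (Ideal.mem_sup_left ?_)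
        have : N + c - k = (N - k) + c := by omega
        rw [this, pow_add, mul_assoc]
        exact Ideal.mul_mem_left _ _ hx
      · rw [Ideal.span_le, Set.singleton_subset_iff, SetLike.mem_coe, Submodule.mem_comap,
          LinearMap.mulLeft_apply, mul_right_comm, ← pow_add, Nat.sub_add_cancel (by omega)]
        exact Ideal.mul_mem_right _ _ (hzS i (Finset.mem_insert_self i T))
      · rw [Ideal.span_le]
        rintro _ ⟨j, hj, rfl⟩
        rw [SetLike.mem_coe, Submodule.mem_comap, LinearMap.mulLeft_apply, mul_assoc]
        refine Ideal.mul_mem_left _ _ ?_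
        obtain ⟨b, hb⟩ := Finset.dvd_prod_of_mem z (show j ∈ T from hj)
        rw [hb, mul_pow, mul_right_comm, ← pow_add, add_comm c N]
        exact Ideal.mul_mem_right _ _ (hzS j (Finset.mem_insert_of_mem hj))
    have := key hmem
    rw [Submodule.mem_comap, LinearMap.mulLeft_apply, mul_assoc, ← pow_add] at this
    rw [Finset.prod_insert hi, mul_pow]
    convert this using 3
    omega

/-- Extension of linear maps into an injective module along a map with small kernel. -/
theorem Module.Injective.exists_comp_eq {A : Type u} [CommRing A] {E P Q : Type u}
    [AddCommGroup E] [Module A E] [AddCommGroup P] [Module A P] [AddCommGroup Q] [Module A Q]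
    (hE : Module.Injective A E) (μ : P →ₗ[A] Q) (φ : P →ₗ[A] E) (h : ∀ p, μ p = 0 → φ p = 0) :
    ∃ ψ : Q →ₗ[A] E, ∀ p, ψ (μ p) = φ p := by
  obtain ⟨ψ, hψ⟩ := hE.out ((LinearMap.ker μ).liftQ μ le_rfl)
    (LinearMap.ker_eq_bot.mp (Submodule.ker_liftQ_eq_bot' _ _ rfl))
    ((LinearMap.ker μ).liftQ φ fun p hp => h p hp)
  exact ⟨ψ, fun p => hψ ((LinearMap.ker μ).mkQ p)⟩

theorem Module.Injective.exists_eq_sum_smul {A : Type u} [CommRing A] {E Q : Type u}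
    [AddCommGroup E] [Module A E] [AddCommGroup Q] [Module A Q] (hE : Module.Injective A E)
    {κ : Type} [Fintype κ] (T : Finset κ) (c : κ → A) (φ : Q →ₗ[A] E)
    (h : ∀ q, (∀ j ∈ T, c j • q = 0) → φ q = 0) :
    ∃ ψ : κ → Q →ₗ[A] E, φ = ∑ j ∈ T, c j • ψ j := by
  classical
  obtain ⟨Ψ, hΨ⟩ := hE.exists_comp_eq (P := Q) (Q := κ → Q)
    (LinearMap.pi fun j => if j ∈ T then c j • LinearMap.id else 0) φ (by
      intro q hq
      refine h q fun j hj => ?_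
      simpa [hj] using congrFun hq j)
  refine ⟨fun j => Ψ ∘ₗ LinearMap.single A (fun _ => Q) j, ?_⟩
  ext q
  rw [← hΨ, ← LinearMap.sum_single_apply (fun _ : κ => Q) (LinearMap.pi _ q), map_sum]
  simp only [LinearMap.sum_apply, LinearMap.smul_apply, LinearMap.comp_apply, ← map_smul]
  rw [← Finset.sum_subset (Finset.subset_univ T)]
  · refine Finset.sum_congr rfl fun j hj => ?_
    simp [hj, ← Pi.single_smul]
  · intro j _ hj
    simp [hj]

theorem exists_functional_ne_zero {A : Type u} [CommRing A] [IsLocalRing A] {E : Type u}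
    [AddCommGroup E] [Module A E] (hE : Module.Injective A E) {σ : E} (hσ : σ ≠ 0)
    (hmσ : ∀ a ∈ IsLocalRing.maximalIdeal A, a • σ = 0) {M : Type u} [AddCommGroup M] [Module A M]
    {u : M} (hu : u ≠ 0) {N : ℕ} (hN : ∀ a ∈ IsLocalRing.maximalIdeal A ^ N, a • u = 0) :
    ∃ f : M →ₗ[A] E, f ≠ 0 := by
  obtain ⟨s, hs, hms⟩ : ∃ s : M, s ≠ 0 ∧ ∀ a ∈ IsLocalRing.maximalIdeal A, a • s = 0 := by
    induction N with
    | zero => exact absurd (by simpa using hN 1 (by simp)) hu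
    | succ N ih =>
      by_cases h : ∀ a ∈ IsLocalRing.maximalIdeal A ^ N, a • u = 0
      · exact ih h
      · push Not at h
        obtain ⟨a, ha, hau⟩ := h
        refine ⟨a • u, hau, fun b hb => ?_⟩
        rw [smul_smul]
        exact hN _ (by rw [pow_succ']; exact Ideal.mul_mem_mul hb ha)
  obtain ⟨f, hf⟩ := hE.exists_comp_eq (LinearMap.toSpanSingleton A M s)
    (LinearMap.toSpanSingleton A E σ) (by
      intro a ha
      refine hmσ a ?_
      rw [IsLocalRing.mem_maximalIdeal, mem_nonunits_iff]
      intro h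
      exact hs ((h.smul_eq_zero).mp ha))
  refine ⟨f, fun h => hσ ?_⟩
  have := hf 1
  simpa [h] using this.symm

/-- In a module with an essential simple socle the elements killed by a power of the maximal
ideal form a finitely generated submodule. -/
theorem fg_of_pow_maximalIdeal_smul {A : Type u} [CommRing A] [IsLocalRing A] [IsNoetherianRing A]
    {E : Type u} [AddCommGroup E] [Module A E] {σ : E}
    (hess : ∀ e : E, e ≠ 0 → ∃ a : A, a • e = σ) (hσ : σ ≠ 0) (n : ℕ) (G : Submodule A E)
    (hG : ∀ e ∈ G, ∀ a ∈ IsLocalRing.maximalIdeal A ^ n, a • e = 0) : G.FG := by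
  have hsoc : ∀ G : Submodule A E,
      (∀ e ∈ G, ∀ a ∈ IsLocalRing.maximalIdeal A, a • e = 0) → IsNoetherian A G := by
    intro G hG
    have hle : G ≤ Submodule.span A {σ} := by
      intro e he
      by_cases h0 : e = 0
      · simp [h0]
      obtain ⟨a, ha⟩ := hess e h0
      have hu : IsUnit a := by
        by_contra h
        exact hσ (by rw [← ha, hG e he a ((IsLocalRing.mem_maximalIdeal a).mpr h)])
      obtain ⟨b, hb⟩ := hu.exists_left_inv
      refine Submodule.mem_span_singleton.mpr ⟨b, ?_⟩
      rw [← ha, smul_smul, hb, one_smul]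
    have : IsNoetherian A (Submodule.span A {σ}) := inferInstance
    exact isNoetherian_of_le hle
  suffices IsNoetherian A G from (isNoetherian_submodule.mp this) G le_rfl
  induction n generalizing G with
  | zero =>
    refine hsoc G fun e he a _ => ?_
    have : e = 0 := by simpa using hG e he 1 (by simp)
    simp [this]
  | succ n ih =>
    obtain ⟨s, u, hu⟩ := Submodule.fg_iff_exists_fin_generating_family.mp
      (IsNoetherian.noetherian (IsLocalRing.maximalIdeal A ^ n))
    let S : Submodule A E :=
      { carrier := {e | ∀ a ∈ IsLocalRing.maximalIdeal A, a • e = 0}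
        add_mem' := fun hx hy a ha => by rw [smul_add, hx a ha, hy a ha, add_zero]
        zero_mem' := fun a _ => smul_zero a
        smul_mem' := fun c x hx a ha => by rw [smul_comm, hx a ha, smul_zero] }
    have hS : IsNoetherian A S := hsoc S fun e he => he
    let f : G →ₗ[A] (Fin s → S) := LinearMap.pi fun i =>
      LinearMap.codRestrict S (u i • G.subtype) fun e a ha => by
        have hui : u i ∈ IsLocalRing.maximalIdeal A ^ n := by
          rw [← hu]; exact Submodule.subset_span ⟨i, rfl⟩
        rw [LinearMap.smul_apply, smul_smul]
        exact hG _ e.2 _ (by rw [pow_succ']; exact Ideal.mul_mem_mul ha hui)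
    have hker : IsNoetherian A (LinearMap.ker f) := by
      have h1 : IsNoetherian A ((LinearMap.ker f).map G.subtype) := by
        apply ih
        rintro _ ⟨e, he, rfl⟩ a ha
        have he' : ∀ i, u i • (e : E) = 0 := fun i =>
          congrArg Subtype.val (congrFun (LinearMap.mem_ker.mp he) i)
        rw [← hu] at ha
        induction ha using Submodule.span_induction with
        | mem x hx => obtain ⟨i, rfl⟩ := hx; exact he' i
        | zero => simp
        | add x y _ _ hx hy => rw [add_smul, hx, hy, add_zero]
        | smul c x _ hx => rw [smul_assoc, hx, smul_zero]
      exact isNoetherian_of_linearEquiv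
        (Submodule.equivMapOfInjective G.subtype G.injective_subtype (LinearMap.ker f)).symm
    have hrange : IsNoetherian A (LinearMap.range f) := inferInstance
    exact isNoetherian_of_range_eq_ker (LinearMap.ker f).subtype f (by simp)

theorem isPrecomplete_pi {A : Type*} [CommRing A] (I : Ideal A) [IsPrecomplete I A] (k : ℕ) :
    IsPrecomplete I (Fin k → A) := by
  have key : ∀ (n : ℕ) (f : Fin k → A), f ∈ (I ^ n • ⊤ : Submodule A (Fin k → A)) ↔
      ∀ i, f i ∈ (I ^ n • ⊤ : Submodule A A) := by
    intro n f
    constructor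
    · intro hf i
      have := Submodule.mem_map_of_mem (f := (LinearMap.proj i : (Fin k → A) →ₗ[A] A)) hf
      rw [Submodule.map_smul''] at this
      exact Submodule.smul_mono le_rfl le_top this
    · intro hf
      rw [← LinearMap.sum_single_apply (fun _ : Fin k => A) f]
      refine Submodule.sum_mem _ fun i _ => ?_
      have := Submodule.mem_map_of_mem (f := LinearMap.single A (fun _ : Fin k => A) i) (hf i)
      rw [Submodule.map_smul''] at this
      exact Submodule.smul_mono le_rfl le_top this
  constructor
  intro f hf
  have h : ∀ i, ∃ L : A, ∀ n, f n i ≡ L [SMOD (I ^ n • ⊤ : Submodule A A)] := by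
    intro i
    refine IsPrecomplete.prec' (I := I) (fun n => f n i) fun {m n} hmn => ?_
    rw [SModEq.sub_mem]
    exact (key m _).mp (SModEq.sub_mem.mp (hf hmn)) i
  choose L hL using h
  refine ⟨L, fun n => ?_⟩
  rw [SModEq.sub_mem, key]
  exact fun i => SModEq.sub_mem.mp (hL i n)

theorem exists_directed_module {A : Type u} [CommRing A] [IsDomain A] {κ : Type} [Fintype κ]
    {z : κ → A} (hz : PowIndependent z) (hz0 : ∀ i, z i ≠ 0) :
    ∃ (Q : Type u) (_ : AddCommGroup Q) (_ : Module A Q) (v : ℕ → Q),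
      (∀ n, (∏ i, z i) • v (n + 1) = v n) ∧ (∀ q k, ∃ n ≥ k, ∃ a : A, q = a • v n) ∧
      ∀ a n, a • v n = 0 ↔ a ∈ powIdeal z fun _ => n := by
  set g := ∏ i, z i with hg
  have hg0 : g ≠ 0 := Finset.prod_ne_zero_iff.mpr fun i _ => hz0 i
  let L := Localization.Away g
  let w : L := IsLocalization.Away.invSelf g
  have hgw : algebraMap A L g * w = 1 := IsLocalization.Away.mul_invSelf g
  have hinj : Function.Injective (algebraMap A L) :=
    IsLocalization.injective L (powers_le_nonZeroDivisors_of_noZeroDivisors hg0)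
  have hgI : ∀ n, ∀ a ∈ powIdeal z (fun _ => n), g * a ∈ powIdeal z fun _ => n + 1 := by
    intro n a ha
    refine mul_mem_of_mem_powIdeal (fun i => ?_) ha
    obtain ⟨c, hc⟩ := Finset.dvd_prod_of_mem z (Finset.mem_univ i)
    rw [hg, hc, show z i * c * z i ^ n = c * z i ^ (n + 1) by ring]
    exact Ideal.mul_mem_left _ _ (pow_mem_powIdeal z (fun _ => n + 1) i)
  have hgI' : ∀ k n, ∀ a ∈ powIdeal z (fun _ => n), g ^ k * a ∈ powIdeal z fun _ => n + k := by
    intro k n a ha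
    induction k with
    | zero => simpa using ha
    | succ k ih =>
      rw [pow_succ', mul_assoc]
      exact hgI _ _ ih
  have hv : ∀ k n, g ^ k • w ^ (n + k) = w ^ n := by
    intro k n
    rw [Algebra.smul_def, map_pow, add_comm, pow_add, ← mul_assoc, ← mul_pow, hgw, one_pow, one_mul]
  let Z : Submodule A L :=
    { carrier := {q | ∃ n, ∃ a ∈ powIdeal z (fun _ => n), q = a • w ^ n}
      zero_mem' := ⟨0, 0, Ideal.zero_mem _, by simp⟩
      add_mem' := by
        rintro _ _ ⟨n, a, ha, rfl⟩ ⟨m, b, hb, rfl⟩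
        refine ⟨n + m, g ^ m * a + g ^ n * b, Ideal.add_mem _ (hgI' _ _ _ ha) ?_, ?_⟩
        · rw [add_comm n m]; exact hgI' _ _ _ hb
        · rw [add_smul, mul_comm, mul_smul, hv, mul_comm, mul_smul, add_comm n m, hv]
      smul_mem' := by
        rintro c _ ⟨n, a, ha, rfl⟩
        exact ⟨n, c * a, Ideal.mul_mem_left _ _ ha, by rw [mul_smul]⟩ }
  refine ⟨L ⧸ Z, inferInstance, inferInstance, fun n => Z.mkQ (w ^ n), fun n => ?_, ?_, ?_⟩
  · rw [← map_smul]
    congr 1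
    simpa using hv 1 n
  · intro q k
    obtain ⟨l, rfl⟩ := Z.mkQ_surjective q
    obtain ⟨n, a, h⟩ := IsLocalization.Away.surj g l
    refine ⟨n + k, by omega, g ^ k * a, ?_⟩
    rw [← map_smul]
    congr 1
    have hl : l = a • w ^ n := by
      rw [Algebra.smul_def, ← h, mul_assoc, ← mul_pow, hgw, one_pow, mul_one]
    rw [mul_comm, mul_smul, hv, hl]
  · intro a n
    rw [← map_smul, Submodule.mkQ_apply, Submodule.Quotient.mk_eq_zero]
    constructor
    · rintro ⟨m, b, hb, hab⟩
      have h1 : g ^ m * a = g ^ n * b := by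
        apply hinj
        have h2 : ∀ (k : ℕ) (c : A), algebraMap A L (g ^ k * c) =
            algebraMap A L (g ^ (m + n)) * (algebraMap A L (g^k * c) * w ^ (m + n)) := by
          intro k c
          rw [mul_left_comm, map_pow, ← mul_pow, hgw, one_pow, mul_one]
        rw [h2 m, h2 n]
        congr 1
        rw [← Algebra.smul_def, ← Algebra.smul_def, mul_comm, mul_smul, add_comm m n, hv, hab,
          mul_comm, mul_smul, add_comm n m, hv]
      apply hz.mem_of_prod_pow_mul_mem n m
      rw [← hg, h1, add_comm]
      exact hgI' _ _ _ hb
    · intro ha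
      exact ⟨n, a, ha, rfl⟩

theorem exists_pow_le_powIdeal {A : Type*} [CommRing A] [IsNoetherianRing A] {κ : Type*}
    {z : κ → A} {m : Ideal A} {N : ℕ} (h : m ^ N ≤ Ideal.span (Set.range z)) (n : κ → ℕ) :
    ∃ M, m ^ M ≤ powIdeal z n := by
  have h1 : Ideal.span (Set.range z) ≤ (powIdeal z n).radical := by
    rw [Ideal.span_le]
    rintro _ ⟨i, rfl⟩
    exact ⟨n i, pow_mem_powIdeal z n i⟩
  have h2 : m ≤ (powIdeal z n).radical := by
    intro a ha
    rw [← Ideal.radical_idem]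
    exact ⟨N, h1 (h (Ideal.pow_mem_pow ha N))⟩
  exact Ideal.exists_pow_le_of_le_radical_of_fg h2 (IsNoetherian.noetherian m)

theorem prod_pow_smul_directed {A : Type*} [CommRing A] {κ : Type*} [Fintype κ] {z : κ → A}
    {Q : Type*} [AddCommGroup Q] [Module A Q] {v : ℕ → Q}
    (hv : ∀ n, (∏ i, z i) • v (n + 1) = v n) {n N : ℕ} (h : n ≤ N) :
    (∏ i, z i) ^ (N - n) • v N = v n := by
  induction N, h using Nat.le_induction with
  | base => simp
  | succ N hN ih => rw [Nat.succ_sub hN, pow_succ, mul_smul, hv, ih]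

section Dual
open IsLocalRing
variable {A : Type u} [CommRing A] [IsLocalRing A] [IsNoetherianRing A] {E : Type u}
  [AddCommGroup E] [Module A E] {σ : E} {κ : Type} [Fintype κ] [DecidableEq κ] {z : κ → A}
  {Q : Type u} [AddCommGroup Q] [Module A Q] {v : ℕ → Q}

theorem finite_dual_of_directed [IsAdicComplete (maximalIdeal A) A]
    (hE : Module.Injective A E) (hess : ∀ e : E, e ≠ 0 → ∃ a : A, a • e = σ) (hσ : σ ≠ 0)
    (hz : PowIndependent z) (hzm : ∀ i, z i ∈ maximalIdeal A) {N : ℕ}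
    (hN : maximalIdeal A ^ N ≤ Ideal.span (Set.range z))
    (hv : ∀ n, (∏ i, z i) • v (n + 1) = v n) (hsurj : ∀ q k, ∃ n ≥ k, ∃ a : A, q = a • v n)
    (hker : ∀ (a : A) n, a • v n = 0 ↔ a ∈ powIdeal z fun _ => n) :
    Module.Finite A (Q →ₗ[A] E) := by
  have hdiv : ∀ w : Q →ₗ[A] E, w (v 1) = 0 → w ∈ (maximalIdeal A • ⊤ : Submodule A (Q →ₗ[A] E)) := by
    intro w hw
    obtain ⟨ψ, rfl⟩ := hE.exists_eq_sum_smul Finset.univ z w (by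
      intro q hq
      obtain ⟨n, hn, a, rfl⟩ := hsurj q 1
      have ha : a ∈ Ideal.span {∏ i, z i ^ (n - 1)} ⊔ powIdeal z (fun _ => n) := by
        refine hz.mem_sup_of_pow_mul_mem Finset.univ hn fun i _ => ?_
        rw [pow_one, ← hker, mul_smul]
        exact hq i (Finset.mem_univ i)
      obtain ⟨b, c, hc, rfl⟩ := Ideal.mem_span_singleton_sup.mp ha
      rw [add_smul, (hker c n).mpr hc, add_zero, Finset.prod_pow, mul_smul,
        prod_pow_smul_directed hv hn, map_smul, hw, smul_zero])
    exact Submodule.sum_mem _ fun i _ => Submodule.smul_mem_smul (hzm i) trivial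
  have hhaus : IsHausdorff (maximalIdeal A) (Q →ₗ[A] E) := by
    constructor
    intro w hw
    ext q
    obtain ⟨n, -, a, rfl⟩ := hsurj q 0
    obtain ⟨M, hM⟩ := exists_pow_le_powIdeal hN (fun _ => n)
    have h1 := hw M
    rw [SModEq.zero] at h1
    suffices w (v n) = 0 by simp [this]
    have : maximalIdeal A ^ M • ⊤ ≤ LinearMap.ker (LinearMap.applyₗ (R := A) (M₂ := E) (v n)) := by
      rw [Submodule.smul_le]
      intro r hr w' _
      rw [LinearMap.mem_ker, LinearMap.applyₗ_apply_apply, LinearMap.smul_apply, ← map_smul,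
        (hker r n).mpr (hM hr), map_zero]
    exact this h1
  let ev : (Q →ₗ[A] E) →ₗ[A] E := LinearMap.applyₗ (R := A) (M₂ := E) (v 1)
  have hfg : (LinearMap.range ev).FG := by
    refine fg_of_pow_maximalIdeal_smul hess hσ N _ ?_
    rintro _ ⟨w, rfl⟩ a ha
    have : a • v 1 = 0 := (hker a 1).mpr (by simpa [powIdeal] using hN ha)
    rw [LinearMap.applyₗ_apply_apply, ← map_smul, this, map_zero]
  obtain ⟨k, s, hs⟩ := Submodule.fg_iff_exists_fin_generating_family.mp hfg
  have hs' : ∀ i, ∃ w, ev w = s i := fun i => by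
    have : s i ∈ LinearMap.range ev := hs ▸ Submodule.subset_span ⟨i, rfl⟩
    exact this
  choose w hw using hs'
  let f : (Fin k → A) →ₗ[A] (Q →ₗ[A] E) := Fintype.linearCombination A w
  have := isPrecomplete_pi (maximalIdeal A) k
  have hf : Function.Surjective f := by
    apply surjective_of_mkQ_comp_surjective (I := maximalIdeal A)
    intro q
    obtain ⟨u, rfl⟩ := Submodule.mkQ_surjective _ q
    have hu : ev u ∈ Submodule.span A (Set.range s) := hs ▸ ⟨u, rfl⟩
    rw [Submodule.mem_span_range_iff_exists_fun] at hu
    obtain ⟨c, hc⟩ := hu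
    refine ⟨c, ?_⟩
    rw [LinearMap.comp_apply, ← sub_eq_zero, ← map_sub, Submodule.mkQ_apply,
      Submodule.Quotient.mk_eq_zero]
    apply hdiv
    change ev (f c - u) = 0
    rw [map_sub, Fintype.linearCombination_apply, map_sum, sub_eq_zero, ← hc]
    exact Finset.sum_congr rfl fun i _ => by rw [map_smul, hw]
  exact Module.Finite.of_surjective f hf

end Dual

section CompleteLocal
open IsLocalRing

theorem exists_prod_pow_mem_of_isAdicComplete {A : Type u} [CommRing A] [IsLocalRing A]
    [IsNoetherianRing A] [IsDomain A] [IsAdicComplete (maximalIdeal A) A] {κ : Type} [Fintype κ]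
    [DecidableEq κ] {z : κ → A} (hz : PowIndependent z) (hz0 : ∀ i, z i ≠ 0)
    (hzm : ∀ i, z i ∈ maximalIdeal A) {N₀ : ℕ}
    (hN₀ : maximalIdeal A ^ N₀ ≤ Ideal.span (Set.range z))
    (hdim : ∀ r : A, r ≠ 0 → ringKrullDim (A ⧸ Ideal.span {r}) < (Fintype.card κ : ℕ))
    (o : κ) (b : ℕ → Ideal A)
    (hb : ∀ n, ∀ a ∈ b n, (∏ i ∈ Finset.univ.erase o, z i) * a ∈ b (n + 1))
    (hbz : ∀ n, ∀ i ≠ o, z i ^ n ∈ b n)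
    (hbt : ∀ n, ∃ t ∈ b n, t ∉ Ideal.span (z '' {o}ᶜ)) (k : ℕ) :
    ∃ N ≥ k, (∏ i, z i) ^ (N - k) ∈ b N ⊔ Ideal.span {z o ^ N} := by
  set g := ∏ i, z i with hg
  set X := ∏ i ∈ Finset.univ.erase o, z i with hX
  have hgX : g = z o * X := (Finset.mul_prod_erase Finset.univ z (Finset.mem_univ o)).symm
  by_contra! hcon
  obtain ⟨Q, _, _, v, hv, hsurj, hker⟩ := exists_directed_module hz hz0
  obtain ⟨E, _, _, σ, hE, hσ, hmσ, hess⟩ := exists_injective_hull_residueField A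
  have hfin := finite_dual_of_directed hE hess hσ hz hzm hN₀ hv hsurj hker
  have hbX : ∀ n j, ∀ a ∈ b n, X ^ j * a ∈ b (n + j) := by
    intro n j a ha
    induction j with
    | zero => simpa using ha
    | succ j ih => rw [pow_succ', mul_assoc]; exact hb _ _ ih
  let J : ℕ → Ideal A := fun n => b n ⊔ Ideal.span {z o ^ n}
  have hJ : ∀ j n, ∀ a ∈ J n, g ^ j * a ∈ J (n + j) := by
    intro j n a ha
    rw [show J n = Ideal.span {z o ^ n} ⊔ b n from sup_comm _ _, Ideal.mem_span_singleton_sup] at ha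
    obtain ⟨c, d, hd, rfl⟩ := ha
    rw [hgX, mul_add, mul_pow]
    refine Ideal.add_mem _ (Ideal.mem_sup_right ?_) (Ideal.mem_sup_left ?_)
    · exact Ideal.mem_span_singleton.mpr ⟨X ^ j * c, by ring⟩
    · rw [mul_assoc]
      exact Ideal.mul_mem_left _ _ (hbX _ _ _ hd)
  have hIJ : ∀ n, powIdeal z (fun _ => n) ≤ J n := by
    intro n
    rw [powIdeal_le]
    intro i
    by_cases hi : i = o
    · subst hi
      exact Ideal.mem_sup_right (Ideal.mem_span_singleton_self _)
    · exact Ideal.mem_sup_left (hbz n i hi)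
  let Y : Submodule A Q :=
    { carrier := {q | ∃ n, ∃ a ∈ J n, q = a • v n}
      zero_mem' := ⟨0, 0, Ideal.zero_mem _, by simp⟩
      add_mem' := by
        rintro _ _ ⟨n, a, ha, rfl⟩ ⟨m, c, hc, rfl⟩
        refine ⟨n + m, g ^ m * a + g ^ n * c, Ideal.add_mem _ (hJ _ _ _ ha) ?_, ?_⟩
        · rw [add_comm n m]; exact hJ _ _ _ hc
        · rw [add_smul, mul_comm, mul_smul, mul_comm (g ^ n), mul_smul]
          have h1 := prod_pow_smul_directed hv (Nat.le_add_right n m)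
          have h2 := prod_pow_smul_directed hv (Nat.le_add_left m n)
          rw [Nat.add_sub_cancel_left] at h1
          rw [Nat.add_sub_cancel] at h2
          rw [h1, h2]
      smul_mem' := by
        rintro c _ ⟨n, a, ha, rfl⟩
        exact ⟨n, c * a, Ideal.mul_mem_left _ _ ha, by rw [mul_smul]⟩ }
  have hvY : v k ∉ Y := by
    rintro ⟨n, a, ha, h⟩
    let N := n + k
    have h1 : (g ^ (N - k) - g ^ (N - n) * a) • v N = 0 := by
      rw [sub_smul, prod_pow_smul_directed hv (Nat.le_add_left k n), mul_comm, mul_smul,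
        prod_pow_smul_directed hv (Nat.le_add_right n k), h, sub_self]
    rw [hker] at h1
    have h2 : g ^ (N - n) * a ∈ J N := by
      have := hJ k n a ha
      rwa [show N - n = k from Nat.add_sub_cancel_left ..]
    refine hcon N (Nat.le_add_left k n) ?_
    have := Ideal.add_mem _ (hIJ N h1) h2
    rwa [sub_add_cancel] at this
  obtain ⟨M, hM⟩ := exists_pow_le_powIdeal hN₀ (fun _ => k)
  obtain ⟨f, hf⟩ := exists_functional_ne_zero hE hσ hmσ (M := Q ⧸ Y) (u := Y.mkQ (v k))
    (by rwa [Ne, Submodule.mkQ_apply, Submodule.Quotient.mk_eq_zero]) (N := M) (by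
      intro a ha
      rw [← map_smul, (hker a k).mpr (hM ha), map_zero])
  let w : Q →ₗ[A] E := f ∘ₗ Y.mkQ
  have hw0 : w ≠ 0 := by
    intro h
    apply hf
    ext q
    exact LinearMap.congr_fun h q
  have hwY : ∀ n, ∀ a ∈ b n, w (a • v n) = 0 := by
    intro n a ha
    have : a • v n ∈ Y := ⟨n, a, Ideal.mem_sup_left ha, rfl⟩
    rw [LinearMap.comp_apply, Submodule.mkQ_apply, (Submodule.Quotient.mk_eq_zero Y).mpr this,
      map_zero]
  set K := Ideal.span (z '' {o}ᶜ) with hK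
  have htw : ∀ n, ∀ t ∈ b n, t • w ∈ (K ^ n • ⊤ : Submodule A (Q →ₗ[A] E)) := by
    intro n t ht
    obtain ⟨ψ, hψ⟩ := hE.exists_eq_sum_smul (Finset.univ.erase o) (fun i => z i ^ n) (t • w) (by
      intro q hq
      obtain ⟨N, hN, a, rfl⟩ := hsurj q n
      have ha := hz.mem_sup_of_pow_mul_mem (Finset.univ.erase o) hN (a := a) fun i hi => by
        rw [← hker, mul_smul]
        exact hq i hi
      obtain ⟨c, e, he, rfl⟩ := Ideal.mem_span_singleton_sup.mp ha
      rw [add_smul, (hker e N).mpr he, add_zero, Finset.prod_pow, LinearMap.smul_apply, ← map_smul,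
        smul_smul, show t * (c * X ^ (N - n)) = c * (X ^ (N - n) * t) by ring, mul_smul, map_smul,
        hwY N _ (by simpa [Nat.add_sub_cancel' hN] using hbX n (N - n) t ht), smul_zero])
    rw [hψ]
    refine Submodule.sum_mem _ fun i hi => Submodule.smul_mem_smul (Ideal.pow_mem_pow ?_ n) trivial
    exact Ideal.subset_span ⟨i, by simpa using hi, rfl⟩
  obtain ⟨c, hc⟩ := Ideal.exists_pow_inf_eq_pow_smul K (Submodule.span A {w})
  obtain ⟨t, ht, htK⟩ := hbt (c + 1)
  have h1 : t • w ∈ (K ^ (c + 1) • ⊤ ⊓ Submodule.span A {w} : Submodule A (Q →ₗ[A] E)) :=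
    ⟨htw _ t ht, Submodule.smul_mem _ _ (Submodule.mem_span_singleton_self w)⟩
  rw [hc (c + 1) (by omega), Nat.add_sub_cancel_left, pow_one] at h1
  have h2 := Submodule.smul_mono (le_refl K) (inf_le_right :
    (K ^ c • ⊤ ⊓ Submodule.span A {w} : Submodule A (Q →ₗ[A] E)) ≤ _) h1
  rw [Submodule.mem_smul_span_singleton] at h2
  obtain ⟨ξ, hξ, hξw⟩ := h2
  have hr0 : t - ξ ≠ 0 := fun h => htK (by rwa [sub_eq_zero.mp h])
  have hrw : (t - ξ) • w = 0 := by rw [sub_smul, hξw, sub_self]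
  apply hw0
  ext q
  obtain ⟨n, -, a, rfl⟩ := hsurj q 0
  obtain ⟨N, hN, hmem⟩ := exists_prod_pow_mem_of_ringKrullDim_lt z Finset.univ
    (Ideal.span {t - ξ}) (by simpa using hdim _ hr0) n
  obtain ⟨r, e, he, hre⟩ := Ideal.mem_span_singleton_sup.mp hmem
  rw [map_smul, ← prod_pow_smul_directed hv hN, ← hre, add_smul,
    (hker e N).mpr (by simpa [powIdeal] using he), add_zero, mul_comm, mul_smul, map_smul,
    ← LinearMap.smul_apply, hrw]
  simp

end CompleteLocal

section

open IsLocalRing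

theorem ringKrullDim_le_card_of_pow_le {A : Type*} [CommRing A] [IsLocalRing A]
    [IsNoetherianRing A] {κ : Type*} [Fintype κ] {z : κ → A} (hzm : ∀ i, z i ∈ maximalIdeal A)
    {N : ℕ} (hN : maximalIdeal A ^ N ≤ Ideal.span (Set.range z)) :
    ringKrullDim A ≤ (Fintype.card κ : ℕ) := by
  have hmin : maximalIdeal A ∈ (Ideal.span (Set.range z)).minimalPrimes := by
    refine ⟨⟨inferInstance, ?_⟩, ?_⟩
    · rw [Ideal.span_le]
      rintro _ ⟨i, rfl⟩
      exact hzm i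
    · rintro p ⟨hp, hzp⟩ -
      exact Ideal.IsPrime.le_of_pow_le (hN.trans hzp)
  rw [← maximalIdeal_height_eq_ringKrullDim]
  have h1 := Ideal.height_le_card_of_mem_minimalPrimes_span (Set.finite_range z) hmin
  have h2 : (Set.range z).ncard ≤ Fintype.card κ := by
    rw [← Set.image_univ]
    refine (Set.ncard_image_le Set.finite_univ).trans ?_
    simp
  exact_mod_cast h1.trans (by exact_mod_cast h2)

theorem ringKrullDim_quotient_span_singleton_lt {A : Type*} [CommRing A] [IsDomain A] {n : ℕ}
    (h : ringKrullDim A ≤ n) {r : A} (hr : r ≠ 0) :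
    ringKrullDim (A ⧸ Ideal.span {r}) < n := by
  have h1 := (ringKrullDim_quotient_succ_le_of_nonZeroDivisor
    (mem_nonZeroDivisors_of_ne_zero hr)).trans h
  by_contra! hcon
  have h2 := (add_le_add_left hcon 1).trans h1
  have : ((n + 1 : ℕ) : WithBot ℕ∞) ≤ (n : ℕ) := by push_cast; exact h2
  have h3 : ((n + 1 : ℕ) : ℕ∞) ≤ (n : ℕ) := by exact_mod_cast this
  have h4 : n + 1 ≤ n := by exact_mod_cast h3
  omega

theorem PowIndependent.map {R A : Type*} [CommRing R] [CommRing A] [Algebra R A] [Module.Flat R A]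
    {κ : Type*} {z : κ → R} (hz : PowIndependent z) :
    PowIndependent fun i => algebraMap R A (z i) := by
  intro i n a h
  set J : Ideal R := Ideal.span ((fun j => z j ^ n j) '' {i}ᶜ) with hJ
  have hmap : Ideal.span ((fun j => algebraMap R A (z j) ^ n j) '' {i}ᶜ) = J.map (algebraMap R A) := by
    rw [hJ, Ideal.map_span, Set.image_image]
    simp
  rw [hmap] at h ⊢
  obtain ⟨l, f, g, hfg⟩ := Submodule.mem_span_set'.mp h
  have hg : ∀ j, ∃ r ∈ J, algebraMap R A r = g j := fun j => (g j).2
  choose r hr hrg using hg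
  have hrel : ∑ j : Option (Fin l), (j.elim (z i) (fun j => -r j) : R) • (j.elim a f : A) = 0 := by
    rw [Fintype.sum_option]
    simp only [Option.elim, Algebra.smul_def, map_neg, neg_mul, Finset.sum_neg_distrib, hrg]
    rw [← hfg, add_neg_eq_zero]
    exact Finset.sum_congr rfl fun j _ => by rw [smul_eq_mul, mul_comm]
  obtain ⟨k, c, y, hy, hc⟩ := Module.Flat.isTrivialRelation_of_sum_smul_eq_zero (R := R) (M := A)
    (f := fun j : Option (Fin l) => j.elim (z i) fun j => -r j) (x := fun j => j.elim a f) hrel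
  have ha := hy none
  simp only [Option.elim] at ha
  rw [ha]
  refine Submodule.sum_mem _ fun j _ => ?_
  rw [Algebra.smul_def]
  refine Ideal.mul_mem_right _ _ (Ideal.mem_map_of_mem _ (hz i n _ ?_))
  have hcj := hc j
  rw [Fintype.sum_option] at hcj
  simp only [Option.elim, neg_mul, Finset.sum_neg_distrib] at hcj
  rw [add_neg_eq_zero] at hcj
  rw [hcj]
  exact Submodule.sum_mem _ fun j _ => Ideal.mul_mem_right _ _ (hr j)

/-- The combinatorial core of the Hartshorne-Lichtenbaum vanishing theorem. -/
theorem exists_prod_pow_mem_of_isDomain_adicCompletion {R : Type u} [CommRing R] [IsLocalRing R]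
    [IsNoetherianRing R] [IsDomain (AdicCompletion (maximalIdeal R) R)] {κ : Type} [Fintype κ]
    [DecidableEq κ] {z : κ → R} (hz : PowIndependent z) (hz0 : ∀ i, z i ≠ 0)
    (hzm : ∀ i, z i ∈ maximalIdeal R) {N₀ : ℕ}
    (hN₀ : maximalIdeal R ^ N₀ ≤ Ideal.span (Set.range z))
    (o : κ) (b : ℕ → Ideal R)
    (hb : ∀ n, ∀ a ∈ b n, (∏ i ∈ Finset.univ.erase o, z i) * a ∈ b (n + 1))
    (hbz : ∀ n, ∀ i ≠ o, z i ^ n ∈ b n)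
    (hbt : ∀ n, ∃ t ∈ b n, t ∉ Ideal.span (z '' {o}ᶜ)) (k : ℕ) :
    ∃ N ≥ k, (∏ i, z i) ^ (N - k) ∈ b N ⊔ Ideal.span {z o ^ N} := by
  let A := AdicCompletion (maximalIdeal R) R
  have hA : IsNoetherianRing A := isNoetherianRing_adicCompletion_maximalIdeal R
  have hff : Module.FaithfullyFlat R A := Module.FaithfullyFlat.of_flat_of_isLocalHom
  let φ := algebraMap R A
  have hcomap : ∀ (J : Ideal R) (a : R), φ a ∈ J.map φ → a ∈ J := by
    intro J a ha
    rw [← Ideal.comap_map_eq_self_of_faithfullyFlat (B := A) J]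
    exact ha
  have hinj : Function.Injective φ := FaithfulSMul.algebraMap_injective R A
  have hzm' : ∀ i, φ (z i) ∈ maximalIdeal A := fun i => by
    rw [AdicCompletion.maximalIdeal_eq_map]
    exact Ideal.mem_map_of_mem _ (hzm i)
  have hN₀' : maximalIdeal A ^ N₀ ≤ Ideal.span (Set.range fun i => φ (z i)) := by
    rw [AdicCompletion.maximalIdeal_eq_map, ← Ideal.map_pow]
    refine (Ideal.map_mono hN₀).trans ?_
    rw [Ideal.map_span, ← Set.range_comp]
    rfl
  obtain ⟨N, hN, h⟩ := exists_prod_pow_mem_of_isAdicComplete (A := A) (z := fun i => φ (z i))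
    hz.map (fun i => by simpa [map_eq_zero_iff φ hinj] using hz0 i) hzm' hN₀'
    (fun r hr => ringKrullDim_quotient_span_singleton_lt
      (ringKrullDim_le_card_of_pow_le hzm' hN₀') hr) o (fun n => (b n).map φ)
    (fun n => by
      suffices (b n).map φ ≤ Submodule.comap (LinearMap.mulLeft A
        (∏ i ∈ Finset.univ.erase o, φ (z i))) ((b (n + 1)).map φ) from fun a ha => this ha
      rw [Ideal.map_le_iff_le_comap]
      intro a ha
      rw [Ideal.mem_comap, Submodule.mem_comap, LinearMap.mulLeft_apply, ← map_prod, ← map_mul]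
      exact Ideal.mem_map_of_mem _ (hb n a ha))
    (fun n i hi => by
      rw [← map_pow]
      exact Ideal.mem_map_of_mem _ (hbz n i hi))
    (fun n => by
      obtain ⟨t, ht, hto⟩ := hbt n
      refine ⟨φ t, Ideal.mem_map_of_mem _ ht, fun h => hto (hcomap _ _ ?_)⟩
      rwa [Ideal.map_span, Set.image_image]) k
  refine ⟨N, hN, hcomap _ _ ?_⟩
  rw [Ideal.map_sup, Ideal.map_span, Set.image_singleton]
  simpa using h

end

section

open IsLocalRing RingTheory.Sequence

theorem PowIndependent.of_forall_finset {A : Type*} [CommRing A] {κ : Type*} [Finite κ] {z : κ → A}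
    (h : ∀ (S : Finset κ) (i : κ), i ∉ S → ∀ a, z i * a ∈ Ideal.span (z '' S) →
      a ∈ Ideal.span (z '' S)) : PowIndependent z := by
  classical
  cases nonempty_fintype κ
  have key : ∀ (s : ℕ) (S : Finset κ) (n : κ → ℕ), S.card + ∑ j ∈ S, n j ≤ s → ∀ i ∉ S, ∀ a,
      z i * a ∈ Ideal.span ((fun j => z j ^ n j) '' S) →
        a ∈ Ideal.span ((fun j => z j ^ n j) '' S) := by
    intro s
    induction s with
    | zero =>
      intro S n hs i hi a ha
      have : S = ∅ := Finset.card_eq_zero.mp (by omega)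
      subst this
      simpa using h ∅ i hi a (by simpa using ha)
    | succ s ih =>
      intro S n hs i hi a ha
      by_cases h0 : ∃ j ∈ S, n j = 0
      · obtain ⟨j, hj, hj0⟩ := h0
        have : (1 : A) ∈ Ideal.span ((fun j => z j ^ n j) '' (S : Set κ)) :=
          Ideal.subset_span ⟨j, hj, by simp [hj0]⟩
        rw [(Ideal.eq_top_iff_one _).mpr this]
        trivial
      by_cases h1 : ∀ j ∈ S, n j = 1
      · have : (fun j => z j ^ n j) '' (S : Set κ) = z '' S :=
          Set.image_congr fun j hj => by rw [h1 j hj, pow_one]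
        rw [this] at ha ⊢
        exact h S i hi a ha
      push Not at h0 h1
      obtain ⟨j, hj, hj1⟩ := h1
      have hj0 := h0 j hj
      set K := Ideal.span ((fun j => z j ^ n j) '' (S.erase j : Set κ)) with hK
      have hsplit : ∀ m, Ideal.span ((fun l => z l ^ (Function.update n j m) l) '' (S : Set κ)) =
          Ideal.span {z j ^ m} ⊔ K := by
        intro m
        rw [hK, ← Ideal.span_union]
        congr 1
        conv_lhs => rw [← Finset.insert_erase hj, Finset.coe_insert, Set.image_insert_eq]
        rw [Set.singleton_union]
        congr 1
        · simp
        · refine Set.image_congr fun l hl => ?_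
          have : l ≠ j := (Finset.mem_erase.mp hl).1
          simp [this]
      have hsplit' := hsplit (n j)
      rw [Function.update_eq_self] at hsplit'
      have hsum : ∀ m < n j, S.card + ∑ l ∈ S, Function.update n j m l ≤ s := by
        intro m hm
        rw [Finset.sum_update_of_mem hj]
        rw [← Finset.add_sum_erase S n hj] at hs
        rw [← Finset.erase_eq]
        omega
      have hKj : ∀ b, z j * b ∈ K → b ∈ K := by
        intro b hb
        refine ih (S.erase j) n ?_ j (Finset.notMem_erase j S) b hb
        rw [Finset.card_erase_of_mem hj]
        rw [← Finset.add_sum_erase S n hj] at hs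
        have := Finset.card_pos.mpr ⟨j, hj⟩
        omega
      have hKj' : ∀ k b, z j ^ k * b ∈ K → b ∈ K := by
        intro k
        induction k with
        | zero => simp
        | succ k ihk =>
          intro b hb
          exact ihk b (hKj _ (by rwa [← mul_assoc, ← pow_succ']))
      rw [hsplit'] at ha ⊢
      have hle : Ideal.span {z j ^ n j} ⊔ K ≤ Ideal.span {z j ^ (n j - 1)} ⊔ K := by
        refine sup_le_sup_right ?_ K
        rw [Ideal.span_singleton_le_span_singleton]
        exact pow_dvd_pow _ (Nat.sub_le _ _)
      have ha' : a ∈ Ideal.span {z j ^ (n j - 1)} ⊔ K := by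
        rw [← hsplit]
        refine ih S _ (hsum _ (by omega)) i hi a ?_
        rw [hsplit]
        exact hle ha
      obtain ⟨a', c, hc, rfl⟩ := Ideal.mem_span_singleton_sup.mp ha'
      obtain ⟨e, f, hf, hef⟩ := Ideal.mem_span_singleton_sup.mp ha
      have hpow : z j ^ n j = z j ^ (n j - 1) * z j := by rw [← pow_succ]; congr 1; omega
      have h2 : z i * a' - z j * e ∈ K := by
        apply hKj' (n j - 1)
        have : z j ^ (n j - 1) * (z i * a' - z j * e) = f - z i * c := by
          rw [hpow] at hef
          linear_combination -hef
        rw [this]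
        exact Ideal.sub_mem _ hf (Ideal.mul_mem_left _ _ hc)
      have h3 : a' ∈ Ideal.span {z j ^ 1} ⊔ K := by
        rw [← hsplit]
        refine ih S _ (hsum 1 (by omega)) i hi a' ?_
        rw [hsplit, Ideal.mem_span_singleton_sup]
        exact ⟨e, _, h2, by ring⟩
      obtain ⟨p, q, hq, rfl⟩ := Ideal.mem_span_singleton_sup.mp h3
      refine Ideal.mem_span_singleton_sup.mpr ⟨p, q * z j ^ (n j - 1) + c,
        Ideal.add_mem _ (Ideal.mul_mem_right _ _ hq) hc, ?_⟩
      rw [hpow]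
      ring
  intro i n a ha
  have hcompl : ((Finset.univ.erase i : Finset κ) : Set κ) = {i}ᶜ := by ext; simp
  rw [← hcompl] at ha ⊢
  exact key _ _ n le_rfl i (by simp) a ha

theorem powIndependent_get_of_isRegular {R : Type*} [CommRing R] [IsLocalRing R]
    [IsNoetherianRing R] {rs : List R} (h : IsWeaklyRegular R rs)
    (hm : ∀ r ∈ rs, r ∈ maximalIdeal R) : PowIndependent rs.get := by
  apply PowIndependent.of_forall_finset
  intro S i hi a ha
  let l := S.toList ++ i :: ((insert i S)ᶜ : Finset (Fin rs.length)).toList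
  have hl : l.Perm (List.finRange rs.length) := by
    rw [List.perm_ext_iff_of_nodup _ (List.nodup_finRange _)]
    · intro j
      simp only [l, List.mem_append, Finset.mem_toList, List.mem_cons, Finset.mem_compl,
        Finset.mem_insert, List.mem_finRange, iff_true]
      tauto
    · rw [List.nodup_append]
      refine ⟨S.nodup_toList, ?_, ?_⟩
      · rw [List.nodup_cons]
        exact ⟨by simp, Finset.nodup_toList _⟩
      · intro x hx y hy hxy
        subst hxy
        simp only [Finset.mem_toList, List.mem_cons, Finset.mem_compl, Finset.mem_insert] at hx hy
        rcases hy with rfl | hy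
        · exact hi hx
        · tauto
  have hp : (l.map rs.get).Perm rs := by
    conv_rhs => rw [← List.map_get_finRange rs]
    exact hl.map _
  have hreg := IsLocalRing.isWeaklyRegular_of_perm_of_subset_maximalIdeal h hp.symm hm
  rw [isWeaklyRegular_iff] at hreg
  have hlen : S.card < (l.map rs.get).length := by simp [l]
  have h1 := hreg S.card hlen
  have h2 : (l.map rs.get)[S.card] = rs.get i := by simp [l]
  have h3 : (l.map rs.get).take S.card = S.toList.map rs.get := by
    rw [← List.map_take]
    simp [l]
  have h4 : (Ideal.ofList (S.toList.map rs.get) • ⊤ : Submodule R R) = Ideal.span (rs.get '' S) := by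
    rw [smul_eq_mul, Ideal.mul_top, Ideal.ofList]
    congr 1
    ext x
    simp
  rw [h2, h3, h4] at h1
  have h5 : rs.get i • (Submodule.Quotient.mk a : R ⧸ (Ideal.span (rs.get '' S))) = rs.get i • 0 := by
    rw [smul_zero, ← Submodule.Quotient.mk_smul]
    exact (Submodule.Quotient.mk_eq_zero _).mpr ha
  exact (Submodule.Quotient.mk_eq_zero _).mp (h1 h5)

end

/-- The submodule of elements killed by a power of the ideal `a`. -/
def idealTorsion {R : Type*} [CommRing R] (a : Ideal R) (M : Type*) [AddCommGroup M] [Module R M] :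
    Submodule R M where
  carrier := {e | ∃ n, ∀ r ∈ a ^ n, r • e = 0}
  zero_mem' := ⟨0, fun r _ => smul_zero r⟩
  add_mem' := by
    rintro e f ⟨n, hn⟩ ⟨m, hm⟩
    refine ⟨n + m, fun r hr => ?_⟩
    rw [smul_add, hn r (Ideal.pow_le_pow_right (Nat.le_add_right n m) hr),
      hm r (Ideal.pow_le_pow_right (Nat.le_add_left m n) hr), add_zero]
  smul_mem' := by
    rintro c e ⟨n, hn⟩
    exact ⟨n, fun r hr => by rw [smul_comm, hn r hr, smul_zero]⟩

section IdealTorsion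
variable {R : Type*} [CommRing R] {a b c : Ideal R} {M M' : Type*} [AddCommGroup M] [Module R M]
  [AddCommGroup M'] [Module R M']

theorem mem_idealTorsion {e : M} : e ∈ idealTorsion a M ↔ ∃ n, ∀ r ∈ a ^ n, r • e = 0 := Iff.rfl

theorem idealTorsion_anti_of_pow_le {n : ℕ} (h : b ^ n ≤ a) :
    idealTorsion a M ≤ idealTorsion b M := by
  rintro e ⟨m, hm⟩
  refine ⟨n * m, fun r hr => hm r ?_⟩
  rw [pow_mul] at hr
  exact Ideal.pow_right_mono h m hr

theorem idealTorsion_anti (h : b ≤ a) : idealTorsion a M ≤ idealTorsion b M :=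
  idealTorsion_anti_of_pow_le (n := 1) (by simpa using h)

theorem map_mem_idealTorsion (f : M →ₗ[R] M') {e : M} (he : e ∈ idealTorsion a M) :
    f e ∈ idealTorsion a M' := by
  obtain ⟨n, hn⟩ := he
  exact ⟨n, fun r hr => by rw [← map_smul, hn r hr, map_zero]⟩

theorem mem_idealTorsion_sup {e : M} (ha : e ∈ idealTorsion a M) (hb : e ∈ idealTorsion b M) :
    e ∈ idealTorsion (a ⊔ b) M := by
  obtain ⟨n, hn⟩ := ha
  obtain ⟨m, hm⟩ := hb
  refine ⟨n + m, fun r hr => ?_⟩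
  obtain ⟨s, hs, t, ht, rfl⟩ := Submodule.mem_sup.mp (Ideal.sup_pow_add_le_pow_sup_pow hr)
  rw [add_smul, hn s hs, hm t ht, add_zero]

theorem mem_idealTorsion_span_singleton {e : M} {y : R} {k : ℕ} (h : y ^ k • e = 0) :
    e ∈ idealTorsion (Ideal.span {y}) M := by
  refine ⟨k, fun r hr => ?_⟩
  rw [Ideal.span_singleton_pow, Ideal.mem_span_singleton] at hr
  obtain ⟨s, rfl⟩ := hr
  rw [mul_comm, mul_smul, h, smul_zero]

theorem exists_pow_smul_eq_zero {e : M} (h : e ∈ idealTorsion a M) {y : R} (hy : y ∈ a) :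
    ∃ k, y ^ k • e = 0 := by
  obtain ⟨n, hn⟩ := h
  exact ⟨n, hn _ (Ideal.pow_mem_pow hy n)⟩

theorem idealTorsion_bot : idealTorsion (⊥ : Ideal R) M = ⊤ := by
  rw [eq_top_iff]
  intro e _
  refine ⟨1, fun r hr => ?_⟩
  have : r = 0 := by simpa using hr
  rw [this, zero_smul]

/-- If `v b ^ L ⊆ a` then some power of `v` moves `a`-torsion into `b`-torsion. -/
theorem exists_pow_smul_mem_idealTorsion {v : R} {L : ℕ} (h : ∀ w ∈ b ^ L, v * w ∈ a) {e : M}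
    (he : e ∈ idealTorsion a M) : ∃ l, v ^ l • e ∈ idealTorsion b M := by
  obtain ⟨l, hl⟩ := he
  refine ⟨l, L * l, fun r hr => ?_⟩
  rw [smul_smul, mul_comm]
  apply hl
  have h1 : Ideal.span {v} * b ^ L ≤ a := by
    rw [Ideal.mul_le]
    intro r hr s hs
    obtain ⟨t, rfl⟩ := Ideal.mem_span_singleton.mp hr
    rw [show v * t * s = t * (v * s) by ring]
    exact Ideal.mul_mem_left _ _ (h s hs)
  have h2 := Ideal.pow_right_mono h1 l
  rw [mul_pow, ← pow_mul] at h2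
  exact h2 (Ideal.mul_mem_mul (Ideal.pow_mem_pow (Ideal.mem_span_singleton_self v) l) hr)

end IdealTorsion

/-- The torsion of an injective module over a Noetherian domain is divisible. -/
theorem Module.Injective.exists_smul_eq_of_mem_idealTorsion {R : Type u} [CommRing R] [IsDomain R]
    [IsNoetherianRing R] {E : Type u} [AddCommGroup E] [Module R E] (hE : Module.Injective R E)
    (a : Ideal R) {s : R} (hs : s ≠ 0) {e : E} (he : e ∈ idealTorsion a E) :
    ∃ e' ∈ idealTorsion a E, s • e' = e := by
  obtain ⟨n, hn⟩ := he
  obtain ⟨k, hk⟩ := Ideal.exists_pow_inf_eq_pow_smul a (Ideal.span {s})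
  obtain ⟨ψ, hψ⟩ := hE.exists_comp_eq ((a ^ (n + k)).mkQ ∘ₗ LinearMap.mulLeft R s)
    (LinearMap.toSpanSingleton R E e) (by
      intro r hr
      have h1 : s * r ∈ a ^ (n + k) := (Submodule.Quotient.mk_eq_zero _).mp hr
      have h2 : s * r ∈ (a ^ (n + k) • ⊤ ⊓ Ideal.span {s} : Ideal R) :=
        ⟨by simpa using h1, Ideal.mul_mem_right _ _ (Ideal.mem_span_singleton_self s)⟩
      rw [hk _ (Nat.le_add_left k n), Nat.add_sub_cancel] at h2
      have h3 := Submodule.smul_mono (le_refl (a ^ n)) (inf_le_right :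
        (a ^ k • ⊤ ⊓ Ideal.span {s} : Ideal R) ≤ _) h2
      rw [smul_eq_mul, mul_comm, Ideal.mem_span_singleton_mul] at h3
      obtain ⟨r', hr', h4⟩ := h3
      rw [mul_left_cancel₀ hs h4] at hr'
      exact hn r hr')
  refine ⟨ψ ((a ^ (n + k)).mkQ 1), ⟨n + k, fun r hr => ?_⟩, ?_⟩
  · rw [← map_smul, ← map_smul, smul_eq_mul, mul_one, Submodule.mkQ_apply,
      (Submodule.Quotient.mk_eq_zero _).mpr hr, map_zero]
  · have := hψ 1
    simp only [LinearMap.comp_apply, LinearMap.mulLeft_apply, LinearMap.toSpanSingleton_apply,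
      one_smul] at this
    rw [← this, ← map_smul, ← map_smul, smul_eq_mul]

/-- An injective resolution of the ring `R`, in terms of modules. -/
structure InjRes (R : Type u) [CommRing R] where
  E : ℕ → ModuleCat.{u} R
  d : ∀ j, E j →ₗ[R] E (j + 1)
  aug : R →ₗ[R] E 0
  injective : ∀ j, Module.Injective R (E j)
  aug_injective : Function.Injective aug
  exact_zero : ∀ e, d 0 e = 0 ↔ ∃ r, aug r = e
  exact_succ : ∀ j e, d (j + 1) e = 0 ↔ ∃ e', d j e' = e

namespace InjRes
variable {R : Type u} [CommRing R] (F : InjRes R)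

/-- Coboundaries of the `a`-torsion subcomplex. -/
def Bnd (a : Ideal R) : ∀ j, Submodule R (F.E j)
  | 0 => ⊥
  | j + 1 => (idealTorsion a (F.E j)).map (F.d j)

/-- Cocycles of the `a`-torsion subcomplex. -/
def Cyc (a : Ideal R) (j : ℕ) : Submodule R (F.E j) :=
  idealTorsion a (F.E j) ⊓ LinearMap.ker (F.d j)

variable {F} {a b c : Ideal R} {j : ℕ}

theorem d_d (e : F.E j) : F.d (j + 1) (F.d j e) = 0 := (F.exact_succ j _).mpr ⟨e, rfl⟩

theorem map_mem_Bnd {e : F.E j} (he : e ∈ idealTorsion a (F.E j)) : F.d j e ∈ F.Bnd a (j + 1) :=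
  ⟨e, he, rfl⟩

theorem Bnd_le_Cyc : F.Bnd a j ≤ F.Cyc a j := by
  cases j with
  | zero => exact bot_le
  | succ j =>
    rintro _ ⟨e, he, rfl⟩
    exact ⟨map_mem_idealTorsion _ he, d_d e⟩

theorem Bnd_anti_of_pow_le {n : ℕ} (h : b ^ n ≤ a) : F.Bnd a j ≤ F.Bnd b j := by
  cases j with
  | zero => exact bot_le
  | succ j => exact Submodule.map_mono (idealTorsion_anti_of_pow_le h)

theorem Bnd_anti (h : b ≤ a) : F.Bnd a j ≤ F.Bnd b j :=
  Bnd_anti_of_pow_le (n := 1) (by simpa using h)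

theorem Cyc_anti (h : b ≤ a) : F.Cyc a j ≤ F.Cyc b j :=
  inf_le_inf_right _ (idealTorsion_anti h)

theorem ofList_cons' (y : R) (xs : List R) :
    Ideal.ofList (y :: xs) = Ideal.ofList xs ⊔ Ideal.span {y} := by
  rw [Ideal.ofList_cons, sup_comm]

variable [IsDomain R] [IsNoetherianRing R]

theorem exists_smul_eq_of_mem_Bnd {s : R} (hs : s ≠ 0) {e : F.E j} (he : e ∈ F.Bnd a j) :
    ∃ e' ∈ F.Bnd a j, s • e' = e := by
  cases j with
  | zero => exact ⟨0, Submodule.zero_mem _, by rw [(Submodule.mem_bot R).mp he, smul_zero]⟩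
  | succ j =>
    obtain ⟨f, hf, rfl⟩ := he
    obtain ⟨f', hf', rfl⟩ := (F.injective j).exists_smul_eq_of_mem_idealTorsion a hs hf
    exact ⟨F.d j f', ⟨f', hf', rfl⟩, by rw [map_smul]⟩

theorem map_mem_Bnd_of_pow_smul_mem {y : R} (hy : y ≠ 0) {k : ℕ} {e : F.E j}
    (he : e ∈ idealTorsion c (F.E j)) (hye : y ^ k • e ∈ F.Bnd c j) :
    F.d j e ∈ F.Bnd (c ⊔ Ideal.span {y}) (j + 1) := by
  obtain ⟨b', hb', h⟩ := exists_smul_eq_of_mem_Bnd (pow_ne_zero k hy) hye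
  have h1 : F.d j e = F.d j (e - b') := by
    rw [map_sub, show F.d j b' = 0 from (Bnd_le_Cyc hb').2, sub_zero]
  rw [h1]
  apply map_mem_Bnd
  refine mem_idealTorsion_sup (Submodule.sub_mem _ he (Bnd_le_Cyc hb').1)
    (mem_idealTorsion_span_singleton (k := k) ?_)
  rw [smul_sub, h, sub_self]

/-- Local cohomology vanishes above the number of generators. -/
theorem Cyc_le_Bnd_of_card_lt (S : Finset R) {i : ℕ} (h : S.card < i) :
    F.Cyc (Ideal.span S) i ≤ F.Bnd (Ideal.span S) i := by
  classical
  induction S using Finset.induction_on generalizing i with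
  | empty =>
    obtain ⟨j, rfl⟩ : ∃ j, i = j + 1 := ⟨i - 1, by simp at h; omega⟩
    intro z hz
    obtain ⟨e, rfl⟩ := (F.exact_succ j z).mp hz.2
    refine map_mem_Bnd ?_
    rw [Finset.coe_empty, Ideal.span_empty, idealTorsion_bot]
    trivial
  | insert y S hyS ih =>
    rw [Finset.card_insert_of_notMem hyS] at h
    have hspan : Ideal.span ((insert y S : Finset R) : Set R) = Ideal.span S ⊔ Ideal.span {y} := by
      rw [Finset.coe_insert, Ideal.span_insert, sup_comm]
    rw [hspan]
    intro z hz
    have hz' : z ∈ F.Bnd (Ideal.span S) i := ih (by omega) (Cyc_anti le_sup_left hz)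
    by_cases hy : y = 0
    · subst hy
      simpa using hz'
    obtain ⟨j, rfl⟩ : ∃ j, i = j + 1 := ⟨i - 1, by omega⟩
    obtain ⟨e, he, rfl⟩ := hz'
    obtain ⟨k, hk⟩ := exists_pow_smul_eq_zero hz.1 (y := y)
      (Ideal.mem_sup_right (Ideal.mem_span_singleton_self y))
    refine map_mem_Bnd_of_pow_smul_mem hy (k := k) he (ih (by omega) ⟨Submodule.smul_mem _ _ he,
      LinearMap.mem_ker.mpr (by rw [map_smul, hk])⟩)

theorem Cyc_le_Bnd_ofList (xs : List R) {i : ℕ} (h : xs.length < i) :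
    F.Cyc (Ideal.ofList xs) i ≤ F.Bnd (Ideal.ofList xs) i := by
  classical
  have : Ideal.ofList xs = Ideal.span (xs.toFinset : Set R) := by
    rw [Ideal.ofList]
    congr 1
    ext
    simp
  rw [this]
  exact Cyc_le_Bnd_of_card_lt _ ((List.toFinset_card_le xs).trans_lt h)

variable (F) in
/-- A compatible system of representatives for the top local cohomology with support in the ideal
generated by `xs`. -/
structure IsSymbol (xs : List R) (g : ℕ → F.E xs.length) : Prop where
  mem : ∀ n, g n ∈ F.Cyc (Ideal.ofList xs) xs.length
  pow_smul : ∀ n, ∀ x ∈ xs, x ^ n • g n ∈ F.Bnd (Ideal.ofList xs) xs.length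
  sub_mem : ∀ n, g n - xs.prod • g (n + 1) ∈ F.Bnd (Ideal.ofList xs) xs.length
  exists_sub_mem : ∀ z ∈ F.Cyc (Ideal.ofList xs) xs.length, ∀ k, ∃ n ≥ k, ∃ r : R,
    z - r • g n ∈ F.Bnd (Ideal.ofList xs) xs.length

theorem IsSymbol.cons {xs : List R} {g : ℕ → F.E xs.length} (hg : F.IsSymbol xs g) {y : R}
    (hy : y ≠ 0) {e : ℕ → F.E xs.length}
    (he : ∀ n, e n ∈ idealTorsion (Ideal.ofList xs) (F.E xs.length))
    (heg : ∀ n, y ^ n • e n = g n) : F.IsSymbol (y :: xs) (fun n => F.d xs.length (e n)) := by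
  have hyn : ∀ n, y ^ n • F.d xs.length (e n) = 0 := fun n => by
    rw [← map_smul, heg]
    exact (hg.mem n).2
  constructor
  · intro n
    rw [ofList_cons']
    exact ⟨mem_idealTorsion_sup (map_mem_idealTorsion _ (he n))
      (mem_idealTorsion_span_singleton (hyn n)), d_d _⟩
  · intro n x hx
    rcases List.mem_cons.mp hx with rfl | hx
    · rw [hyn]
      exact Submodule.zero_mem _
    · rw [← map_smul, ofList_cons']
      refine map_mem_Bnd_of_pow_smul_mem hy (k := n) (Submodule.smul_mem _ _ (he n)) ?_
      rw [smul_comm, heg]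
      exact hg.pow_smul n x hx
  · intro n
    rw [← map_smul, ← map_sub, ofList_cons']
    refine map_mem_Bnd_of_pow_smul_mem hy (k := n)
      (Submodule.sub_mem _ (he n) (Submodule.smul_mem _ _ (he _))) ?_
    rw [List.prod_cons, smul_sub, heg, smul_smul, show y ^ n * (y * xs.prod) =
      xs.prod * y ^ (n + 1) by ring, mul_smul, heg]
    exact hg.sub_mem n
  · intro z hz k
    rw [ofList_cons'] at hz ⊢
    obtain ⟨f, hf, rfl⟩ := Cyc_le_Bnd_ofList xs (Nat.lt_succ_self _) (Cyc_anti le_sup_left hz)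
    obtain ⟨l, hl⟩ := exists_pow_smul_eq_zero hz.1 (y := y)
      (Ideal.mem_sup_right (Ideal.mem_span_singleton_self y))
    obtain ⟨n, hn, r, hr⟩ := hg.exists_sub_mem (y ^ l • f)
      ⟨Submodule.smul_mem _ _ hf, LinearMap.mem_ker.mpr (by rw [map_smul, hl])⟩ (max k l)
    refine ⟨n, (le_max_left _ _).trans hn, r * y ^ (n - l), ?_⟩
    rw [← map_smul, ← map_sub]
    refine map_mem_Bnd_of_pow_smul_mem hy (k := l)
      (Submodule.sub_mem _ hf (Submodule.smul_mem _ _ (he _))) ?_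
    rw [smul_sub, smul_smul, show y ^ l * (r * y ^ (n - l)) = r * y ^ (l + (n - l)) by ring,
      Nat.add_sub_cancel' ((le_max_right _ _).trans hn), mul_smul, heg]
    exact hr

theorem exists_isSymbol (xs : List R) (hx : ∀ x ∈ xs, x ≠ 0) : ∃ g, F.IsSymbol xs g := by
  induction xs with
  | nil =>
    refine ⟨fun _ => F.aug 1, ?_, ?_, ?_, ?_⟩
    · intro n
      refine ⟨?_, (F.exact_zero _).mpr ⟨1, rfl⟩⟩
      rw [Ideal.ofList_nil, idealTorsion_bot]
      trivial
    · simp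
    · intro n
      rw [List.prod_nil, one_smul, sub_self]
      exact Submodule.zero_mem _
    · intro z hz k
      obtain ⟨r, rfl⟩ := (F.exact_zero z).mp hz.2
      refine ⟨k, le_rfl, r, ?_⟩
      rw [← map_smul, smul_eq_mul, mul_one, sub_self]
      exact Submodule.zero_mem _
  | cons y xs ih =>
    obtain ⟨g, hg⟩ := ih fun x h => hx x (List.mem_cons_of_mem _ h)
    have hy := hx y List.mem_cons_self
    choose e he heg using fun n => (F.injective xs.length).exists_smul_eq_of_mem_idealTorsion
      (Ideal.ofList xs) (pow_ne_zero n hy) (hg.mem n).1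
    exact ⟨_, hg.cons hy he heg⟩

end InjRes

theorem Ideal.IsPrime.exists_notMem_forall_mem_finset {R α : Type*} [CommRing R] {P : Ideal R}
    (hP : P.IsPrime) (p : R → α → Prop) (hp : ∀ u v a, p v a → p (u * v) a) (T : Finset α)
    (h : ∀ a ∈ T, ∃ v ∉ P, p v a) : ∃ v ∉ P, ∀ a ∈ T, p v a := by
  classical
  induction T using Finset.induction_on with
  | empty => exact ⟨1, hP.one_notMem, by simp⟩
  | insert a T _ ih =>
    obtain ⟨v, hv, h1⟩ := ih fun b hb => h b (Finset.mem_insert_of_mem hb)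
    obtain ⟨u, hu, h2⟩ := h a (Finset.mem_insert_self a T)
    refine ⟨u * v, hP.mul_notMem hu hv, fun b hb => ?_⟩
    rcases Finset.mem_insert.mp hb with rfl | hb
    · rw [mul_comm]
      exact hp _ _ _ h2
    · exact hp _ _ _ (h1 b hb)

/-- If the prime `P` is minimal over `J`, locally at `P` some power of `P` is contained in `J`. -/
theorem Ideal.IsPrime.exists_notMem_forall_pow_mul_mem {R : Type*} [CommRing R]
    [IsNoetherianRing R] {P : Ideal R} (hP : P.IsPrime) {J : Ideal R}
    (h : ∀ p : Ideal R, p.IsPrime → J ≤ p → p ≤ P → p = P) :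
    ∃ v ∉ P, ∃ k, ∀ w ∈ P ^ k, v * w ∈ J := by
  let J' : Ideal R :=
    { carrier := {r | ∃ v ∉ P, v * r ∈ J}
      zero_mem' := ⟨1, hP.one_notMem, by simp⟩
      add_mem' := by
        rintro a b ⟨u, hu, hua⟩ ⟨v, hv, hvb⟩
        refine ⟨u * v, hP.mul_notMem hu hv, ?_⟩
        rw [show u * v * (a + b) = v * (u * a) + u * (v * b) by ring]
        exact J.add_mem (J.mul_mem_left _ hua) (J.mul_mem_left _ hvb)
      smul_mem' := by
        rintro c a ⟨u, hu, hua⟩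
        refine ⟨u, hu, ?_⟩
        rw [smul_eq_mul, show u * (c * a) = c * (u * a) by ring]
        exact J.mul_mem_left _ hua }
  have hrad : P ≤ J'.radical := by
    intro w hw
    by_contra hcon
    have hcon' : ∀ u ∉ P, ∀ k, u * w ^ k ∉ J := fun u hu k hk => hcon ⟨k, u, hu, hk⟩
    let S : Submonoid R :=
      { carrier := {r | ∃ u ∉ P, ∃ k, r = u * w ^ k}
        one_mem' := ⟨1, hP.one_notMem, 0, by simp⟩
        mul_mem' := by
          rintro _ _ ⟨u, hu, k, rfl⟩ ⟨v, hv, l, rfl⟩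
          exact ⟨u * v, hP.mul_notMem hu hv, k + l, by ring⟩ }
    have hd : Disjoint (J : Set R) (S : Set R) := by
      rw [Set.disjoint_left]
      rintro _ hr ⟨u, hu, k, rfl⟩
      exact hcon' u hu k hr
    obtain ⟨p, hp, hJp, hpS⟩ := Ideal.exists_le_prime_disjoint J S hd
    rw [Set.disjoint_left] at hpS
    have hpP : p = P := h p hp hJp fun r hr => by
      by_contra hrP
      exact hpS hr ⟨r, hrP, 0, by simp⟩
    exact hpS (hpP ▸ hw : w ∈ p) ⟨1, hP.one_notMem, 1, by simp⟩
  obtain ⟨k, hk⟩ := Ideal.exists_pow_le_of_le_radical_of_fg hrad (IsNoetherian.noetherian P)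
  obtain ⟨T, hT⟩ := IsNoetherian.noetherian (P ^ k)
  obtain ⟨v, hv, hvT⟩ := hP.exists_notMem_forall_mem_finset (fun v w => v * w ∈ J)
    (fun u v a ha => by rw [mul_assoc]; exact J.mul_mem_left _ ha) T
    (fun a ha => hk (hT ▸ Submodule.subset_span ha))
  refine ⟨v, hv, k, fun w hw => ?_⟩
  have hle : P ^ k ≤ Submodule.comap (LinearMap.mulLeft R v) J := by
    rw [← hT, Submodule.span_le]
    exact hvT
  exact hle hw

namespace InjRes
variable {R : Type u} [CommRing R] [IsDomain R] [IsNoetherianRing R] {F : InjRes R} {j : ℕ}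

/-- If the `j`-th local cohomology modules vanish at all primes properly contained in `P`, then
locally at `P` local cohomology classes lift to classes supported at `P`. -/
theorem exists_sub_mem_Bnd_of_forall_lt {P : Ideal R} (hP : P.IsPrime)
    (h : ∀ P' : Ideal R, P'.IsPrime → P' < P → ∀ c, ∀ z ∈ F.Cyc c j, ∃ u ∉ P', u • z ∈ F.Bnd c j)
    (c : Ideal R) (z : F.E j) (hz : z ∈ F.Cyc c j) :
    ∃ u ∉ P, ∃ z' ∈ F.Cyc (c ⊔ P) j, u • z - z' ∈ F.Bnd c j := by
  classical
  obtain ⟨W, hW⟩ := IsNoetherian.noetherian P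
  have key : ∀ T : Finset R, (∀ w ∈ T, w ∈ P) →
      ∃ u ∉ P, ∃ z' ∈ F.Cyc (c ⊔ Ideal.span T) j, u • z - z' ∈ F.Bnd c j := by
    intro T hT
    induction T using Finset.induction_on with
    | empty =>
      refine ⟨1, hP.one_notMem, z, by simpa using hz, ?_⟩
      rw [one_smul, sub_self]
      exact Submodule.zero_mem _
    | insert w T _ ih =>
      obtain ⟨u, hu, z', hz', hb⟩ := ih fun w hw => hT w (Finset.mem_insert_of_mem hw)
      have hspan : c ⊔ Ideal.span ((insert w T : Finset R) : Set R) =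
          (c ⊔ Ideal.span T) ⊔ Ideal.span {w} := by
        rw [Finset.coe_insert, Ideal.span_insert, sup_assoc, sup_comm (Ideal.span {w})]
      rw [hspan]
      by_cases hw0 : w = 0
      · subst hw0
        exact ⟨u, hu, z', by simpa using hz', hb⟩
      obtain ⟨v, hv, k, hk⟩ := hP.exists_notMem_forall_pow_mul_mem
        (J := (F.Bnd (c ⊔ Ideal.span T) j).comap (LinearMap.toSpanSingleton R _ z')) (by
          intro p hp hJp hpP
          by_contra hne
          obtain ⟨t, ht, htz⟩ := h p hp (lt_of_le_of_ne hpP hne) _ z' hz'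
          exact ht (hJp htz))
      have hkw : w ^ k • v • z' ∈ F.Bnd (c ⊔ Ideal.span T) j := by
        rw [smul_smul, mul_comm]
        exact hk _ (Ideal.pow_mem_pow (hT w (Finset.mem_insert_self _ _)) k)
      obtain ⟨b', hb', hwb⟩ := exists_smul_eq_of_mem_Bnd (pow_ne_zero k hw0) hkw
      refine ⟨v * u, hP.mul_notMem hv hu, v • z' - b', ⟨?_, ?_⟩, ?_⟩
      · refine mem_idealTorsion_sup (Submodule.sub_mem _ (Submodule.smul_mem _ _ hz'.1)
          (Bnd_le_Cyc hb').1) (mem_idealTorsion_span_singleton (k := k) ?_)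
        rw [smul_sub, hwb, sub_self]
      · exact Submodule.sub_mem _ (Submodule.smul_mem _ _ hz'.2) (Bnd_le_Cyc hb').2
      · rw [show (v * u) • z - (v • z' - b') = v • (u • z - z') + b' by
          rw [mul_smul, smul_sub]; abel]
        exact Submodule.add_mem _ (Submodule.smul_mem _ _ hb) (Bnd_anti le_sup_left hb')
  have := key W fun w hw => hW ▸ Submodule.subset_span hw
  rwa [show Ideal.span (W : Set R) = P from hW] at this

/-- Local cohomology in degree `j` vanishes at primes of height less than `j`. -/
theorem exists_smul_mem_Bnd_of_height_lt {P : Ideal R} (hP : P.IsPrime) (hj : P.height < j)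
    (c : Ideal R) (z : F.E j) (hz : z ∈ F.Cyc c j) : ∃ u ∉ P, u • z ∈ F.Bnd c j := by
  have key : ∀ n : ℕ, ∀ P : Ideal R, P.IsPrime → P.height < j → P.height < n →
      ∀ c, ∀ z ∈ F.Cyc c j, ∃ u ∉ P, u • z ∈ F.Bnd c j := by
    intro n
    induction n with
    | zero => exact fun P _ _ h => absurd h (by simp)
    | succ n ih =>
      intro P hP hj hn c z hz
      by_cases hcP : c ≤ P
      swap
      · obtain ⟨r, hr, hrP⟩ := SetLike.not_le_iff_exists.mp hcP
        obtain ⟨k, hk⟩ := exists_pow_smul_eq_zero hz.1 hr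
        exact ⟨r ^ k, fun h => hrP (hP.mem_of_pow_mem k h), hk ▸ Submodule.zero_mem _⟩
      have hfin : P.FiniteHeight := inferInstance
      obtain ⟨u, hu, z', hz', hb⟩ := exists_sub_mem_Bnd_of_forall_lt hP (F := F) (j := j) (by
        intro P' hP' hlt
        have h1 : P'.height < P.height := Ideal.height_strict_mono_of_isPrime hlt
        refine ih P' hP' (h1.trans hj) (h1.trans_le ?_)
        exact ENat.lt_natCast_add_one_iff.mp (by simpa using hn)) c z hz
      rw [sup_eq_right.mpr hcP] at hz'
      obtain ⟨S, hS, hcard⟩ := Ideal.exists_finset_card_eq_height_of_isNoetherianRing P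
      have hSP : Ideal.span (S : Set R) ≤ P := hS.1.2
      have hSj : S.card < j := by exact_mod_cast hcard ▸ hj
      have h1 := Cyc_le_Bnd_of_card_lt S hSj (Cyc_anti hSP hz')
      obtain ⟨i, rfl⟩ : ∃ i, j = i + 1 := ⟨j - 1, by omega⟩
      obtain ⟨f, hf, rfl⟩ := h1
      obtain ⟨v, hv, L, hL⟩ := hP.exists_notMem_forall_pow_mul_mem
        (fun p hp hJp hpP => le_antisymm hpP (hS.2 ⟨hp, hJp⟩ hpP))
      obtain ⟨l, hl⟩ := exists_pow_smul_mem_idealTorsion hL hf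
      refine ⟨v ^ l * u, hP.mul_notMem (fun h => hv (hP.mem_of_pow_mem l h)) hu, ?_⟩
      rw [show (v ^ l * u) • z = v ^ l • (u • z - F.d i f) + F.d i (v ^ l • f) by
        rw [mul_smul, smul_sub, map_smul]; abel]
      exact Submodule.add_mem _ (Submodule.smul_mem _ _ hb)
        (Bnd_anti hcP (map_mem_Bnd hl))
  exact key j P hP hj hj c z hz

end InjRes

namespace InjRes
open IsLocalRing

theorem IsSymbol.sub_pow_smul_mem {R : Type u} [CommRing R] {F : InjRes R} {xs : List R}
    {g : ℕ → F.E xs.length} (hg : F.IsSymbol xs g) (k n : ℕ) :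
    g k - xs.prod ^ n • g (k + n) ∈ F.Bnd (Ideal.ofList xs) xs.length := by
  induction n with
  | zero =>
    rw [pow_zero, one_smul, Nat.add_zero, sub_self]
    exact Submodule.zero_mem _
  | succ n ih =>
    rw [show g k - xs.prod ^ (n + 1) • g (k + (n + 1)) = (g k - xs.prod ^ n • g (k + n)) +
      xs.prod ^ n • (g (k + n) - xs.prod • g (k + n + 1)) by
        rw [smul_sub, smul_smul, ← pow_succ, ← add_assoc]; abel]
    exact Submodule.add_mem _ ih (Submodule.smul_mem _ _ (hg.sub_mem _))

/-- A local version of the Hartshorne–Lichtenbaum vanishing theorem. -/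
theorem Cyc_le_Bnd_of_isWeaklyRegular {R : Type u} [CommRing R] [IsLocalRing R]
    [IsNoetherianRing R] [IsDomain R] [IsDomain (AdicCompletion (maximalIdeal R) R)] {F : InjRes R}
    {y : R} {xs : List R} (hreg : RingTheory.Sequence.IsWeaklyRegular R (y :: xs))
    (hm : ∀ r ∈ y :: xs, r ∈ maximalIdeal R) (h0 : ∀ r ∈ y :: xs, r ≠ 0) {N₀ : ℕ}
    (hN₀ : maximalIdeal R ^ N₀ ≤ Ideal.ofList (y :: xs)) {q : Ideal R} (hq : q.IsPrime)
    (hxq : Ideal.ofList xs ≤ q)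
    (hmin : ∀ p : Ideal R, p.IsPrime → Ideal.ofList xs ≤ p → p ≤ q → p = q)
    (hht : ∀ P : Ideal R, P.IsPrime → P < maximalIdeal R → P.height < (xs.length + 1 : ℕ))
    {a : Ideal R} (haq : a ≤ q) :
    F.Cyc a (xs.length + 1) ≤ F.Bnd a (xs.length + 1) := by
  classical
  have ham : a ≤ maximalIdeal R := haq.trans (le_maximalIdeal hq.ne_top)
  obtain ⟨g, hg⟩ := exists_isSymbol (F := F) xs fun x h => h0 x (List.mem_cons_of_mem _ h)
  have hy := h0 y List.mem_cons_self
  choose e he heg using fun n => (F.injective xs.length).exists_smul_eq_of_mem_idealTorsion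
      (Ideal.ofList xs) (pow_ne_zero n hy) (hg.mem n).1
  have hG := hg.cons hy he heg
  have hmBnd : F.Bnd (Ideal.ofList (y :: xs)) (xs.length + 1) ≤ F.Bnd a (xs.length + 1) :=
    (Bnd_anti_of_pow_le hN₀).trans (Bnd_anti ham)
  obtain ⟨v, hv, L, hL⟩ := hq.exists_notMem_forall_pow_mul_mem hmin
  let z : Fin (xs.length + 1) → R := (y :: xs).get
  have hzimage : z '' {0}ᶜ = {x | x ∈ xs} := by
    ext x
    simp only [Set.mem_image, Set.mem_compl_iff, Set.mem_singleton_iff, Set.mem_ofPred_eq]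
    rw [List.mem_iff_get]
    constructor
    · rintro ⟨i, hi, rfl⟩
      obtain ⟨i, rfl⟩ := Fin.exists_succ_eq.mpr hi
      exact ⟨i, rfl⟩
    · rintro ⟨i, rfl⟩
      exact ⟨i.succ, Fin.succ_ne_zero i, rfl⟩
  have hzprod : ∏ i, z i = (y :: xs).prod := by
    rw [← List.prod_ofFn]
    exact congrArg List.prod (List.ofFn_get (y :: xs))
  have hzerase : ∏ i ∈ Finset.univ.erase 0, z i = xs.prod := by
    have h1 : (Finset.univ.erase 0 : Finset (Fin (xs.length + 1))) =
        Finset.univ.map (Fin.succEmb _) := by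
      ext i
      simp only [Finset.mem_erase, Finset.mem_univ, and_true, Finset.mem_map, true_and]
      exact Fin.exists_succ_eq.symm
    rw [h1, Finset.prod_map, ← List.prod_ofFn]
    exact congrArg List.prod (List.ofFn_get xs)
  have hzspan : Ideal.span (Set.range z) = Ideal.ofList (y :: xs) := by
    rw [Ideal.ofList]
    congr 1
    ext x
    rw [Set.mem_range, Set.mem_ofPred_eq, List.mem_iff_get]
    rfl
  let b : ℕ → Ideal R := fun n => Submodule.comap (LinearMap.toSpanSingleton R _ (g n))
    (idealTorsion q (F.E xs.length) ⊔ F.Bnd (Ideal.ofList xs) xs.length)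
  have hGk : ∀ k, F.d xs.length (e k) ∈ F.Bnd a (xs.length + 1) := by
    intro k
    obtain ⟨N, hN, hmem⟩ := exists_prod_pow_mem_of_isDomain_adicCompletion (z := z)
      (powIndependent_get_of_isRegular hreg hm) (fun i => h0 _ (List.get_mem _ _))
      (fun i => hm _ (List.get_mem _ _)) (hzspan ▸ hN₀) 0 b
      (by
        intro n β hβ
        rw [hzerase]
        change (xs.prod * β) • g (n + 1) ∈
          idealTorsion q (F.E xs.length) ⊔ F.Bnd (Ideal.ofList xs) xs.length
        rw [show (xs.prod * β) • g (n + 1) = β • g n - β • (g n - xs.prod • g (n + 1)) by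
          rw [smul_sub, smul_smul, mul_comm]; abel]
        exact Submodule.sub_mem _ hβ
          (Submodule.mem_sup_right (Submodule.smul_mem _ _ (hg.sub_mem n))))
      (by
        intro n i hi
        obtain ⟨i, rfl⟩ := Fin.exists_succ_eq.mpr hi
        exact Submodule.mem_sup_right (hg.pow_smul n _ (List.get_mem xs i)))
      (by
        intro n
        obtain ⟨l, hl⟩ := exists_pow_smul_mem_idealTorsion hL (hg.mem n).1
        refine ⟨v ^ l, Submodule.mem_sup_left hl, fun h => hv (hq.mem_of_pow_mem l (hxq ?_))⟩
        rwa [hzimage] at h) k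
    rw [hzprod] at hmem
    obtain ⟨β, hβ, γ, hγ, hβγ⟩ := Submodule.mem_sup.mp hmem
    obtain ⟨γ, rfl⟩ := Ideal.mem_span_singleton.mp hγ
    obtain ⟨h, hh, b₁, hb₁, hhb⟩ := Submodule.mem_sup.mp (show β • g N ∈ _ from hβ)
    obtain ⟨h', hh', rfl⟩ := (F.injective _).exists_smul_eq_of_mem_idealTorsion q
      (pow_ne_zero N hy) hh
    obtain ⟨b', hb', rfl⟩ := exists_smul_eq_of_mem_Bnd (pow_ne_zero N hy) hb₁
    have hf : β • e N - h' - b' ∈ idealTorsion (Ideal.ofList (y :: xs)) (F.E xs.length) := by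
      rw [ofList_cons']
      refine mem_idealTorsion_sup (Submodule.sub_mem _ (Submodule.sub_mem _
        (Submodule.smul_mem _ _ (he N)) (idealTorsion_anti hxq hh')) (Bnd_le_Cyc hb').1)
        (mem_idealTorsion_span_singleton (k := N) ?_)
      rw [smul_sub, smul_sub, smul_comm, heg, ← hhb]
      abel
    have hdb : F.d xs.length b' = 0 := (Bnd_le_Cyc hb').2
    have h1 : β • F.d xs.length (e N) ∈ F.Bnd a (xs.length + 1) := by
      rw [show β • F.d xs.length (e N) = F.d xs.length (β • e N - h' - b') + F.d xs.length h' by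
        rw [map_sub, map_sub, map_smul, hdb]; abel]
      exact Submodule.add_mem _ (hmBnd (map_mem_Bnd hf)) (Bnd_anti haq (map_mem_Bnd hh'))
    have h2 : y ^ N • F.d xs.length (e N) = 0 := by
      rw [← map_smul, heg]
      exact (hg.mem N).2
    have h3 := hG.sub_pow_smul_mem k (N - k)
    simp only [Nat.add_sub_cancel' hN] at h3
    rw [← hβγ, show (z 0 ^ N * γ : R) = γ * y ^ N from mul_comm _ _, add_smul, mul_smul, h2,
      smul_zero, add_zero] at h3
    rw [← sub_add_cancel (F.d xs.length (e k)) (β • F.d xs.length (e N))]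
    exact Submodule.add_mem _ (hmBnd h3) h1
  intro c hc
  obtain ⟨u, hu, c', hc', hb⟩ := exists_sub_mem_Bnd_of_forall_lt (F := F)
    (maximalIdeal.isMaximal R).isPrime
    (fun P' hP' hlt c z hz => exists_smul_mem_Bnd_of_height_lt hP' (hht P' hP' hlt) c z hz) a c hc
  rw [sup_eq_right.mpr ham] at hc'
  have hxm : Ideal.ofList (y :: xs) ≤ maximalIdeal R := Ideal.span_le.mpr hm
  obtain ⟨n, -, r, hr⟩ := hG.exists_sub_mem c' (Cyc_anti hxm hc') 0
  have h4 : u • c ∈ F.Bnd a (xs.length + 1) := by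
    rw [show u • c = (u • c - c') + (c' - r • F.d xs.length (e n)) + r • F.d xs.length (e n) by abel]
    exact Submodule.add_mem _ (Submodule.add_mem _ hb (hmBnd hr)) (Submodule.smul_mem _ _ (hGk n))
  have hu' : IsUnit u := by simpa using hu
  obtain ⟨w, hw⟩ := hu'.exists_left_inv
  rw [← one_smul R c, ← hw, mul_smul]
  exact Submodule.smul_mem _ _ h4

end InjRes

section

open IsLocalRing RingTheory.Sequence

theorem ringKrullDim_quotient_succ_le_of_lt {R : Type*} [CommRing R] {p q : Ideal R}
    (hp : p.IsPrime) (h : p < q) : ringKrullDim (R ⧸ q) + 1 ≤ ringKrullDim (R ⧸ p) := by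
  obtain ⟨r, hrq, hrp⟩ := SetLike.exists_of_lt h
  have h1 := ringKrullDim_quotient_sup_span_singleton_succ_le (J := p) (r := r)
    fun a ha => (hp.mem_or_mem ha).resolve_left hrp
  have hle : p ⊔ Ideal.span {r} ≤ q :=
    sup_le h.le ((Ideal.span_singleton_le_iff_mem q).mpr hrq)
  have h2 : ringKrullDim (R ⧸ q) ≤ ringKrullDim (R ⧸ (p ⊔ Ideal.span {r})) :=
    ringKrullDim_le_of_surjective (Ideal.Quotient.factor hle) (Ideal.Quotient.factor_surjective hle)
  exact (add_le_add_left h2 1).trans h1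

theorem exists_associatedPrime_quotSMulTop {R : Type u} [CommRing R] [IsLocalRing R]
    [IsNoetherianRing R] {M : Type u} [AddCommGroup M] [Module R M] [Module.Finite R M]
    {x : R} (hx : x ∈ maximalIdeal R) (hreg : IsSMulRegular M x) {p : Ideal R}
    (hp : p ∈ associatedPrimes R M) :
    ∃ p' ∈ associatedPrimes R (QuotSMulTop x M), p < p' := by
  obtain ⟨hpp, e, he⟩ := isAssociatedPrime_iff.mp hp
  have hpe : ∀ r, r ∈ p ↔ r • e = 0 := fun r => by rw [he]; simp [Submodule.mem_colon_singleton]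
  let K : Submodule R M :=
    { carrier := {m | ∀ r ∈ p, r • m = 0}
      zero_mem' := fun r _ => smul_zero r
      add_mem' := fun {a b} ha hb r hr => by rw [smul_add, ha r hr, hb r hr, add_zero]
      smul_mem' := fun c a ha r hr => by rw [smul_comm, ha r hr, smul_zero] }
  have heK : e ∈ K := fun r hr => (hpe r).mp hr
  have he0 : e ≠ 0 := fun h => hpp.one_notMem ((hpe 1).mpr (by rw [h, smul_zero]))
  obtain ⟨k, hk, hkx⟩ : ∃ k ∈ K, ∀ k' ∈ K, k ≠ x • k' := by
    by_contra hcon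
    push Not at hcon
    have hK : K = ⊥ := by
      apply Submodule.eq_bot_of_le_smul_of_le_jacobson_bot (Ideal.span {x}) K
        (IsNoetherian.noetherian K)
      · intro k hk
        obtain ⟨k', hk', rfl⟩ := hcon k hk
        exact Submodule.smul_mem_smul (Ideal.mem_span_singleton_self x) hk'
      · rw [IsLocalRing.jacobson_eq_maximalIdeal _ bot_ne_top, Ideal.span_singleton_le_iff_mem]
        exact hx
    exact he0 ((Submodule.mem_bot R).mp (hK ▸ heK))
  have hk0 : (Submodule.Quotient.mk k : QuotSMulTop x M) ≠ 0 := by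
    intro h
    obtain ⟨m, -, hm⟩ := (Submodule.mem_smul_pointwise_iff_exists _ _ _).mp
      ((Submodule.Quotient.mk_eq_zero _).mp h)
    refine hkx m (fun r hr => hreg ?_) hm.symm
    change x • r • m = x • (0 : M)
    rw [smul_comm, hm, hk r hr, smul_zero]
  obtain ⟨p', hp', hle⟩ := exists_le_isAssociatedPrime_of_isNoetherianRing R _ hk0
  have hmem : ∀ r : R, (Submodule.Quotient.mk (r • k) : QuotSMulTop x M) = 0 → r ∈ p' := by
    intro r hr
    apply hle
    rw [Submodule.mem_colon_singleton, Submodule.mem_bot]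
    exact hr
  refine ⟨p', hp', lt_of_le_of_ne (fun r hr => hmem r (by rw [hk r hr]; rfl)) ?_⟩
  rintro rfl
  have hxp : x ∈ p := hmem x ((Submodule.Quotient.mk_eq_zero _).mpr
    ((Submodule.mem_smul_pointwise_iff_exists _ _ _).mpr ⟨k, trivial, rfl⟩))
  exact he0 (hreg (by simpa using (hpe x).mp hxp))

theorem length_le_ringKrullDim_quotient_of_mem_associatedPrimes {R : Type u} [CommRing R]
    [IsLocalRing R] [IsNoetherianRing R] (rs : List R) (hm : ∀ r ∈ rs, r ∈ maximalIdeal R)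
    {M : Type u} [AddCommGroup M] [Module R M] [Module.Finite R M] (hrs : IsWeaklyRegular M rs)
    {p : Ideal R} (hp : p ∈ associatedPrimes R M) :
    (rs.length : WithBot ℕ∞) ≤ ringKrullDim (R ⧸ p) := by
  induction rs generalizing M p with
  | nil =>
    have := hp.1
    simpa using ringKrullDim_nonneg_of_nontrivial (R := R ⧸ p)
  | cons x rs ih =>
    rw [isWeaklyRegular_cons_iff] at hrs
    obtain ⟨p', hp', hlt⟩ := exists_associatedPrime_quotSMulTop (hm x List.mem_cons_self) hrs.1 hp
    have h1 := ih (fun r hr => hm r (List.mem_cons_of_mem _ hr)) hrs.2 hp'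
    have h2 := ringKrullDim_quotient_succ_le_of_lt hp.1 hlt
    push_cast [List.length_cons]
    exact (add_le_add_left h1 1).trans h2

/-- Regular sequences on a quotient by a regular element. -/
theorem exists_isRegular_quotSMulTop {R : Type u} [CommRing R] [IsLocalRing R]
    [IsNoetherianRing R] {M : Type u} [AddCommGroup M] [Module R M] [Module.Finite R M]
    [Nontrivial M] {x : R} (hx : x ∈ maximalIdeal R) (hreg : IsSMulRegular M x) {n : ℕ}
    (h : ∃ rs : List R, rs.length = n + 1 ∧ (∀ r ∈ rs, r ∈ maximalIdeal R) ∧ IsRegular M rs) :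
    ∃ rs : List R, rs.length = n ∧ (∀ r ∈ rs, r ∈ maximalIdeal R) ∧
      IsRegular (QuotSMulTop x M) rs := by
  have hlt : ∀ (L : Type u) [AddCommGroup L] [Module R L] [Module.Finite R L] [Nontrivial L],
      maximalIdeal R • (⊤ : Submodule R L) < ⊤ := fun L _ _ _ _ =>
    (Submodule.top_ne_ideal_smul_of_le_jacobson_annihilator (maximalIdeal_le_jacobson _)).symm.lt_top
  have := nontrivial_quotSMulTop_of_mem_maximalIdeal M hx
  have h1 := ((ModuleCat.exists_isRegular_tfae (maximalIdeal R) (n + 1) (ModuleCat.of R M)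
    (hlt M)).out 3 1).mp h
  refine ((ModuleCat.exists_isRegular_tfae (maximalIdeal R) n
    (ModuleCat.of R (QuotSMulTop x M)) (hlt _)).out 1 3).mp fun i hi => ?_
  have zero1 := AddCommGrpCat.isZero_of_iff_subsingleton.mpr (h1 i (by omega))
  have zero2 := AddCommGrpCat.isZero_of_iff_subsingleton.mpr (h1 (i + 1) (by omega))
  exact AddCommGrpCat.subsingleton_of_isZero <| ShortComplex.Exact.isZero_of_both_zeros
    ((Abelian.Ext.covariant_sequence_exact₃' _
      (IsSMulRegular.smulShortComplex_shortExact (M := ModuleCat.of R M) hreg)) i (i + 1) rfl)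
    (zero1.eq_zero_of_src _) (zero2.eq_zero_of_tgt _)

theorem exists_isRegular_append_of_ringKrullDim_quotient_le_one {R : Type u} [CommRing R]
    [IsLocalRing R] [IsNoetherianRing R] {q : Ideal R} (hq : q.IsPrime)
    (hq1 : ringKrullDim (R ⧸ q) ≤ 1) (n : ℕ) {M : Type u} [AddCommGroup M] [Module R M]
    [Module.Finite R M] [Nontrivial M]
    (h : ∃ rs : List R, rs.length = n + 1 ∧ (∀ r ∈ rs, r ∈ maximalIdeal R) ∧ IsRegular M rs) :
    ∃ (xs : List R) (y : R), xs.length = n ∧ (∀ x ∈ xs, x ∈ q) ∧ y ∈ maximalIdeal R ∧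
      IsRegular M (xs ++ [y]) := by
  induction n generalizing M with
  | zero =>
    obtain ⟨rs, hl, hm, hrs⟩ := h
    obtain ⟨y, rfl⟩ := List.length_eq_one_iff.mp hl
    exact ⟨[], y, rfl, by simp, hm y (by simp), hrs⟩
  | succ n ih =>
    have hx : ∃ x ∈ q, IsSMulRegular M x := by
      by_contra hcon
      push Not at hcon
      have hsub : (q : Set R) ⊆ ⋃ p ∈ associatedPrimes R M, p := by
        rw [biUnion_associatedPrimes_eq_compl_regular]
        exact hcon
      obtain ⟨p, hp, hqp⟩ := (Ideal.subset_union_prime_finite (associatedPrimes.finite R M)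
        ⊥ ⊥ (f := id) (fun p hp _ _ => hp.1)).mp hsub
      obtain ⟨rs, hl, hm, hrs⟩ := h
      have h1 := length_le_ringKrullDim_quotient_of_mem_associatedPrimes rs hm hrs.1 hp
      have h2 : ringKrullDim (R ⧸ p) ≤ ringKrullDim (R ⧸ q) :=
        ringKrullDim_le_of_surjective (Ideal.Quotient.factor hqp)
          (Ideal.Quotient.factor_surjective hqp)
      rw [hl] at h1
      have h3 := (h1.trans h2).trans hq1
      have h4 : n + 1 + 1 ≤ 1 := by exact_mod_cast h3
      omega
    obtain ⟨x, hxq, hx⟩ := hx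
    have hxm := le_maximalIdeal hq.ne_top hxq
    have := nontrivial_quotSMulTop_of_mem_maximalIdeal M hxm
    obtain ⟨xs, y, hl, hxs, hy, hreg⟩ := ih (exists_isRegular_quotSMulTop hxm hx h)
    refine ⟨x :: xs, y, by simp [hl], ?_, hy, IsRegular.cons hx hreg⟩
    simpa using ⟨hxq, hxs⟩

end

section

open IsLocalRing RingTheory.Sequence

theorem eq_natCast_of_add_natCast_eq {x : WithBot ℕ∞} {n k : ℕ}
    (h : x + (n : WithBot ℕ∞) = ((k + n : ℕ) : WithBot ℕ∞)) : x = k := by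
  induction x using WithBot.recBotCoe with
  | bot =>
    rw [WithBot.bot_add] at h
    exact absurd h.symm (WithBot.coe_ne_bot (a := ((k + n : ℕ) : ℕ∞)))
  | coe a =>
    have h1 : a + (n : ℕ∞) = (k : ℕ∞) + (n : ℕ∞) := by
      have h2 : ((a + (n : ℕ∞) : ℕ∞) : WithBot ℕ∞) = (((k + n : ℕ) : ℕ∞) : WithBot ℕ∞) := h
      have h3 := WithBot.coe_injective h2
      rw [h3]
      push_cast
      rfl
    rw [WithTop.add_right_cancel (ENat.natCast_ne_top n) h1]
    rfl

variable {R : Type u} [CommRing R] [IsLocalRing R] [IsNoetherianRing R]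

theorem exists_maximalIdeal_pow_le_ofList {d : ℕ} (hd : ringKrullDim R = d) {rs : List R}
    (hl : rs.length = d) (hrs : IsRegular R rs) : ∃ N, maximalIdeal R ^ N ≤ Ideal.ofList rs := by
  have h := ringKrullDim_add_length_eq_ringKrullDim_of_isRegular rs hrs
  have h0 : ringKrullDim (R ⧸ Ideal.ofList rs) = (0 : ℕ) :=
    eq_natCast_of_add_natCast_eq (n := d) (by rw [← hl, h, hd, hl, zero_add])
  have hne : Ideal.ofList rs ≠ ⊤ := fun htop => hrs.2 (by rw [htop, Submodule.top_smul])
  have : Nontrivial (R ⧸ Ideal.ofList rs) := Ideal.Quotient.nontrivial_iff.mpr hne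
  have : Ring.KrullDimLE 0 (R ⧸ Ideal.ofList rs) :=
    ringKrullDimZero_iff_ringKrullDim_eq_zero.mpr (by exact_mod_cast h0)
  have : IsArtinianRing (R ⧸ Ideal.ofList rs) :=
    isArtinianRing_iff_isNoetherianRing_krullDimLE_zero.mpr ⟨inferInstance, inferInstance⟩
  exact exists_maximalIdeal_pow_le_of_isArtinianRing_quotient _

theorem ne_zero_of_mem_of_isRegular {rs : List R} (hrs : IsRegular R rs) {r : R} (hr : r ∈ rs) :
    r ≠ 0 := by
  classical
  have h := (IsLocalRing.isRegular_of_perm hrs (List.perm_cons_erase hr))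
  rw [isRegular_cons_iff] at h
  rintro rfl
  exact one_ne_zero (h.1 (by simp : (0 : R) • (1 : R) = (0 : R) • (0 : R)))

/-- Over a Cohen–Macaulay local ring, a prime of dimension one contains a regular sequence which
is one element short of being a system of parameters. -/
theorem exists_isRegular_of_ringKrullDim_quotient_eq_one {d : ℕ} (hd : ringKrullDim R = d)
    (hd1 : 1 ≤ d)
    (h : ∃ rs : List R, rs.length = d ∧ (∀ r ∈ rs, r ∈ maximalIdeal R) ∧ IsRegular R rs)
    {q : Ideal R} (hq : q.IsPrime) (hq1 : ringKrullDim (R ⧸ q) = 1) :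
    ∃ (xs : List R) (y : R), xs.length + 1 = d ∧ IsRegular R (y :: xs) ∧ IsWeaklyRegular R xs ∧
      y ∈ maximalIdeal R ∧ Ideal.ofList xs ≤ q ∧
      ∀ p : Ideal R, p.IsPrime → Ideal.ofList xs ≤ p → p ≤ q → p = q := by
  obtain ⟨xs, y, hl, hxq, hy, hreg⟩ := exists_isRegular_append_of_ringKrullDim_quotient_le_one hq
    hq1.le (d - 1) (M := R) (by rwa [Nat.sub_add_cancel hd1])
  have hxs : IsWeaklyRegular R xs := ((isWeaklyRegular_append_iff R _ _).mp hreg.1).1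
  have hxsr : IsRegular R xs := (isRegular_iff_isWeaklyRegular_of_subset_maximalIdeal
    fun r hr => le_maximalIdeal hq.ne_top (hxq r hr)).mpr hxs
  refine ⟨xs, y, by omega, IsLocalRing.isRegular_of_perm hreg (List.perm_append_singleton y xs),
    hxs, hy, Ideal.span_le.mpr hxq, fun p hp hxp hpq => ?_⟩
  by_contra hne
  have h1 := ringKrullDim_quotient_succ_le_of_lt hp (lt_of_le_of_ne hpq hne)
  have h2 : ringKrullDim (R ⧸ p) ≤ ringKrullDim (R ⧸ Ideal.ofList xs) :=
    ringKrullDim_le_of_surjective (Ideal.Quotient.factor hxp) (Ideal.Quotient.factor_surjective hxp)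
  have h3 : ringKrullDim (R ⧸ Ideal.ofList xs) = (1 : ℕ) :=
    eq_natCast_of_add_natCast_eq (n := xs.length) (by
      rw [ringKrullDim_add_length_eq_ringKrullDim_of_isRegular xs hxsr, hd]
      congr 1
      omega)
  rw [hq1] at h1
  have h4 := (h1.trans h2).trans_eq h3
  have h5 : 1 + 1 ≤ 1 := by exact_mod_cast h4
  omega

theorem height_lt_of_lt_maximalIdeal {d : ℕ} (hd : ringKrullDim R = d) {P : Ideal R}
    (hP : P.IsPrime) (h : P < maximalIdeal R) : P.height < d := by
  have h1 : P.height < (maximalIdeal R).height := Ideal.height_strict_mono_of_isPrime h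
  rw [← maximalIdeal_height_eq_ringKrullDim] at hd
  have h2 : (maximalIdeal R).height = (d : ℕ∞) := WithBot.coe_injective hd
  rwa [h2] at h1

/-- Top local cohomology vanishes for ideals contained in a prime of dimension one. -/
theorem InjRes.Cyc_le_Bnd_of_le_prime [IsDomain R] [IsDomain (AdicCompletion (maximalIdeal R) R)]
    (F : InjRes R) {n : ℕ} (hd : ringKrullDim R = (n + 1 : ℕ))
    (h : ∃ rs : List R, rs.length = n + 1 ∧ (∀ r ∈ rs, r ∈ maximalIdeal R) ∧ IsRegular R rs)
    {q : Ideal R} (hq : q.IsPrime) (hq1 : ringKrullDim (R ⧸ q) = 1) {a : Ideal R} (haq : a ≤ q) :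
    F.Cyc a (n + 1) ≤ F.Bnd a (n + 1) := by
  obtain ⟨xs, y, hl, hreg, -, hy, hxq, hmin⟩ :=
    exists_isRegular_of_ringKrullDim_quotient_eq_one hd (by omega) h hq hq1
  obtain rfl : xs.length = n := by omega
  obtain ⟨N₀, hN₀⟩ := exists_maximalIdeal_pow_le_ofList hd (by simp) hreg
  have hm : ∀ r ∈ y :: xs, r ∈ maximalIdeal R := by
    intro r hr
    rcases List.mem_cons.mp hr with rfl | hr
    · exact hy
    · exact le_maximalIdeal hq.ne_top (hxq (Ideal.subset_span hr))
  exact Cyc_le_Bnd_of_isWeaklyRegular hreg.1 hm (fun r hr => ne_zero_of_mem_of_isRegular hreg hr)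
    hN₀ hq hxq hmin (fun P hP hlt => height_lt_of_lt_maximalIdeal hd hP hlt) haq

end

section

open IsLocalRing RingTheory.Sequence

namespace InjRes

variable {R : Type u} [CommRing R] [IsLocalRing R] [IsNoetherianRing R] [IsDomain R] {F : InjRes R}

/-- The annihilator of a suitable generating system of the top local cohomology of a regular
sequence. -/
theorem exists_isSymbol_annihilator (xs : List R) (hm : ∀ x ∈ xs, x ∈ maximalIdeal R)
    (hreg : IsWeaklyRegular R xs) (h0 : ∀ x ∈ xs, x ≠ 0) :
    ∃ g, F.IsSymbol xs g ∧ ∀ (n : ℕ) (r : R), r • g n ∈ F.Bnd (Ideal.ofList xs) xs.length →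
      r ∈ Ideal.span ((fun x => x ^ n) '' {x | x ∈ xs}) := by
  classical
  induction xs with
  | nil =>
    refine ⟨fun _ => F.aug 1, ?_, ?_⟩
    · refine ⟨fun n => ⟨?_, (F.exact_zero _).mpr ⟨1, rfl⟩⟩, by simp, fun n => ?_, fun z hz k => ?_⟩
      · rw [Ideal.ofList_nil, idealTorsion_bot]
        trivial
      · rw [List.prod_nil, one_smul, sub_self]
        exact Submodule.zero_mem _
      · obtain ⟨r, rfl⟩ := (F.exact_zero z).mp hz.2
        refine ⟨k, le_rfl, r, ?_⟩
        rw [← map_smul, smul_eq_mul, mul_one, sub_self]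
        exact Submodule.zero_mem _
    · intro n r hr
      have h1 : F.aug r = 0 := by
        rw [← map_smul, smul_eq_mul, mul_one] at hr
        exact (Submodule.mem_bot R).mp hr
      rw [F.aug_injective (h1.trans (map_zero _).symm)]
      exact Submodule.zero_mem _
  | cons y xs ih =>
    have hxs : IsWeaklyRegular R xs := ((isWeaklyRegular_append_iff R _ _).mp
      (IsLocalRing.isWeaklyRegular_of_perm_of_subset_maximalIdeal hreg
        (List.perm_append_singleton y xs).symm hm)).1
    obtain ⟨g, hg, hann⟩ := ih (fun x h => hm x (List.mem_cons_of_mem _ h)) hxs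
      fun x h => h0 x (List.mem_cons_of_mem _ h)
    have hy := h0 y List.mem_cons_self
    choose e he heg using fun n => (F.injective xs.length).exists_smul_eq_of_mem_idealTorsion
      (Ideal.ofList xs) (pow_ne_zero n hy) (hg.mem n).1
    refine ⟨_, hg.cons hy he heg, fun n r hr => ?_⟩
    rw [ofList_cons'] at hr
    obtain ⟨f, hf, hdf⟩ := hr
    obtain ⟨k, hk⟩ := exists_pow_smul_eq_zero hf (y := y)
      (Ideal.mem_sup_right (Ideal.mem_span_singleton_self y))
    have hw : r • e n - f ∈ F.Cyc (Ideal.ofList xs) xs.length := by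
      refine ⟨Submodule.sub_mem _ (Submodule.smul_mem _ _ (he n))
        (idealTorsion_anti le_sup_left hf), LinearMap.mem_ker.mpr ?_⟩
      rw [map_sub, map_smul, hdf, sub_self]
    obtain ⟨N, hN, s, hs⟩ := hg.exists_sub_mem _ hw n
    have h1 := hg.sub_pow_smul_mem n (N - n)
    rw [Nat.add_sub_cancel' hN] at h1
    have h2 : (y ^ k * (r * xs.prod ^ (N - n) - y ^ n * s)) • g N ∈
        F.Bnd (Ideal.ofList xs) xs.length := by
      have h3 : (y ^ k * (r * xs.prod ^ (N - n) - y ^ n * s)) • g N =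
          y ^ (k + n) • (r • e n - f - s • g N) -
            (r * y ^ k) • (g n - xs.prod ^ (N - n) • g N) := by
        have h4 : y ^ (k + n) • (r • e n - f) = (r * y ^ k) • g n := by
          rw [smul_sub, smul_smul, show y ^ (k + n) * r = (r * y ^ k) * y ^ n by ring, mul_smul,
            heg, show y ^ (k + n) = y ^ n * y ^ k by ring, mul_smul (y ^ n), hk, smul_zero, sub_zero]
        rw [smul_sub, h4, smul_sub, smul_smul, smul_smul,
          show y ^ k * (r * xs.prod ^ (N - n) - y ^ n * s) =
            r * y ^ k * xs.prod ^ (N - n) - y ^ (k + n) * s by ring, sub_smul]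
        abel
      rw [h3]
      exact Submodule.sub_mem _ (Submodule.smul_mem _ _ hs) (Submodule.smul_mem _ _ h1)
    have h3 := hann N _ h2
    let z : Fin (xs.length + 1) → R := (y :: xs).get
    have hz : PowIndependent z := powIndependent_get_of_isRegular hreg hm
    have himage : ∀ M : ℕ, (fun i => z i ^ M) '' {0}ᶜ = (fun x => x ^ M) '' {x | x ∈ xs} := by
      intro M
      ext x
      simp only [Set.mem_image, Set.mem_compl_iff, Set.mem_singleton_iff, Set.mem_ofPred_eq]
      constructor
      · rintro ⟨i, hi, rfl⟩
        obtain ⟨i, rfl⟩ := Fin.exists_succ_eq.mpr hi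
        exact ⟨xs.get i, List.get_mem _ _, rfl⟩
      · rintro ⟨x, hx, rfl⟩
        obtain ⟨i, rfl⟩ := List.mem_iff_get.mp hx
        exact ⟨i.succ, Fin.succ_ne_zero i, rfl⟩
    have hprod : ∏ i ∈ Finset.univ.erase 0, z i ^ (N - n) = xs.prod ^ (N - n) := by
      have h1 : (Finset.univ.erase 0 : Finset (Fin (xs.length + 1))) =
          Finset.univ.map (Fin.succEmb _) := by
        ext i
        simp only [Finset.mem_erase, Finset.mem_univ, and_true, Finset.mem_map, true_and]
        exact Fin.exists_succ_eq.symm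
      rw [Finset.prod_pow, h1, Finset.prod_map, ← List.prod_ofFn]
      exact congrArg (fun l => List.prod l ^ (N - n)) (List.ofFn_get xs)
    rw [← himage] at h3
    have h4 := hz.pow_mul_mem 0 (fun _ => N) k h3
    have h5 : (∏ i ∈ Finset.univ.erase 0, z i ^ (N - n)) * r ∈
        powIdeal z (fun i => if i = 0 then n else N) := by
      rw [hprod, mul_comm, show r * xs.prod ^ (N - n) =
        (r * xs.prod ^ (N - n) - y ^ n * s) + y ^ n * s by ring]
      refine Ideal.add_mem _ (Ideal.span_mono ?_ h4) (Ideal.mul_mem_right _ _ ?_)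
      · rintro _ ⟨i, hi, rfl⟩
        have hi' : i ≠ 0 := hi
        exact ⟨i, by simp [hi']⟩
      · have := pow_mem_powIdeal z (fun i => if i = 0 then n else N) 0
        rw [if_pos rfl] at this
        exact this
    have h6 := hz.cancel_prod (Finset.univ.erase 0) _ (N - n) (fun i hi => by
      have : i ≠ 0 := Finset.ne_of_mem_erase hi
      simp [this]) h5
    refine Ideal.span_mono ?_ h6
    rintro _ ⟨i, rfl⟩
    refine ⟨z i, List.get_mem _ _, ?_⟩
    by_cases hi : i = 0
    · simp [hi]
    · simp [hi, Nat.sub_sub_self hN]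

/-- There is a local cohomology class with support in `I` whose annihilator is exactly `Q`. -/
theorem exists_mem_Cyc_annihilator {xs : List R} (hreg : IsWeaklyRegular R xs)
    (h0 : ∀ x ∈ xs, x ≠ 0) {Q : Ideal R} (hQ : Q.IsPrime) (hxQ : Ideal.ofList xs ≤ Q)
    (hmin : ∀ p : Ideal R, p.IsPrime → Ideal.ofList xs ≤ p → p ≤ Q → p = Q) {I : Ideal R}
    (hIQ : I ≤ Q) (hImin : ∀ p : Ideal R, p.IsPrime → I ≤ p → p ≤ Q → p = Q) :
    ∃ h ∈ F.Cyc I xs.length, (∀ r ∈ Q, r • h ∈ F.Bnd I xs.length) ∧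
      ∀ t ∉ Q, t • h ∉ F.Bnd I xs.length := by
  have hm : ∀ x ∈ xs, x ∈ maximalIdeal R := fun x hx =>
    le_maximalIdeal hQ.ne_top (hxQ (Ideal.subset_span hx))
  obtain ⟨g, hg, hann⟩ := exists_isSymbol_annihilator (F := F) xs hm hreg h0
  have hann1 : ∀ r : R, r • g 1 ∈ F.Bnd (Ideal.ofList xs) xs.length → r ∈ Ideal.ofList xs := by
    intro r hr
    have := hann 1 r hr
    simp only [pow_one, Set.image_id'] at this
    exact this
  have hg1 : ∀ r ∈ Ideal.ofList xs, r • g 1 ∈ F.Bnd (Ideal.ofList xs) xs.length := by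
    have : Ideal.ofList xs ≤ Submodule.comap (LinearMap.toSpanSingleton R _ (g 1))
        (F.Bnd (Ideal.ofList xs) xs.length) := Ideal.span_le.mpr fun x hx => by
      simpa using hg.pow_smul 1 x hx
    exact this
  have hQass : Q ∈ associatedPrimes R (R ⧸ Ideal.ofList xs) := by
    apply Module.associatedPrimes.minimalPrimes_annihilator_subset_associatedPrimes
    rw [Ideal.annihilator_quotient]
    exact ⟨⟨hQ, hxQ⟩, fun p hp hpQ => (hmin p hp.1 hp.2 hpQ).ge⟩
  obtain ⟨-, c', hc'⟩ := isAssociatedPrime_iff.mp hQass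
  obtain ⟨c, rfl⟩ := Ideal.Quotient.mk_surjective c'
  have hc : ∀ r, r ∈ Q ↔ r * c ∈ Ideal.ofList xs := by
    intro r
    rw [hc', Submodule.mem_colon_singleton, Submodule.mem_bot, ← Ideal.Quotient.eq_zero_iff_mem,
      map_mul]
    rfl
  obtain ⟨v, hv, L, hL⟩ := hQ.exists_notMem_forall_pow_mul_mem hmin
  obtain ⟨l, hl⟩ := exists_pow_smul_mem_idealTorsion hL
    (Submodule.smul_mem _ c (hg.mem 1).1)
  have hv' : ∀ n, v ^ n ∉ Q := fun n hn => hv (hQ.mem_of_pow_mem n hn)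
  obtain ⟨f, hf⟩ : ∃ f, f = v ^ l • c • g 1 := ⟨_, rfl⟩
  rw [← hf] at hl
  have hfc : F.d xs.length f = 0 := by
    rw [hf, map_smul, map_smul, show F.d xs.length (g 1) = 0 from (hg.mem 1).2, smul_zero, smul_zero]
  have hfann : ∀ t, t • f ∈ F.Bnd (Ideal.ofList xs) xs.length → t ∈ Q := by
    intro t ht
    rw [hf, smul_smul, smul_smul] at ht
    have := (hc _).mpr (hann1 _ ht)
    exact (hQ.mem_or_mem this).resolve_right (hv' l)
  have hpush : ∀ (J K : Ideal R), (∀ p : Ideal R, p.IsPrime → K ≤ p → p ≤ Q → p = Q) → J ≤ Q →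
      ∀ b ∈ F.Bnd K xs.length, ∃ u ∉ Q, u • b ∈ F.Bnd J xs.length := by
    intro J K hK hJ b hb
    generalize xs.length = j at b hb
    cases j with
    | zero =>
      refine ⟨1, hQ.one_notMem, ?_⟩
      rw [(Submodule.mem_bot R).mp hb, smul_zero]
      exact Submodule.zero_mem _
    | succ j =>
      obtain ⟨f, hf, rfl⟩ := hb
      obtain ⟨u, hu, L, hL⟩ := hQ.exists_notMem_forall_pow_mul_mem hK
      obtain ⟨l, hl⟩ := exists_pow_smul_mem_idealTorsion hL hf
      refine ⟨u ^ l, fun h => hu (hQ.mem_of_pow_mem l h), ?_⟩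
      rw [← map_smul]
      exact map_mem_Bnd (idealTorsion_anti hJ hl)
  obtain ⟨T, hT⟩ := IsNoetherian.noetherian Q
  obtain ⟨w, hw, hwT⟩ := hQ.exists_notMem_forall_mem_finset
    (fun u t => u • t • f ∈ F.Bnd I xs.length)
    (fun u v a ha => by rw [mul_smul]; exact Submodule.smul_mem _ _ ha) T (fun t ht => by
      apply hpush I _ hmin hIQ
      have htQ : t ∈ Q := hT ▸ Submodule.subset_span ht
      rw [hf, smul_comm, smul_smul t]
      exact Submodule.smul_mem _ _ (hg1 _ ((hc t).mp htQ)))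
  refine ⟨w • f, Submodule.smul_mem _ _ ⟨idealTorsion_anti hIQ hl, hfc⟩, ?_, ?_⟩
  · have hle : Q ≤ Submodule.comap (LinearMap.toSpanSingleton R _ (w • f))
        (F.Bnd I xs.length) := by
      rw [← hT, Submodule.span_le]
      intro t ht
      change t • w • f ∈ F.Bnd I xs.length
      rw [smul_comm]
      exact hwT t ht
    exact hle
  · intro t ht hmem
    obtain ⟨u, hu, h⟩ := hpush (Ideal.ofList xs) I hImin hxQ _ hmem
    rw [smul_smul, smul_smul] at h
    exact hQ.mul_notMem (hQ.mul_notMem hu ht) hw (hfann _ h)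

end InjRes

end

section

open IsLocalRing RingTheory.Sequence

section EssentialSocle

variable {A : Type u} [CommRing A] [IsLocalRing A] {E : Type u} [AddCommGroup E] [Module A E] {σ : E}

theorem exists_eq_smul_of_maximalIdeal_smul (hess : ∀ e : E, e ≠ 0 → ∃ a : A, a • e = σ)
    (hσ : σ ≠ 0) {e : E} (he : ∀ a ∈ maximalIdeal A, a • e = 0) : ∃ a : A, e = a • σ := by
  by_cases h0 : e = 0
  · exact ⟨0, by simp [h0]⟩
  obtain ⟨a, ha⟩ := hess e h0
  have hu : IsUnit a := by
    by_contra h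
    exact hσ (ha ▸ he a h)
  obtain ⟨u, rfl⟩ := hu
  exact ⟨(u⁻¹ : Aˣ), by rw [← ha, smul_smul, Units.inv_mul, one_smul]⟩

/-- Endomorphisms of an injective hull of the residue field act as scalars on the elements killed
by a fixed power of the maximal ideal. -/
theorem exists_forall_eq_smul [IsNoetherianRing A] (hE : Module.Injective A E)
    (hess : ∀ e : E, e ≠ 0 → ∃ a : A, a • e = σ) (hσ : σ ≠ 0)
    (hmσ : ∀ a ∈ maximalIdeal A, a • σ = 0) (f : E →ₗ[A] E) (k : ℕ) :
    ∃ r : A, ∀ e, (∀ a ∈ maximalIdeal A ^ k, a • e = 0) → f e = r • e := by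
  induction k with
  | zero =>
    refine ⟨0, fun e he => ?_⟩
    have : e = 0 := by simpa using he 1 (by simp)
    simp [this]
  | succ k ih =>
    obtain ⟨r, hr⟩ := ih
    obtain ⟨t, b, hb⟩ := Submodule.fg_iff_exists_fin_generating_family.mp
      (IsNoetherian.noetherian (maximalIdeal A ^ k))
    let P : Submodule A E :=
      { carrier := {e | ∀ a ∈ maximalIdeal A ^ (k + 1), a • e = 0}
        zero_mem' := fun a _ => smul_zero a
        add_mem' := fun {x y} hx hy a ha => by rw [smul_add, hx a ha, hy a ha, add_zero]
        smul_mem' := fun c x hx a ha => by rw [smul_comm, hx a ha, smul_zero] }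
    obtain ⟨ψ, hψ⟩ := hE.exists_eq_sum_smul (Q := P) Finset.univ b
      ((f - r • LinearMap.id) ∘ₗ P.subtype) (by
        intro q hq
        have : f (q : E) = r • (q : E) := by
          refine hr _ fun a ha => ?_
          rw [← hb] at ha
          induction ha using Submodule.span_induction with
          | mem x hx =>
            obtain ⟨j, rfl⟩ := hx
            exact congrArg Subtype.val (hq j (Finset.mem_univ j))
          | zero => exact zero_smul _ _
          | add x y _ _ hx hy => rw [add_smul, hx, hy, add_zero]
          | smul c x _ hx => rw [smul_assoc, hx, smul_zero]
        simp [this])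
    have hσP : σ ∈ P := fun a ha => hmσ a (Ideal.pow_le_self (Nat.succ_ne_zero k) ha)
    have hsc : ∀ j, ∃ c : A, ψ j ⟨σ, hσP⟩ = c • σ := fun j =>
      exists_eq_smul_of_maximalIdeal_smul hess hσ fun a ha => by
        rw [← map_smul, show a • (⟨σ, hσP⟩ : P) = 0 from Subtype.ext (hmσ a ha), map_zero]
    choose c hc using hsc
    refine ⟨r + ∑ j, c j * b j, fun e he => ?_⟩
    have h1 := LinearMap.congr_fun hψ ⟨e, he⟩
    simp only [LinearMap.comp_apply, LinearMap.sub_apply, LinearMap.smul_apply, LinearMap.id_apply,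
      Submodule.subtype_apply, LinearMap.sum_apply] at h1
    rw [sub_eq_iff_eq_add'] at h1
    rw [h1, add_smul, Finset.sum_smul]
    congr 1
    refine Finset.sum_congr rfl fun j _ => ?_
    obtain ⟨a, ha⟩ := exists_eq_smul_of_maximalIdeal_smul hess hσ (e := b j • e) (by
      intro a ha
      rw [smul_smul]
      refine he _ ?_
      rw [pow_succ']
      refine Ideal.mul_mem_mul ha ?_
      rw [← hb]
      exact Submodule.subset_span ⟨j, rfl⟩)
    rw [← map_smul, show b j • (⟨e, he⟩ : P) = a • ⟨σ, hσP⟩ from Subtype.ext ha, map_smul, hc,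
      mul_smul, ha, smul_comm]

variable {M : Type u} [AddCommGroup M] [Module A M]

theorem exists_functional_apply_ne_zero (hE : Module.Injective A E) (hσ : σ ≠ 0)
    (hmσ : ∀ a ∈ maximalIdeal A, a • σ = 0) {s : M} (hs : s ≠ 0) : ∃ f : M →ₗ[A] E, f s ≠ 0 := by
  obtain ⟨f, hf⟩ := hE.exists_comp_eq (LinearMap.toSpanSingleton A M s)
    (LinearMap.toSpanSingleton A E σ) (by
      intro a ha
      refine hmσ a ?_
      rw [mem_maximalIdeal, mem_nonunits_iff]
      intro h
      exact hs ((h.smul_eq_zero).mp ha))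
  refine ⟨f, fun h => hσ ?_⟩
  have := hf 1
  simpa [h] using this.symm

theorem exists_ne_zero_maximalIdeal_smul {u : M} (hu : u ≠ 0) {N : ℕ}
    (hN : ∀ a ∈ maximalIdeal A ^ N, a • u = 0) :
    ∃ b : A, b • u ≠ 0 ∧ ∀ a ∈ maximalIdeal A, a • b • u = 0 := by
  induction N with
  | zero => exact absurd (by simpa using hN 1 (by simp)) hu
  | succ N ih =>
    by_cases h : ∀ a ∈ maximalIdeal A ^ N, a • u = 0
    · exact ih h
    · push Not at h
      obtain ⟨a, ha, hau⟩ := h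
      refine ⟨a, hau, fun b hb => ?_⟩
      rw [smul_smul]
      exact hN _ (by rw [pow_succ']; exact Ideal.mul_mem_mul hb ha)

/-- A module of elements killed by powers of the maximal ideal with finitely generated socle
embeds into a finite power of the injective hull of the residue field. -/
theorem exists_finite_functionals [IsNoetherianRing A] (hE : Module.Injective A E) (hσ : σ ≠ 0)
    (hmσ : ∀ a ∈ maximalIdeal A, a • σ = 0)
    (hM : ∀ t : M, ∃ N, ∀ a ∈ maximalIdeal A ^ N, a • t = 0) (S : Submodule A M) (hS : S.FG)
    (hmS : ∀ t : M, t ∈ S ↔ ∀ a ∈ maximalIdeal A, a • t = 0) :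
    ∃ (r : ℕ) (φ : Fin r → M →ₗ[A] E), ∀ t, (∀ i, φ i t = 0) → t = 0 := by
  classical
  have : Module.Finite A S := Module.Finite.iff_fg.mpr hS
  have hart : IsArtinian A S := by
    have ht : Module.IsTorsionBySet A S (maximalIdeal A) := fun t a =>
      Subtype.ext ((hmS t).mp t.2 a a.2)
    let : Module (A ⧸ maximalIdeal A) S := ht.module
    have : IsScalarTower A (A ⧸ maximalIdeal A) S := ht.isScalarTower
    have : Module.Finite (A ⧸ maximalIdeal A) S := Module.Finite.of_restrictScalars_finite A _ _
    let : Field (A ⧸ maximalIdeal A) := Ideal.Quotient.field _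
    have h1 : IsArtinian (A ⧸ maximalIdeal A) S := inferInstance
    have hsurj : Function.Surjective (algebraMap A (A ⧸ maximalIdeal A)) :=
      Ideal.Quotient.mk_surjective
    exact isArtinian_of_surjective_algebraMap hsurj
  obtain ⟨T, hT⟩ := Finset.exists_inf_le
    (fun φ : M →ₗ[A] E => LinearMap.ker (φ ∘ₗ S.subtype))
  refine ⟨T.card, fun i => (T.equivFin.symm i : M →ₗ[A] E), fun t ht => ?_⟩
  by_contra h0
  obtain ⟨N, hN⟩ := hM t
  obtain ⟨b, hb, hmb⟩ := exists_ne_zero_maximalIdeal_smul h0 hN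
  obtain ⟨f, hf⟩ := exists_functional_apply_ne_zero hE hσ hmσ hb
  have hbS : b • t ∈ S := (hmS _).mpr hmb
  have : (⟨b • t, hbS⟩ : S) ∈ T.inf fun φ : M →ₗ[A] E => LinearMap.ker (φ ∘ₗ S.subtype) := by
    rw [Submodule.mem_finsetInf]
    intro φ hφ
    have := ht (T.equivFin ⟨φ, hφ⟩)
    simp only [Equiv.symm_apply_apply] at this
    simp [this]
  exact hf (hT f this)

/-- A Cayley-Hamilton argument for modules with finitely generated socle. -/
theorem exists_pow_add_smul_eq_zero [IsNoetherianRing A] (hE : Module.Injective A E)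
    (hess : ∀ e : E, e ≠ 0 → ∃ a : A, a • e = σ) (hσ : σ ≠ 0)
    (hmσ : ∀ a ∈ maximalIdeal A, a • σ = 0) {r : ℕ} (φ : Fin r → M →ₗ[A] E)
    (hφ : ∀ t, (∀ i, φ i t = 0) → t = 0) {Q : Ideal A} {x : A}
    (hx : ∀ t : M, (∀ q ∈ Q, q • t = 0) → x • t = 0) (F : Submodule A M) {k : ℕ}
    (hF : ∀ t ∈ F, ∀ a ∈ maximalIdeal A ^ k, a • t = 0) :
    ∃ q ∈ Q, ∀ t ∈ F, (x ^ r + q) • t = 0 := by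
  classical
  obtain ⟨n, g, hg⟩ := Submodule.fg_iff_exists_fin_generating_family.mp (IsNoetherian.noetherian Q)
  have hgQ : ∀ j, g j ∈ Q := fun j => hg ▸ Submodule.subset_span ⟨j, rfl⟩
  have hspan : ∀ ψ : F →ₗ[A] E, ∃ c : Fin r → A, ∀ t : F, ψ t = ∑ l, c l • φ l t := by
    intro ψ
    obtain ⟨Ψ, hΨ⟩ := hE.exists_comp_eq (LinearMap.pi fun l => φ l ∘ₗ F.subtype) ψ (by
      intro t ht
      rw [show t = 0 from Subtype.ext (hφ t fun i => congrFun ht i), map_zero])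
    choose c hc using fun l => exists_forall_eq_smul hE hess hσ hmσ
      (Ψ ∘ₗ LinearMap.single A (fun _ => E) l) k
    refine ⟨c, fun t => ?_⟩
    rw [← hΨ, ← LinearMap.sum_single_apply (fun _ : Fin r => E) (LinearMap.pi _ t), map_sum]
    refine Finset.sum_congr rfl fun l _ => ?_
    refine hc l _ fun a ha => ?_
    change a • φ l t = 0
    rw [← map_smul, hF t t.2 a ha, map_zero]
  have hrow : ∀ i, ∃ B : Fin r → A, (∀ l, B l ∈ Q) ∧ ∀ t : F, x • φ i t = ∑ l, B l • φ l t := by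
    intro i
    obtain ⟨ψ, hψ⟩ := hE.exists_eq_sum_smul (Q := F) Finset.univ g (x • φ i ∘ₗ F.subtype) (by
      intro t ht
      have : x • (t : M) = 0 := by
        refine hx _ fun q hq => ?_
        rw [← hg] at hq
        induction hq using Submodule.span_induction with
        | mem y hy =>
          obtain ⟨j, rfl⟩ := hy
          exact congrArg Subtype.val (ht j (Finset.mem_univ j))
        | zero => exact zero_smul _ _
        | add y z _ _ hy hz => rw [add_smul, hy, hz, add_zero]
        | smul c y _ hy => rw [smul_assoc, hy, smul_zero]
      rw [LinearMap.smul_apply, LinearMap.comp_apply, ← map_smul, Submodule.subtype_apply, this,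
        map_zero])
    choose c hc using fun j => hspan (ψ j)
    refine ⟨fun l => ∑ j, g j * c j l, fun l => Ideal.sum_mem _ fun j _ =>
      Q.mul_mem_right _ (hgQ j), fun t => ?_⟩
    have := LinearMap.congr_fun hψ t
    simp only [LinearMap.smul_apply, LinearMap.comp_apply, Submodule.subtype_apply,
      LinearMap.sum_apply, hc, Finset.smul_sum, smul_smul] at this
    rw [this, Finset.sum_comm]
    simp only [Finset.sum_smul]
  choose B hBQ hB using hrow
  let C : Matrix (Fin r) (Fin r) A := Matrix.scalar (Fin r) x - Matrix.of B
  have hC : ∀ (t : F) i, ∑ l, C i l • φ l t = 0 := by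
    intro t i
    simp only [C, Matrix.sub_apply, Matrix.of_apply, sub_smul, Finset.sum_sub_distrib, ← hB]
    simp [Matrix.diagonal_apply, ite_smul]
  refine ⟨C.det - x ^ r, ?_, fun t ht => hφ _ fun i => ?_⟩
  · rw [← Ideal.Quotient.eq_zero_iff_mem, map_sub, map_pow, RingHom.map_det]
    have : (Ideal.Quotient.mk Q).mapMatrix C = Matrix.scalar (Fin r) (Ideal.Quotient.mk Q x) := by
      ext i l
      have h0 : Ideal.Quotient.mk Q (B i l) = 0 := Ideal.Quotient.eq_zero_iff_mem.mpr (hBQ i l)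
      simp only [C, RingHom.mapMatrix_apply, Matrix.map_apply, Matrix.sub_apply, Matrix.of_apply,
        map_sub, h0, sub_zero, Matrix.scalar_apply, Matrix.diagonal_apply]
      split_ifs <;> simp
    rw [this]
    simp
  · rw [add_sub_cancel, map_smul]
    have h1 : ∑ l, (C.adjugate * C) i l • φ l t = 0 := by
      simp only [Matrix.mul_apply, Finset.sum_smul, mul_smul]
      rw [Finset.sum_comm]
      simp only [← Finset.smul_sum, hC ⟨t, ht⟩, smul_zero, Finset.sum_const_zero]
    rw [Matrix.adjugate_mul] at h1
    simpa [Matrix.one_apply, ite_smul, mul_ite] using h1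

end EssentialSocle

end

section

open IsLocalRing RingTheory.Sequence

theorem exists_pow_smul_eq_zero_of_fg {R M : Type*} [CommRing R] [AddCommGroup M] [Module R M]
    {a : Ideal R} {L : Submodule R M} (hL : L.FG) (h : L ≤ idealTorsion a M) :
    ∃ n, ∀ t ∈ L, ∀ r ∈ a ^ n, r • t = 0 := by
  obtain ⟨m, g, rfl⟩ := Submodule.fg_iff_exists_fin_generating_family.mp hL
  choose n hn using fun i => mem_idealTorsion.mp (h (Submodule.subset_span ⟨i, rfl⟩))
  refine ⟨Finset.univ.sup n, fun t ht r hr => ?_⟩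
  induction ht using Submodule.span_induction with
  | mem x hx =>
    obtain ⟨i, rfl⟩ := hx
    exact hn i r (Ideal.pow_le_pow_right (Finset.le_sup (Finset.mem_univ i)) hr)
  | zero => exact smul_zero _
  | add x y _ _ hx hy => rw [smul_add, hx, hy, add_zero]
  | smul c x _ hx => rw [smul_comm, hx, smul_zero]

/-- If `N` is divisible by `s` up to `s`-torsion, the `s`-torsion of `N` is supported at the maximal
ideal and `0 :_N Q` is finitely generated, then `0 :_N Q` consists of `s`-torsion elements. -/
theorem le_idealTorsion_of_fg {A : Type u} [CommRing A] [IsLocalRing A] [IsNoetherianRing A]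
    {N : Type u} [AddCommGroup N] [Module A N] {Q : Ideal A} (hQ : Q ≤ maximalIdeal A) {s : A}
    (hs : s ∈ maximalIdeal A) {H : Submodule A N} (hH : ∀ z, z ∈ H ↔ ∀ q ∈ Q, q • z = 0)
    (hfg : H.FG) (hT : idealTorsion (Ideal.span {s}) N ≤ idealTorsion (maximalIdeal A) N)
    (hdiv : ∀ z : N, ∃ z', z - s • z' ∈ idealTorsion (Ideal.span {s}) N) :
    H ≤ idealTorsion (Ideal.span {s}) N := by
  set T := idealTorsion (Ideal.span {s}) N with hTdef
  have hsT : ∀ (z : N) (k : ℕ), s ^ k • z ∈ T → z ∈ T := by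
    intro z k hz
    obtain ⟨n, hn⟩ := exists_pow_smul_eq_zero hz (Ideal.mem_span_singleton_self s)
    exact mem_idealTorsion_span_singleton (k := n + k) (by rw [pow_add, mul_smul, hn])
  have hHn : ∀ L : Submodule A N, L ≤ H → L.FG := fun L hL =>
    isNoetherian_submodule.mp (isNoetherian_of_fg_of_noetherian H hfg) L hL
  obtain ⟨E, _, _, σ, hE, hσ, hmσ, hess⟩ := exists_injective_hull_residueField A
  let S : Submodule A T :=
    { carrier := {t | ∀ a ∈ maximalIdeal A, a • t = 0}
      zero_mem' := fun a _ => smul_zero a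
      add_mem' := fun {x y} hx hy a ha => by rw [smul_add, hx a ha, hy a ha, add_zero]
      smul_mem' := fun c x hx a ha => by rw [smul_comm, hx a ha, smul_zero] }
  have hS : S.FG := by
    refine Submodule.fg_of_fg_map_injective T.subtype T.subtype_injective (hHn _ ?_)
    rintro _ ⟨t, ht, rfl⟩
    exact (hH _).mpr fun q hq => congrArg Subtype.val (ht q (hQ hq))
  obtain ⟨r, φ, hφ⟩ := exists_finite_functionals hE hσ hmσ (M := T) (by
    rintro ⟨t, ht⟩
    obtain ⟨n, hn⟩ := hT ht
    exact ⟨n, fun a ha => Subtype.ext (hn a ha)⟩) S hS fun t => Iff.rfl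
  obtain ⟨c, hc⟩ := exists_pow_smul_eq_zero_of_fg (hHn (T ⊓ H) inf_le_right)
    (inf_le_left : T ⊓ H ≤ T)
  have hx : ∀ t : T, (∀ q ∈ Q, q • t = 0) → s ^ c • t = 0 := by
    intro t ht
    refine Subtype.ext (hc t ⟨t.2, (hH _).mpr fun q hq => congrArg Subtype.val (ht q hq)⟩ _ ?_)
    exact Ideal.pow_mem_pow (Ideal.mem_span_singleton_self s) c
  have hkey : ∀ z : N, (∀ q ∈ Q, q • z ∈ T) → ∃ q ∈ Q, ((s ^ c) ^ r + q) • z ∈ H := by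
    intro z hz
    let L : Submodule A N := Submodule.map (LinearMap.toSpanSingleton A N z) Q
    have hLT : L ≤ T := by
      rintro _ ⟨q, hq, rfl⟩
      exact hz q hq
    obtain ⟨k, hk⟩ := exists_pow_smul_eq_zero_of_fg
      ((IsNoetherian.noetherian Q).map (LinearMap.toSpanSingleton A N z)) (hLT.trans hT)
    obtain ⟨q', hq', h⟩ := exists_pow_add_smul_eq_zero hE hess hσ hmσ φ hφ hx
      (L.comap T.subtype) (k := k) (fun t ht a ha => Subtype.ext (hk t ht a ha))
    refine ⟨q', hq', (hH _).mpr fun q hq => ?_⟩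
    rw [smul_comm]
    exact congrArg Subtype.val (h ⟨q • z, hz q hq⟩ ⟨q, hq, rfl⟩)
  let V : Submodule A (N ⧸ T) :=
    { carrier := {v | ∀ q ∈ Q, q • v = 0}
      zero_mem' := fun a _ => smul_zero a
      add_mem' := fun {x y} hx hy a ha => by rw [smul_add, hx a ha, hy a ha, add_zero]
      smul_mem' := fun c x hx a ha => by rw [smul_comm, hx a ha, smul_zero] }
  have hinj : ∀ (k : ℕ) (v : N ⧸ T), s ^ k • v = 0 → v = 0 := by
    intro k v hv
    obtain ⟨z, rfl⟩ := T.mkQ_surjective v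
    rw [← map_smul, Submodule.mkQ_apply, Submodule.Quotient.mk_eq_zero] at hv
    exact (Submodule.Quotient.mk_eq_zero _).mpr (hsT z k hv)
  have hVfg : V.FG := by
    refine Submodule.fg_of_fg_map_injective (LinearMap.lsmul A (N ⧸ T) ((s ^ c) ^ r)) ?_ ?_
    · rw [injective_iff_map_eq_zero]
      intro v hv
      rw [LinearMap.lsmul_apply, ← pow_mul] at hv
      exact hinj _ v hv
    · refine isNoetherian_submodule.mp (isNoetherian_of_fg_of_noetherian (H.map T.mkQ)
        (hfg.map _)) _ ?_
      rintro _ ⟨v, hv, rfl⟩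
      obtain ⟨z, rfl⟩ := T.mkQ_surjective v
      obtain ⟨q, hq, h⟩ := hkey z fun q hq => by
        have := hv q hq
        rwa [← map_smul, Submodule.mkQ_apply, Submodule.Quotient.mk_eq_zero] at this
      refine ⟨_, h, ?_⟩
      rw [map_smul, add_smul, hv q hq, add_zero, LinearMap.lsmul_apply]
  have hV : V = ⊥ := by
    refine Submodule.eq_bot_of_le_smul_of_le_jacobson_bot (Ideal.span {s}) V hVfg ?_ ?_
    · intro v hv
      obtain ⟨z, rfl⟩ := T.mkQ_surjective v
      obtain ⟨z', hz'⟩ := hdiv z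
      have h1 : T.mkQ z = s • T.mkQ z' := by
        rw [← map_smul, ← sub_eq_zero, ← map_sub, Submodule.mkQ_apply,
          Submodule.Quotient.mk_eq_zero]
        exact hz'
      rw [h1]
      refine Submodule.smul_mem_smul (Ideal.mem_span_singleton_self s) fun q hq => hinj 1 _ ?_
      rw [pow_one, smul_comm, ← h1]
      exact hv q hq
    · rw [IsLocalRing.jacobson_eq_maximalIdeal ⊥ bot_ne_top, Ideal.span_singleton_le_iff_mem]
      exact hs
  intro y hy
  have : T.mkQ y ∈ V := fun q hq => by rw [← map_smul, (hH y).mp hy q hq, map_zero]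
  rw [hV, Submodule.mem_bot, Submodule.mkQ_apply, Submodule.Quotient.mk_eq_zero] at this
  exact this

end

section

open IsLocalRing RingTheory.Sequence

section Avoidance
variable {R : Type*} [CommRing R] [IsLocalRing R] [IsNoetherianRing R]

theorem one_le_ringKrullDim_quotient_sup_span_singleton {I : Ideal R}
    (h2 : 2 ≤ ringKrullDim (R ⧸ I)) {s : R} (hs : s ∈ maximalIdeal R) :
    1 ≤ ringKrullDim (R ⧸ (I ⊔ Ideal.span {s})) := by
  classical
  have : Nontrivial (R ⧸ I) := by
    by_contra h
    rw [not_nontrivial_iff_subsingleton] at h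
    rw [ringKrullDim_eq_bot_of_subsingleton] at h2
    exact absurd h2 (by decide)
  have : IsLocalRing (R ⧸ I) :=
    IsLocalRing.of_surjective' (Ideal.Quotient.mk I) Ideal.Quotient.mk_surjective
  have h := ringKrullDim_le_ringKrullDim_quotient_add_card (R := R ⧸ I)
    {Ideal.Quotient.mk I s} (by
      rw [IsLocalRing.ringJacobson_eq_maximalIdeal, Finset.coe_singleton, Set.singleton_subset_iff,
        SetLike.mem_coe, mem_maximalIdeal, mem_nonunits_iff]
      intro hu
      obtain ⟨t, ht⟩ := hu.exists_right_inv
      obtain ⟨t, rfl⟩ := Ideal.Quotient.mk_surjective t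
      rw [← map_mul, ← map_one (Ideal.Quotient.mk I), Ideal.Quotient.eq] at ht
      have hI : I ≤ maximalIdeal R := le_maximalIdeal (Ideal.Quotient.nontrivial_iff.mp ‹_›)
      have : (1 : R) ∈ maximalIdeal R := by
        simpa only [sub_sub_cancel] using
          (maximalIdeal R).sub_mem ((maximalIdeal R).mul_mem_right t hs) (hI ht)
      exact (Ideal.ne_top_iff_one _).mp (maximalIdeal.isMaximal R).ne_top this)
  rw [Finset.coe_singleton, Finset.card_singleton, ← Set.image_singleton, ← Ideal.map_span,
    ringKrullDim_eq_of_ringEquiv (DoubleQuot.quotQuotEquivQuotSup I (Ideal.span {s}))] at h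
  have h3 := h2.trans h
  revert h3
  generalize ringKrullDim (R ⧸ (I ⊔ Ideal.span {s})) = x
  intro h3
  induction x with
  | bot => exact absurd h3 (by decide)
  | coe x =>
    have h4 : (2 : ℕ∞) ≤ x + 1 := WithBot.coe_le_coe.mp h3
    have : (1 : ℕ∞) ≤ x := by
      rw [show (2 : ℕ∞) = 1 + 1 by norm_num] at h4
      exact (ENat.add_le_add_iff_right ENat.one_ne_top).mp h4
    exact_mod_cast this

theorem exists_isPrime_ringKrullDim_quotient_eq_one {J : Ideal R}
    (h1 : 1 ≤ ringKrullDim (R ⧸ J)) :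
    ∃ q : Ideal R, q.IsPrime ∧ J ≤ q ∧ ringKrullDim (R ⧸ q) = 1 := by
  let S : Set (Ideal R) := {p | p.IsPrime ∧ J ≤ p ∧ p ≠ maximalIdeal R}
  have hS : S.Nonempty := by
    by_contra hcon
    rw [Set.not_nonempty_iff_eq_empty] at hcon
    have h0 : Ring.KrullDimLE 0 (R ⧸ J) := by
      rw [Ring.krullDimLE_zero_iff]
      intro p hp
      have : p.comap (Ideal.Quotient.mk J) = maximalIdeal R := by
        by_contra hne
        have : p.comap (Ideal.Quotient.mk J) ∈ S := ⟨hp.comap _, by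
          rw [← Ideal.map_le_iff_le_comap, Ideal.map_quotient_self]; exact bot_le, hne⟩
        rw [hcon] at this
        exact this
      have hm : (p.comap (Ideal.Quotient.mk J)).IsMaximal := this ▸ maximalIdeal.isMaximal R
      rw [← Ideal.map_comap_of_surjective _ Ideal.Quotient.mk_surjective p]
      exact (Ideal.map_eq_top_or_isMaximal_of_surjective _ Ideal.Quotient.mk_surjective
        hm).resolve_left (by
          rw [Ideal.map_comap_of_surjective _ Ideal.Quotient.mk_surjective p]
          exact hp.ne_top)
    rw [Ring.krullDimLE_iff] at h0
    exact absurd (h1.trans h0) (by decide)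
  obtain ⟨q, ⟨hq, hJq, hqm⟩, hmax⟩ := set_has_maximal_iff_noetherian.mpr
    (inferInstanceAs (IsNoetherian R R)) S hS
  refine ⟨q, hq, hJq, le_antisymm ?_ ?_⟩
  · have : Ring.KrullDimLE 1 (R ⧸ q) := by
      rw [Ring.krullDimLE_one_iff_of_noZeroDivisors]
      intro p hp0 hp
      have hle : q ≤ p.comap (Ideal.Quotient.mk q) := by
        rw [← Ideal.map_le_iff_le_comap, Ideal.map_quotient_self]; exact bot_le
      have hpc := Ideal.map_comap_of_surjective _ Ideal.Quotient.mk_surjective p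
      have hpm : p.comap (Ideal.Quotient.mk q) = maximalIdeal R := by
        by_contra hne
        refine hmax _ ⟨hp.comap _, hJq.trans hle, hne⟩ (lt_of_le_of_ne hle fun h => hp0 ?_)
        rw [← hpc, ← h, Ideal.map_quotient_self]
      have hm : (p.comap (Ideal.Quotient.mk q)).IsMaximal := hpm ▸ maximalIdeal.isMaximal R
      rw [← hpc]
      exact (Ideal.map_eq_top_or_isMaximal_of_surjective _ Ideal.Quotient.mk_surjective
        hm).resolve_left (by rw [hpc]; exact hp.ne_top)
    exact Ring.krullDimLE_iff.mp this
  · have h := ringKrullDim_quotient_succ_le_of_lt hq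
      (lt_of_le_of_ne (le_maximalIdeal hq.ne_top) hqm)
    have h0 : (0 : WithBot ℕ∞) ≤ ringKrullDim (R ⧸ maximalIdeal R) := by
      have : Nontrivial (R ⧸ maximalIdeal R) :=
        Ideal.Quotient.nontrivial_iff.mpr (maximalIdeal.isMaximal R).ne_top
      exact ringKrullDim_nonneg_of_nontrivial
    calc (1 : WithBot ℕ∞) = 0 + 1 := (zero_add 1).symm
      _ ≤ _ := by gcongr
      _ ≤ _ := h

end Avoidance

theorem exists_mem_maximalIdeal_forall_notMem {R : Type*} [CommRing R] [IsLocalRing R] {S : Set (Ideal R)} (hS : S.Finite)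
    (hp : ∀ p ∈ S, p.IsPrime) (hm : ∀ p ∈ S, p ≠ maximalIdeal R) :
    ∃ s ∈ maximalIdeal R, ∀ p ∈ S, s ∉ p := by
  by_contra! hcon
  have : (maximalIdeal R : Set R) ⊆ ⋃ p ∈ S, (id p : Ideal R) := by
    intro s hs
    obtain ⟨p, hpS, hsp⟩ := hcon s hs
    exact Set.mem_biUnion hpS hsp
  obtain ⟨p, hpS, hmp⟩ :=
    (Ideal.subset_union_prime_finite hS (f := id) ⊤ ⊤ fun p h _ _ => hp p h).mp this
  exact hm p hpS (le_antisymm (le_maximalIdeal (hp p hpS).ne_top) hmp)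


theorem mem_idealTorsion_maximalIdeal_of_forall_associatedPrimes {R : Type*} [CommRing R]
    [IsLocalRing R] [IsNoetherianRing R] {N : Type*} [AddCommGroup N] [Module R N] {t : N}
    {a : Ideal R} (ht : t ∈ idealTorsion a N)
    (h : ∀ p ∈ associatedPrimes R N, a ≤ p → p = maximalIdeal R) :
    t ∈ idealTorsion (maximalIdeal R) N := by
  obtain ⟨k, hk⟩ := ht
  set J := Module.annihilator R (Submodule.span R {t}) with hJ
  have hmem : ∀ r, r ∈ J ↔ r • t = 0 := by
    intro r
    rw [hJ, Submodule.mem_annihilator_span_singleton]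
  have hrad : maximalIdeal R ≤ J.radical := by
    rw [← Ideal.sInf_minimalPrimes]
    refine le_sInf fun p hp => (h p ?_ ?_).ge
    · exact IsAssociatedPrime.map_of_injective (Submodule.subtype _)
        (Module.associatedPrimes.minimalPrimes_annihilator_subset_associatedPrimes R (Submodule.span R {t}) hp)
        (Submodule.subtype_injective _)
    · have hprime := hp.1.1
      refine (Ideal.IsPrime.pow_le_iff (n := k + 1) (Nat.succ_ne_zero k)).mp
        (fun r hr => hp.1.2 ((hmem r).mpr (hk r (Ideal.pow_le_pow_right (Nat.le_succ k) hr))))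
  obtain ⟨n, hn⟩ := Ideal.exists_pow_le_of_le_radical_of_fg hrad (IsNoetherian.noetherian _)
  exact ⟨n, fun r hr => (hmem r).mp (hn hr)⟩

namespace InjRes

variable {R : Type u} [CommRing R]

/-- The local cohomology modules of `R`, computed by an injective resolution. -/
abbrev Coh (F : InjRes R) (a : Ideal R) (j : ℕ) : Type u :=
  F.Cyc a j ⧸ (F.Bnd a j).comap (F.Cyc a j).subtype

/-- The main algebraic theorem: `0 :_N I` is not finitely generated for the local cohomology module
`N` of degree `dim R - 1` with support in `I`. -/
theorem not_fg_of_minimalPrimes [IsLocalRing R] [IsNoetherianRing R] [IsDomain R]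
    [IsDomain (AdicCompletion (maximalIdeal R) R)]
    (F : InjRes R) {n : ℕ} (hd : ringKrullDim R = (n + 1 : ℕ))
    (h : ∃ rs : List R, rs.length = n + 1 ∧ (∀ r ∈ rs, r ∈ maximalIdeal R) ∧ IsRegular R rs)
    {I : Ideal R} (h2 : 2 ≤ ringKrullDim (R ⧸ I)) {Q : Ideal R} (hQ : Q ∈ I.minimalPrimes)
    (hQ1 : ringKrullDim (R ⧸ Q) = 1) (H : Submodule R (F.Coh I n))
    (hH : ∀ z, z ∈ H ↔ ∀ r ∈ I, r • z = 0) : ¬ H.FG := by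
  intro hfg
  have hQp : Q.IsPrime := hQ.1.1
  have hIQ : I ≤ Q := hQ.1.2
  have hQm : Q ≤ maximalIdeal R := le_maximalIdeal hQp.ne_top
  have hQne : Q ≠ maximalIdeal R := by
    rintro rfl
    have h0 : ringKrullDim (R ⧸ maximalIdeal R) = 0 := by
      let _ : Field (R ⧸ maximalIdeal R) := Ideal.Quotient.field _
      exact ringKrullDim_eq_zero_of_field _
    rw [h0] at hQ1
    exact zero_ne_one hQ1
  have hNoeth : IsNoetherian R H := isNoetherian_of_fg_of_noetherian H hfg
  have htors : ∀ z : F.Coh I n, z ∈ idealTorsion I (F.Coh I n) := by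
    intro z
    obtain ⟨c, rfl⟩ := Submodule.mkQ_surjective _ z
    obtain ⟨k, hk⟩ := c.2.1
    refine ⟨k, fun r hr => ?_⟩
    rw [← map_smul, show r • c = 0 from Subtype.ext (hk r hr), map_zero]
  have hass : ∀ p ∈ associatedPrimes R (F.Coh I n), p ∈ associatedPrimes R H := by
    intro p hp
    obtain ⟨hp1, x, hx⟩ := isAssociatedPrime_iff.mp hp
    have hxp : ∀ r, r ∈ p ↔ r • x = 0 := fun r => by
      rw [hx, Submodule.mem_colon_singleton, Submodule.mem_bot]
    obtain ⟨k, hk⟩ := htors x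
    have hIp : I ≤ p := (Ideal.IsPrime.pow_le_iff (n := k + 1) (Nat.succ_ne_zero k)).mp
      fun r hr => (hxp r).mpr (hk r (Ideal.pow_le_pow_right (Nat.le_succ k) hr))
    refine isAssociatedPrime_iff.mpr ⟨hp1, ⟨x, (hH x).mpr fun r hr => (hxp r).mp (hIp hr)⟩, ?_⟩
    ext r
    rw [hxp, Submodule.mem_colon_singleton, Submodule.mem_bot, ← Subtype.coe_inj]
    rfl
  have hfin : (associatedPrimes R (F.Coh I n)).Finite :=
    (associatedPrimes.finite R H).subset hass
  obtain ⟨s, hsm, hs⟩ := exists_mem_maximalIdeal_forall_notMem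
    (S := insert Q (associatedPrimes R (F.Coh I n) \ {maximalIdeal R}))
    ((hfin.subset Set.sdiff_subset).insert Q) (by
      rintro p (rfl | hp)
      exacts [hQp, hp.1.1]) (by
      rintro p (rfl | hp)
      exacts [hQne, hp.2])
  have hsQ : s ∉ Q := hs Q (Set.mem_insert _ _)
  have hs0 : s ≠ 0 := fun h0 => hsQ (h0 ▸ Q.zero_mem)
  obtain ⟨q, hq, hIsq, hq1⟩ := exists_isPrime_ringKrullDim_quotient_eq_one
    (one_le_ringKrullDim_quotient_sup_span_singleton h2 hsm)
  have hle := F.Cyc_le_Bnd_of_le_prime hd h hq hq1 hIsq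
  let H' : Submodule R (F.Coh I n) :=
    { carrier := {v | ∀ q ∈ Q, q • v = 0}
      zero_mem' := fun a _ => smul_zero a
      add_mem' := fun {x y} hx hy a ha => by rw [smul_add, hx a ha, hy a ha, add_zero]
      smul_mem' := fun c x hx a ha => by rw [smul_comm, hx a ha, smul_zero] }
  have hH'fg : H'.FG := isNoetherian_submodule.mp hNoeth H' fun z hz =>
    (hH z).mpr fun r hr => hz r (hIQ hr)
  have hmain : H' ≤ idealTorsion (Ideal.span {s}) (F.Coh I n) := by
    refine le_idealTorsion_of_fg hQm hsm (fun z => Iff.rfl) hH'fg (fun t ht => ?_) fun z => ?_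
    · refine mem_idealTorsion_maximalIdeal_of_forall_associatedPrimes ht fun p hp hsp => ?_
      by_contra hne
      exact hs p (Set.mem_insert_of_mem _ ⟨hp, hne⟩) (hsp (Ideal.mem_span_singleton_self s))
    · obtain ⟨⟨c, hcI, hc0⟩, rfl⟩ := Submodule.mkQ_surjective _ z
      obtain ⟨e, heI, rfl⟩ := (F.injective n).exists_smul_eq_of_mem_idealTorsion I hs0 hcI
      have hc0' : s • F.d n e = 0 := by rw [← map_smul]; exact hc0
      have hde : F.d n e ∈ F.Cyc (I ⊔ Ideal.span {s}) (n + 1) :=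
        ⟨mem_idealTorsion_sup (map_mem_idealTorsion _ heI)
          (mem_idealTorsion_span_singleton (k := 1) (by rwa [pow_one])), d_d e⟩
      obtain ⟨f, hf, hfe⟩ := hle hde
      obtain ⟨k, hk⟩ := exists_pow_smul_eq_zero hf
        (Ideal.mem_sup_right (Ideal.mem_span_singleton_self s))
      have hef : e - f ∈ F.Cyc I n := ⟨sub_mem heI (idealTorsion_anti le_sup_left hf),
        LinearMap.mem_ker.mpr (by rw [map_sub, hfe, sub_self])⟩
      refine ⟨Submodule.mkQ _ ⟨e - f, hef⟩, mem_idealTorsion_span_singleton (k := k) ?_⟩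
      rw [← map_smul, ← map_sub, ← map_smul]
      refine (congrArg (Submodule.mkQ _) (Subtype.ext ?_)).trans (map_zero _)
      change s ^ k • (s • e - s • (e - f)) = 0
      rw [smul_sub s e f, sub_sub_cancel, smul_comm, hk, smul_zero]
  obtain ⟨xs, y, hl, hreg, hxs, hy, hxQ, hmin⟩ :=
    exists_isRegular_of_ringKrullDim_quotient_eq_one hd (Nat.succ_pos n) h hQp hQ1
  obtain rfl : xs.length = n := by omega
  obtain ⟨c, hc, hcQ, hcn⟩ := exists_mem_Cyc_annihilator (F := F) hxs
    (fun x hx => ne_zero_of_mem_of_isRegular hreg (List.mem_cons_of_mem y hx)) hQp hxQ hmin hIQ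
    fun p hp hIp hpQ => le_antisymm hpQ (hQ.2 ⟨hp, hIp⟩ hpQ)
  have hmk : ∀ r : R, r • c ∈ F.Bnd I xs.length ↔
      r • (Submodule.mkQ ((F.Bnd I xs.length).comap (F.Cyc I xs.length).subtype) ⟨c, hc⟩) = 0 := by
    intro r
    rw [← map_smul, Submodule.mkQ_apply, Submodule.Quotient.mk_eq_zero]
    rfl
  obtain ⟨k, hk⟩ := exists_pow_smul_eq_zero (hmain fun r hr => (hmk r).mp (hcQ r hr))
    (Ideal.mem_span_singleton_self s)
  exact hcn (s ^ k) (fun h => hsQ (hQp.mem_of_pow_mem k h)) ((hmk _).mpr hk)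

end InjRes

end

namespace ClassRel
open Opposite Limits
variable {R : Type u} [CommRing R]

/-- `x` is the class of the cocycle `g` in the (opposite of the) homology of a short complex
in the opposite of a category of modules. -/
def Rel (S : ShortComplex (ModuleCat.{u} R)ᵒᵖ) (g : S.X₂.unop) (x : S.homology.unop) : Prop :=
  ∃ z : S.opcycles.unop, S.pOpcycles.unop z = g ∧ S.homologyι.unop z = x

variable (S : ShortComplex (ModuleCat.{u} R)ᵒᵖ)

theorem pOpcycles_exact :
    Function.Exact S.pOpcycles.unop S.f.unop := by
  have h := ShortComplex.exact_of_g_is_cokernel (ShortComplex.mk S.f S.pOpcycles (by simp))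
    S.opcyclesIsCokernel
  have h' := h.unop
  rw [ShortComplex.ShortExact.moduleCat_exact_iff_function_exact] at h'
  exact h'

theorem homologyι_exact :
    Function.Exact S.fromOpcycles.unop S.homologyι.unop := by
  have h := ShortComplex.exact_of_f_is_kernel (ShortComplex.mk S.homologyι S.fromOpcycles
    (by simp)) S.homologyIsKernel
  have h' := h.unop
  rw [ShortComplex.ShortExact.moduleCat_exact_iff_function_exact] at h'
  exact h'

theorem pOpcycles_injective : Function.Injective S.pOpcycles.unop :=
  (ModuleCat.mono_iff_injective S.pOpcycles.unop).1 inferInstance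

theorem homologyι_surjective : Function.Surjective S.homologyι.unop :=
  (ModuleCat.epi_iff_surjective S.homologyι.unop).1 inferInstance

variable {S}

theorem Rel.add {g g' x x'} (h : Rel S g x) (h' : Rel S g' x') : Rel S (g + g') (x + x') := by
  obtain ⟨z, rfl, rfl⟩ := h
  obtain ⟨z', rfl, rfl⟩ := h'
  exact ⟨z + z', by simp, by simp⟩

theorem Rel.smul {g x} (r : R) (h : Rel S g x) : Rel S (r • g) (r • x) := by
  obtain ⟨z, rfl, rfl⟩ := h
  exact ⟨r • z, by simp, by simp⟩

theorem Rel.cocycle {g x} (h : Rel S g x) : S.f.unop g = 0 := by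
  obtain ⟨z, rfl, rfl⟩ := h
  exact (pOpcycles_exact S _).2 ⟨z, rfl⟩

theorem exists_rel_of_cocycle {g} (h : S.f.unop g = 0) : ∃ x, Rel S g x := by
  obtain ⟨z, rfl⟩ := (pOpcycles_exact S _).1 h
  exact ⟨_, z, rfl, rfl⟩

theorem exists_rel (x) : ∃ g, Rel S g x := by
  obtain ⟨z, rfl⟩ := homologyι_surjective S x
  exact ⟨_, z, rfl, rfl⟩

theorem unop_pOpcycles_fromOpcycles (h) :
    S.pOpcycles.unop (S.fromOpcycles.unop h) = S.g.unop h := by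
  rw [← S.p_fromOpcycles]; rfl

theorem rel_zero_iff {g} : Rel S g 0 ↔ ∃ h, S.g.unop h = g := by
  constructor
  · rintro ⟨z, rfl, hz⟩
    obtain ⟨h, rfl⟩ := (homologyι_exact S _).1 hz
    exact ⟨h, (unop_pOpcycles_fromOpcycles h).symm⟩
  · rintro ⟨h, rfl⟩
    exact ⟨_, unop_pOpcycles_fromOpcycles h, (homologyι_exact S _).2 ⟨h, rfl⟩⟩

theorem Rel.map {S T : ShortComplex (ModuleCat.{u} R)ᵒᵖ} (φ : S ⟶ T) {g x} (h : Rel T g x) :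
    Rel S (φ.τ₂.unop g) ((ShortComplex.homologyMap φ).unop x) := by
  obtain ⟨z, rfl, rfl⟩ := h
  refine ⟨(ShortComplex.opcyclesMap φ).unop z, ?_, ?_⟩
  · have := congrArg (fun f => f.unop z) (ShortComplex.p_opcyclesMap φ)
    exact this
  · have := congrArg (fun f => f.unop z) (ShortComplex.homologyι_naturality φ)
    exact this.symm

end ClassRel

namespace ClassRel
open Opposite Limits
variable {R : Type u} [CommRing R]

/-- The functor `X ↦ (X ⟶ Y)` whose left derived functors define `Ext R _ n`. -/
abbrev homFunctor (Y : ModuleCat.{u} R) : ModuleCat.{u} R ⥤ (ModuleCat.{u} R)ᵒᵖ :=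
  ((linearYoneda R (ModuleCat.{u} R)).obj Y).rightOp

/-- The short complex in degree `n` of the complex of morphisms from a projective resolution. -/
abbrev homShortComplex {X : ModuleCat.{u} R} (P : ProjectiveResolution X) (Y : ModuleCat.{u} R)
    (n : ℕ) : ShortComplex (ModuleCat.{u} R)ᵒᵖ :=
  (((homFunctor Y).mapHomologicalComplex _).obj P.complex).sc n

/-- The comparison of `Ext R _ n` with the homology of the complex of morphisms from a
projective resolution. -/
def extToHomology {X : ModuleCat.{u} R} (P : ProjectiveResolution X) (Y : ModuleCat.{u} R)
    (n : ℕ) : ((Ext R (ModuleCat.{u} R) n).obj (op X)).obj Y →ₗ[R]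
      (homShortComplex P Y n).homology.unop :=
  (P.isoLeftDerivedObj (homFunctor Y) n).inv.unop.hom

/-- `x` is the class in `Ext R _ n` of the cocycle `g` on a projective resolution. -/
def ExtRel {X : ModuleCat.{u} R} (P : ProjectiveResolution X) {Y : ModuleCat.{u} R} {n : ℕ}
    (g : P.complex.X n ⟶ Y) (x : ((Ext R (ModuleCat.{u} R) n).obj (op X)).obj Y) : Prop :=
  Rel (homShortComplex P Y n) g (extToHomology P Y n x)

variable {X : ModuleCat.{u} R} {P : ProjectiveResolution X} {Y : ModuleCat.{u} R} {n : ℕ}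

theorem ExtRel.add {g g' : P.complex.X n ⟶ Y} {x x'} (h : ExtRel P g x) (h' : ExtRel P g' x') :
    ExtRel P (g + g') (x + x') := by
  have := Rel.add h h'
  rwa [← map_add] at this

theorem ExtRel.smul {g : P.complex.X n ⟶ Y} {x} (r : R) (h : ExtRel P g x) :
    ExtRel P (r • g) (r • x) := by
  have := Rel.smul r h
  rwa [← map_smul] at this

theorem homShortComplex_f (g : P.complex.X n ⟶ Y) (m : ℕ) (hm : n + 1 = m) :
    (homShortComplex P Y n).f.unop g = 0 ↔ P.complex.d m n ≫ g = 0 := by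
  have h : (ComplexShape.down ℕ).prev n = m := (ComplexShape.down ℕ).prev_eq' hm
  subst h
  exact Iff.rfl

theorem homShortComplex_g (g : P.complex.X n ⟶ Y) (p : ℕ) (hp : p + 1 = n) :
    (∃ h, (homShortComplex P Y n).g.unop h = g) ↔ ∃ h : P.complex.X p ⟶ Y,
      P.complex.d n p ≫ h = g := by
  have h : (ComplexShape.down ℕ).next n = p := (ComplexShape.down ℕ).next_eq' hp
  subst h
  exact Iff.rfl

theorem ExtRel.cocycle {g : P.complex.X n ⟶ Y} {x} (h : ExtRel P g x) (m : ℕ) (hm : n + 1 = m) :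
    P.complex.d m n ≫ g = 0 :=
  (homShortComplex_f g m hm).1 (Rel.cocycle h)

theorem extToHomology_surjective : Function.Surjective (extToHomology P Y n) := fun y =>
  ⟨(P.isoLeftDerivedObj (homFunctor Y) n).hom.unop y,
    congrArg (fun f => f.unop y) (P.isoLeftDerivedObj (homFunctor Y) n).inv_hom_id⟩

theorem exists_extRel_of_cocycle (g : P.complex.X n ⟶ Y) (m : ℕ) (hm : n + 1 = m)
    (hg : P.complex.d m n ≫ g = 0) : ∃ x, ExtRel P g x := by
  obtain ⟨y, hy⟩ := exists_rel_of_cocycle ((homShortComplex_f g m hm).2 hg)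
  obtain ⟨x, rfl⟩ := extToHomology_surjective y
  exact ⟨x, hy⟩

theorem exists_extRel (x : ((Ext R (ModuleCat.{u} R) n).obj (op X)).obj Y) :
    ∃ g : P.complex.X n ⟶ Y, ExtRel P g x :=
  exists_rel (S := homShortComplex P Y n) (extToHomology P Y n x)

theorem extRel_zero_iff {g : P.complex.X n ⟶ Y} (p : ℕ) (hp : p + 1 = n) :
    ExtRel P g 0 ↔ ∃ h : P.complex.X p ⟶ Y, P.complex.d n p ≫ h = g := by
  unfold ExtRel
  rw [map_zero]
  exact (rel_zero_iff (S := homShortComplex P Y n)).trans (homShortComplex_g g p hp)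

theorem ExtRel.map {X' : ModuleCat.{u} R} {P' : ProjectiveResolution X'} (f : X' ⟶ X)
    (φ : P'.complex ⟶ P.complex) (comm : φ.f 0 ≫ P.π.f 0 = P'.π.f 0 ≫ f)
    {g : P.complex.X n ⟶ Y} {x} (h : ExtRel P g x) :
    ExtRel P' (φ.f n ≫ g) ((((Ext R (ModuleCat.{u} R) n).map f.op).app Y) x) := by
  have key := ProjectiveResolution.isoLeftDerivedObj_inv_naturality f P' P φ comm
    (homFunctor Y) n
  have h1 := Rel.map ((HomologicalComplex.shortComplexFunctor _ _ n).map
    (((homFunctor Y).mapHomologicalComplex _).map φ)) h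
  have h2 := congrArg (fun f => f.unop x) key
  have h3 : extToHomology P' Y n ((((Ext R (ModuleCat.{u} R) n).map f.op).app Y) x) =
    (ShortComplex.homologyMap ((HomologicalComplex.shortComplexFunctor _ _ n).map
      (((homFunctor Y).mapHomologicalComplex _).map φ))).unop (extToHomology P Y n x) := h2
  unfold ExtRel
  rw [h3]
  exact h1

end ClassRel

namespace ClassRel
open Opposite Limits Abelian
variable {R : Type u} [CommRing R]

/-- `x` is the class in `Ext R _ n` of the cocycle `c` with values in an injective resolution. -/
def InjRel {Y : ModuleCat.{u} R} (J : InjectiveResolution Y) {X : ModuleCat.{u} R} {n : ℕ}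
    (c : X ⟶ J.cocomplex.X n) (x : ((Ext R (ModuleCat.{u} R) n).obj (op X)).obj Y) : Prop :=
  ∃ g : (ProjectiveResolution.of X).complex.X n ⟶ Y, ExtRel (ProjectiveResolution.of X) g x ∧
    ∃ (hg : (ProjectiveResolution.of X).complex.d (n + 1) n ≫ g = 0)
      (hc : c ≫ J.cocomplex.d n (n + 1) = 0),
      (ProjectiveResolution.of X).extMk g (n + 1) rfl hg = J.extMk c (n + 1) rfl hc

variable {Y : ModuleCat.{u} R} {J : InjectiveResolution Y} {X : ModuleCat.{u} R} {n : ℕ}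

theorem InjRel.add {c c' : X ⟶ J.cocomplex.X n} {x x'} (h : InjRel J c x) (h' : InjRel J c' x') :
    InjRel J (c + c') (x + x') := by
  obtain ⟨g, hx, hg, hc, e⟩ := h
  obtain ⟨g', hx', hg', hc', e'⟩ := h'
  refine ⟨g + g', hx.add hx', by simp [hg, hg'], by simp [hc, hc'], ?_⟩
  rw [← ProjectiveResolution.add_extMk _ _ _ _ _ hg hg', e, e',
    InjectiveResolution.add_extMk _ _ _ _ _ hc hc']

/-- A chain map lifting a morphism. -/
def liftHom {X X' : ModuleCat.{u} R} (f : X' ⟶ X) (P' : ProjectiveResolution X')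
    (P : ProjectiveResolution X) : ProjectiveResolution.Hom P' P f where
  hom := ProjectiveResolution.lift f P' P
  hom_f_zero_comp_π_f_zero := by
    rw [ProjectiveResolution.lift_commutes_zero]
    simp

/-- Multiplication by a scalar as a morphism of resolutions. -/
def smulHom {X : ModuleCat.{u} R} (P : ProjectiveResolution X) (r : R) :
    ProjectiveResolution.Hom P P (r • 𝟙 X) where
  hom := r • 𝟙 P.complex
  hom_f_zero_comp_π_f_zero := by
    change (r • 𝟙 (P.complex.X 0)) ≫ P.π.f 0 =
      P.π.f 0 ≫ (r • 𝟙 (((ChainComplex.single₀ (ModuleCat.{u} R)).obj X).X 0))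
    rw [Linear.smul_comp, Linear.comp_smul, Category.id_comp, Category.comp_id]

theorem InjRel.smul {c : X ⟶ J.cocomplex.X n} {x} (r : R) (h : InjRel J c x) :
    InjRel J (r • c) (r • x) := by
  obtain ⟨g, hx, hg, hc, e⟩ := h
  refine ⟨r • g, hx.smul r, by simp [hg], by simp [hc], ?_⟩
  have h1 := ProjectiveResolution.mk₀_comp_extMk g (n + 1) rfl hg
    (smulHom (ProjectiveResolution.of X) r)
  have h2 := InjectiveResolution.mk₀_comp_extMk J c (n + 1) rfl hc (r • 𝟙 X)
  rw [← e, h1] at h2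
  simpa [smulHom] using h2

theorem exists_injRel_of_cocycle {c : X ⟶ J.cocomplex.X n}
    (hc : c ≫ J.cocomplex.d n (n + 1) = 0) : ∃ x, InjRel J c x := by
  obtain ⟨g, hg, e⟩ := (ProjectiveResolution.of X).extMk_surjective
    (J.extMk c (n + 1) rfl hc) (n + 1) rfl
  obtain ⟨x, hx⟩ := exists_extRel_of_cocycle g (n + 1) rfl hg
  exact ⟨x, g, hx, hg, hc, e⟩

theorem exists_injRel (J : InjectiveResolution Y)
    (x : ((Ext R (ModuleCat.{u} R) n).obj (op X)).obj Y) :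
    ∃ c, InjRel J c x := by
  obtain ⟨g, hx⟩ := exists_extRel (P := ProjectiveResolution.of X) x
  have hg := hx.cocycle (n + 1) rfl
  obtain ⟨c, hc, e⟩ := J.extMk_surjective
    ((ProjectiveResolution.of X).extMk g (n + 1) rfl hg) (n + 1) rfl
  exact ⟨c, g, hx, hg, hc, e.symm⟩

theorem InjRel.cocycle {c : X ⟶ J.cocomplex.X n} {x} (h : InjRel J c x) :
    c ≫ J.cocomplex.d n (n + 1) = 0 :=
  h.choose_spec.2.choose_spec.choose

theorem injRel_zero_iff {c : X ⟶ J.cocomplex.X n} (p : ℕ) (hp : p + 1 = n) :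
    InjRel J c 0 ↔ ∃ b : X ⟶ J.cocomplex.X p, b ≫ J.cocomplex.d p n = c := by
  constructor
  · rintro ⟨g, hx, hg, hc, e⟩
    rw [extRel_zero_iff p hp] at hx
    rw [((ProjectiveResolution.of X).extMk_eq_zero_iff g (n + 1) rfl hg p hp).2 hx] at e
    exact (J.extMk_eq_zero_iff c (n + 1) rfl hc p hp).1 e.symm
  · rintro ⟨b, hb⟩
    have hc : c ≫ J.cocomplex.d n (n + 1) = 0 := by simp [← hb]
    refine ⟨0, (extRel_zero_iff p hp).2 ⟨0, by simp⟩, by simp, hc, ?_⟩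
    rw [(J.extMk_eq_zero_iff c (n + 1) rfl hc p hp).2 ⟨b, hb⟩]
    simp

theorem InjRel.map {X' : ModuleCat.{u} R} (f : X' ⟶ X) {c : X ⟶ J.cocomplex.X n} {x}
    (h : InjRel J c x) :
    InjRel J (f ≫ c) ((((Ext R (ModuleCat.{u} R) n).map f.op).app Y) x) := by
  obtain ⟨g, hx, hg, hc, e⟩ := h
  let φ := liftHom f (ProjectiveResolution.of X') (ProjectiveResolution.of X)
  refine ⟨φ.hom.f n ≫ g, hx.map f φ.hom (ProjectiveResolution.lift_commutes_zero _ _ _), ?_,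
    by simp [hc], ?_⟩
  · rw [← φ.hom.comm_assoc, hg, comp_zero]
  · rw [← ProjectiveResolution.mk₀_comp_extMk g (n + 1) rfl hg φ,
      ← InjectiveResolution.mk₀_comp_extMk J c (n + 1) rfl hc f, e]

theorem InjRel.sub {c c' : X ⟶ J.cocomplex.X n} {x x'} (h : InjRel J c x) (h' : InjRel J c' x') :
    InjRel J (c - c') (x - x') := by
  have := h.add (h'.smul (-1))
  simpa [sub_eq_add_neg] using this

end ClassRel

namespace ClassRel
open Opposite Limits Abelian
variable {R : Type u} [CommRing R]

theorem Rel.unique {S : ShortComplex (ModuleCat.{u} R)ᵒᵖ} {x} (h : Rel S 0 x) : x = 0 := by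
  obtain ⟨z, hz, rfl⟩ := h
  rw [pOpcycles_injective S (hz.trans (map_zero _).symm)]
  exact map_zero _

theorem extToHomology_injective {X : ModuleCat.{u} R} (P : ProjectiveResolution X)
    (Y : ModuleCat.{u} R) (n : ℕ) : Function.Injective (extToHomology P Y n) := by
  intro x y h
  have key (z) : (P.isoLeftDerivedObj (homFunctor Y) n).hom.unop (extToHomology P Y n z) = z :=
    congrArg (fun f => f.unop z) (P.isoLeftDerivedObj (homFunctor Y) n).hom_inv_id
  rw [← key x, h, key y]

theorem ExtRel.unique {X : ModuleCat.{u} R} {P : ProjectiveResolution X} {Y : ModuleCat.{u} R}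
    {n : ℕ} {x} (h : ExtRel P (0 : P.complex.X n ⟶ Y) x) : x = 0 :=
  extToHomology_injective P Y n ((Rel.unique (S := homShortComplex P Y n) h).trans
    (map_zero _).symm)

variable {Y : ModuleCat.{u} R} {J : InjectiveResolution Y}

theorem InjRel.unique {X : ModuleCat.{u} R} {p : ℕ} {x}
    (h : InjRel J (0 : X ⟶ J.cocomplex.X (p + 1)) x) : x = 0 := by
  obtain ⟨g, hx, hg, hc, e⟩ := h
  rw [J.extMk_zero] at e
  have h0 := (extRel_zero_iff p rfl).2
    (((ProjectiveResolution.of X).extMk_eq_zero_iff g _ rfl hg p rfl).1 e)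
  have h1 := hx.add (h0.smul (-1))
  simp only [smul_zero, add_zero, neg_smul, one_smul, add_neg_cancel] at h1
  exact h1.unique

open localCohomology

variable (I : Ideal R)

/-- The canonical map from `Ext` of `R ⧸ I ^ t` to local cohomology. -/
def extToLoc (M : ModuleCat.{u} R) (n t : ℕ) :
    ((Ext R (ModuleCat.{u} R) n).obj (op (ModuleCat.of R (R ⧸ I ^ t)))).obj M ⟶
      (localCohomology I n).obj M :=
  (colimit.ι (diagram (idealPowersDiagram I) n) (op (op t))).app M

/-- The canonical projection `R ⧸ I ^ t' ⟶ R ⧸ I ^ t`. -/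
def projPow {t t' : ℕ} (h : t ≤ t') :
    ModuleCat.of R (R ⧸ I ^ t') ⟶ ModuleCat.of R (R ⧸ I ^ t) :=
  ModuleCat.ofHom (Submodule.mapQ _ _ LinearMap.id (Ideal.pow_le_pow_right h))

theorem extToLoc_projPow (M : ModuleCat.{u} R) (n : ℕ) {t t' : ℕ} (h : t ≤ t') (x) :
    extToLoc I M n t' ((((Ext R (ModuleCat.{u} R) n).map (projPow I h).op).app M) x) =
      extToLoc I M n t x := by
  have := colimit.w (diagram (idealPowersDiagram I) n) (homOfLE h).op.op
  exact congrArg (fun f => (f.app M) x) this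

instance preservesColimit_forget (K : ℕᵒᵖᵒᵖ ⥤ ModuleCat.{u} R) :
    PreservesColimit K (forget (ModuleCat.{u} R)) :=
  have : PreservesFilteredColimitsOfSize.{0, 0} (forget (ModuleCat.{u} R)) :=
    preservesFilteredColimitsOfSize_shrink.{0, u, 0, u} _
  have := PreservesFilteredColimitsOfSize.preserves_filtered_colimits
    (F := forget (ModuleCat.{u} R)) ℕᵒᵖᵒᵖ
  inferInstance

/-- Evaluation of the colimit cocone defining local cohomology. -/
def locIsColimit (M : ModuleCat.{u} R) (n : ℕ) :
    IsColimit (((evaluation _ _).obj M).mapCocone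
      (colimit.cocone (diagram (idealPowersDiagram I) n))) :=
  isColimitOfPreserves ((evaluation _ _).obj M)
    (colimit.isColimit (diagram (idealPowersDiagram I) n))

theorem exists_extToLoc (M : ModuleCat.{u} R) (n : ℕ) (x : (localCohomology I n).obj M) :
    ∃ t y, extToLoc I M n t y = x := by
  obtain ⟨j, y, hy⟩ := Concrete.isColimit_exists_rep _ (locIsColimit I M n) x
  exact ⟨j.unop.unop, y, hy⟩

theorem exists_of_extToLoc_eq_zero (M : ModuleCat.{u} R) (n t : ℕ) (y)
    (h : extToLoc I M n t y = 0) : ∃ t', ∃ h : t ≤ t',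
      (((Ext R (ModuleCat.{u} R) n).map (projPow I h).op).app M) y = 0 := by
  obtain ⟨k, f, g, hfg⟩ := Concrete.isColimit_exists_of_rep_eq _ (locIsColimit I M n)
    (i := op (op t)) (j := op (op t)) y 0 (h.trans (map_zero (extToLoc I M n t).hom).symm)
  exact ⟨k.unop.unop, leOfHom f.unop.unop, hfg.trans (map_zero _)⟩

end ClassRel

namespace ClassRel
open Opposite Limits Abelian
variable {R : Type u} [CommRing R] {M : ModuleCat.{u} R} (J : InjectiveResolution M)
  (I : Ideal R) {n : ℕ}

/-- `x` is the class in local cohomology of the torsion cocycle `c`. -/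
def LocRel (c : J.cocomplex.X n) (x : (localCohomology I n).obj M) : Prop :=
  ∃ (t : ℕ) (f : ModuleCat.of R (R ⧸ I ^ t) ⟶ J.cocomplex.X n) (y : _),
    f (Ideal.Quotient.mk _ 1) = c ∧ InjRel J f y ∧ extToLoc I M n t y = x

variable {J I}

theorem projPow_mk {t t' : ℕ} (h : t ≤ t') (r : R) :
    projPow I h (Ideal.Quotient.mk _ r) = (Ideal.Quotient.mk _ r : R ⧸ I ^ t) := rfl

/-- The class of a cocycle may be computed at any later stage. -/
theorem locRel_of_le {t t' : ℕ} (h : t ≤ t') {f : ModuleCat.of R (R ⧸ I ^ t) ⟶ J.cocomplex.X n} {y}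
    (hf : InjRel J f y) : ∃ (f' : ModuleCat.of R (R ⧸ I ^ t') ⟶ J.cocomplex.X n) (y' : _),
      f' (Ideal.Quotient.mk _ 1) = f (Ideal.Quotient.mk _ 1) ∧ InjRel J f' y' ∧
      extToLoc I M n t' y' = extToLoc I M n t y :=
  ⟨projPow I h ≫ f, _, rfl, hf.map (projPow I h), extToLoc_projPow I M n h y⟩

theorem LocRel.add {c c' : J.cocomplex.X n} {x x'} (h : LocRel J I c x) (h' : LocRel J I c' x') :
    LocRel J I (c + c') (x + x') := by
  obtain ⟨t, f, y, rfl, hy, rfl⟩ := h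
  obtain ⟨t', f', y', rfl, hy', rfl⟩ := h'
  obtain ⟨g, z, hg, hz, e⟩ := locRel_of_le (le_max_left t t') hy
  obtain ⟨g', z', hg', hz', e'⟩ := locRel_of_le (le_max_right t t') hy'
  exact ⟨_, g + g', z + z', by rw [← hg, ← hg']; rfl, hz.add hz', by rw [map_add, e, e']⟩

theorem LocRel.smul {c : J.cocomplex.X n} {x} (r : R) (h : LocRel J I c x) :
    LocRel J I (r • c) (r • x) := by
  obtain ⟨t, f, y, rfl, hy, rfl⟩ := h
  exact ⟨t, r • f, r • y, rfl, hy.smul r, by rw [map_smul]⟩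

theorem quotient_hom_ext {t : ℕ} {N : ModuleCat.{u} R}
    {f g : ModuleCat.of R (R ⧸ I ^ t) ⟶ N}
    (h : f (Ideal.Quotient.mk _ 1) = g (Ideal.Quotient.mk _ 1)) : f = g := by
  refine ModuleCat.hom_ext (LinearMap.ext fun z => ?_)
  obtain ⟨r, rfl⟩ := Ideal.Quotient.mk_surjective z
  have : (Ideal.Quotient.mk (I ^ t) r) = r • (Ideal.Quotient.mk (I ^ t) 1) := by
    rw [← Ideal.Quotient.mk_eq_mk, ← Ideal.Quotient.mk_eq_mk, ← Submodule.Quotient.mk_smul]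
    simp
  erw [this, map_smul, map_smul, h]

theorem exists_quotient_hom {t : ℕ} {N : ModuleCat.{u} R} {c : N} (h : ∀ r ∈ I ^ t, r • c = 0) :
    ∃ f : ModuleCat.of R (R ⧸ I ^ t) ⟶ N, f (Ideal.Quotient.mk _ 1) = c :=
  ⟨ModuleCat.ofHom ((I ^ t).liftQ (LinearMap.toSpanSingleton R N c) fun r hr => h r hr),
    one_smul R c⟩

theorem smul_quotient_hom {t : ℕ} {N : ModuleCat.{u} R}
    (f : ModuleCat.of R (R ⧸ I ^ t) ⟶ N) {r : R} (hr : r ∈ I ^ t) :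
    r • f (Ideal.Quotient.mk _ 1) = 0 := by
  have : r • (Ideal.Quotient.mk (I ^ t) 1) = 0 := by
    rw [← Ideal.Quotient.mk_eq_mk, ← Submodule.Quotient.mk_smul]
    simpa [Ideal.Quotient.eq_zero_iff_mem] using hr
  rw [← map_smul]
  erw [this]
  exact map_zero _

theorem exists_locRel_right (x : (localCohomology I n).obj M) : ∃ c, LocRel J I c x := by
  obtain ⟨t, y, rfl⟩ := exists_extToLoc I M n x
  obtain ⟨f, hf⟩ := exists_injRel J y
  exact ⟨_, t, f, y, rfl, hf, rfl⟩

theorem exists_locRel_left {c : J.cocomplex.X n} {t : ℕ} (h : ∀ r ∈ I ^ t, r • c = 0)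
    (hc : J.cocomplex.d n (n + 1) c = 0) : ∃ x, LocRel J I c x := by
  obtain ⟨f, rfl⟩ := exists_quotient_hom h
  obtain ⟨y, hy⟩ := exists_injRel_of_cocycle (J := J) (c := f)
    (quotient_hom_ext (hc.trans rfl))
  exact ⟨_, t, f, y, rfl, hy, rfl⟩

theorem LocRel.cocycle {c : J.cocomplex.X n} {x} (h : LocRel J I c x) :
    (∃ t, ∀ r ∈ I ^ t, r • c = 0) ∧ J.cocomplex.d n (n + 1) c = 0 := by
  obtain ⟨t, f, y, rfl, hy, rfl⟩ := h
  refine ⟨⟨t, fun r hr => smul_quotient_hom f hr⟩, ?_⟩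
  exact congrArg (fun g => g (Ideal.Quotient.mk _ 1)) hy.cocycle

theorem LocRel.unique {p : ℕ} {x} (h : LocRel J I (0 : J.cocomplex.X (p + 1)) x) : x = 0 := by
  obtain ⟨t, f, y, hf, hy, rfl⟩ := h
  obtain rfl : f = 0 := quotient_hom_ext (hf.trans rfl)
  rw [hy.unique, map_zero]

theorem locRel_zero_iff {p : ℕ} {c : J.cocomplex.X (p + 1)} : LocRel J I c 0 ↔
    ∃ b : J.cocomplex.X p, (∃ t, ∀ r ∈ I ^ t, r • b = 0) ∧ J.cocomplex.d p (p + 1) b = c := by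
  constructor
  · rintro ⟨t, f, y, rfl, hy, h⟩
    obtain ⟨t', h, hz⟩ := exists_of_extToLoc_eq_zero I M _ t y h
    have h1 := hy.map (projPow I h)
    rw [hz] at h1
    obtain ⟨b, hb⟩ := (injRel_zero_iff p rfl).1 h1
    exact ⟨b (Ideal.Quotient.mk _ 1), ⟨t', fun r hr => smul_quotient_hom b hr⟩,
      congrArg (fun g => g (Ideal.Quotient.mk _ 1)) hb⟩
  · rintro ⟨b, ⟨t, hb⟩, rfl⟩
    obtain ⟨f, rfl⟩ := exists_quotient_hom hb
    exact ⟨t, f ≫ J.cocomplex.d p (p + 1), 0, rfl, (injRel_zero_iff p rfl).2 ⟨f, rfl⟩, map_zero _⟩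

end ClassRel

section

open IsLocalRing RingTheory.Sequence

section Bridge
open ClassRel
variable {R : Type u} [CommRing R]

/-- The concrete injective resolution attached to a categorical one. -/
def InjRes.ofInjectiveResolution (J : InjectiveResolution (ModuleCat.of R R)) : InjRes R where
  E j := J.cocomplex.X j
  d j := (J.cocomplex.d j (j + 1)).hom
  aug := (show ModuleCat.of R R ⟶ J.cocomplex.X 0 from J.ι.f 0).hom
  injective j :=
    have : Injective (ModuleCat.of R (J.cocomplex.X j)) := J.injective j
    Module.injective_module_of_injective_object R (J.cocomplex.X j)
  aug_injective := (ModuleCat.mono_iff_injective (J.ι.f 0)).1 inferInstance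
  exact_zero :=
    (ShortComplex.ShortExact.moduleCat_exact_iff_function_exact _).1 J.exact₀
  exact_succ j :=
    (ShortComplex.ShortExact.moduleCat_exact_iff_function_exact _).1 (J.exact_succ j)

variable (J : InjectiveResolution (ModuleCat.of R R)) (I : Ideal R) (p : ℕ)

/-- The graph of the correspondence between cocycles and local cohomology classes. -/
def locGraph : Submodule R (J.cocomplex.X (p + 1) ×
    (localCohomology I (p + 1)).obj (ModuleCat.of R R)) where
  carrier := {q | LocRel J I q.1 q.2}
  add_mem' h h' := LocRel.add h h'
  zero_mem' := locRel_zero_iff.2 ⟨0, ⟨0, fun _ _ => smul_zero _⟩, map_zero _⟩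
  smul_mem' r _ h := LocRel.smul r h

/-- The projection of the graph to local cohomology. -/
def locGraphSnd : locGraph J I p →ₗ[R] (localCohomology I (p + 1)).obj (ModuleCat.of R R) :=
  LinearMap.snd R _ _ ∘ₗ (locGraph J I p).subtype

/-- The projection of the graph to cohomology classes of the torsion complex. -/
def locGraphFst : locGraph J I p →ₗ[R] (InjRes.ofInjectiveResolution J).Coh I (p + 1) :=
  Submodule.mkQ _ ∘ₗ LinearMap.codRestrict ((InjRes.ofInjectiveResolution J).Cyc I (p + 1))
    (LinearMap.fst R _ _ ∘ₗ (locGraph J I p).subtype) fun q => LocRel.cocycle q.2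

theorem locGraphSnd_surjective : Function.Surjective (locGraphSnd J I p) := fun x =>
  have ⟨c, hc⟩ := exists_locRel_right (J := J) x
  ⟨⟨(c, x), hc⟩, rfl⟩

theorem locGraphFst_surjective : Function.Surjective (locGraphFst J I p) := by
  intro y
  obtain ⟨⟨c, ⟨t, ht⟩, hc⟩, rfl⟩ := Submodule.mkQ_surjective _ y
  obtain ⟨x, hx⟩ := exists_locRel_left (J := J) ht hc
  exact ⟨⟨(c, x), hx⟩, rfl⟩

theorem ker_locGraph : LinearMap.ker (locGraphFst J I p) = LinearMap.ker (locGraphSnd J I p) := by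
  ext ⟨⟨c, x⟩, h⟩
  have h1 : (⟨⟨c, x⟩, h⟩ : locGraph J I p) ∈ LinearMap.ker (locGraphFst J I p) ↔
      LocRel J I c 0 := by
    rw [locRel_zero_iff]
    exact (Submodule.Quotient.mk_eq_zero _)
  rw [h1]
  change _ ↔ x = 0
  constructor
  · intro h0
    have := LocRel.add h (LocRel.smul (-1) h0)
    simp only [smul_zero, add_zero, neg_smul, one_smul, add_neg_cancel] at this
    exact this.unique
  · rintro rfl
    exact h

/-- Local cohomology is the cohomology of the torsion subcomplex of an injective resolution. -/
def localCohomologyEquiv : (localCohomology I (p + 1)).obj (ModuleCat.of R R) ≃ₗ[R]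
    (InjRes.ofInjectiveResolution J).Coh I (p + 1) :=
  ((locGraphSnd J I p).quotKerEquivOfSurjective (locGraphSnd_surjective J I p)).symm ≪≫ₗ
    Submodule.quotEquivOfEq _ _ (ker_locGraph J I p).symm ≪≫ₗ
    (locGraphFst J I p).quotKerEquivOfSurjective (locGraphFst_surjective J I p)

/-- The elements killed by an ideal form a finitely generated module as soon as the module of
homomorphisms from the quotient is finite. -/
theorem exists_fg_of_finite_hom {N C : Type*} [AddCommGroup N] [Module R N] [AddCommGroup C]
    [Module R C] (e : N ≃ₗ[R] C) (h : Module.Finite R ((R ⧸ I) →ₗ[R] N)) :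
    ∃ H : Submodule R C, (∀ z, z ∈ H ↔ ∀ r ∈ I, r • z = 0) ∧ H.FG := by
  let φ : ((R ⧸ I) →ₗ[R] N) →ₗ[R] C := e.toLinearMap ∘ₗ LinearMap.applyₗ (1 : R ⧸ I)
  refine ⟨LinearMap.range φ, fun z => ⟨?_, fun hz => ?_⟩, ?_⟩
  · rintro ⟨f, rfl⟩ r hr
    have h1 : r • (1 : R ⧸ I) = 0 := by
      rw [Algebra.smul_def, mul_one]
      exact Ideal.Quotient.eq_zero_iff_mem.2 hr
    change r • e (f 1) = 0
    rw [← map_smul, ← map_smul, h1, map_zero, map_zero]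
  · refine ⟨I.liftQ (LinearMap.toSpanSingleton R N (e.symm z)) fun r hr => ?_, ?_⟩
    · change r • e.symm z = 0
      rw [← map_smul, hz r hr, map_zero]
    · change e ((1 : R) • e.symm z) = z
      simp
  · rw [LinearMap.range_eq_map]
    exact Submodule.FG.map _ h.fg_top

end Bridge

end

section

open IsLocalRing RingTheory.Sequence

theorem IsCMLocalRing.exists_isRegular {R : Type u} [CommRing R] [IsNoetherianRing R]
    [IsLocalRing R] (hCM : IsCMLocalRing R) {n : ℕ} (hd : ringKrullDim R = (n + 1 : ℕ)) :
    ∃ rs : List R, rs.length = n + 1 ∧ (∀ r ∈ rs, r ∈ maximalIdeal R) ∧ IsRegular R rs := by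
  unfold IsCMLocalRing moduleDepth at hCM
  rw [hd] at hCM
  have hsup : (n : ℕ∞) < sSup {n : ℕ∞ | ∃ rs : List R, (rs.length : ℕ∞) = n ∧
      (∀ r ∈ rs, r ∈ maximalIdeal R) ∧ IsRegular R rs} := by
    rw [WithBot.coe_eq_coe.1 (hCM : _ = (((n + 1 : ℕ) : ℕ∞) : WithBot ℕ∞))]
    exact_mod_cast n.lt_succ_self
  obtain ⟨_, ⟨rs, rfl, hrs, hreg⟩, hlt⟩ := lt_sSup_iff.1 hsup
  refine ⟨rs, le_antisymm ?_ (by exact_mod_cast hlt), hrs, hreg⟩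
  have h1 := ringKrullDim_add_length_eq_ringKrullDim_of_isRegular rs hreg
  have : Nontrivial (R ⧸ Ideal.ofList rs) := by
    refine Ideal.Quotient.nontrivial_iff.2 fun h => ?_
    exact hreg.top_ne_smul (by rw [h]; simp)
  have h2 : (0 : WithBot ℕ∞) ≤ ringKrullDim (R ⧸ Ideal.ofList rs) := ringKrullDim_nonneg_of_nontrivial
  have h3 : ((rs.length : ℕ) : WithBot ℕ∞) ≤ ((n + 1 : ℕ) : WithBot ℕ∞) := by
    rw [← hd, ← h1]
    simpa using add_le_add_left h2 (rs.length : WithBot ℕ∞)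
  exact_mod_cast h3

end

theorem stmt11 (R : Type u) [CommRing R] [IsNoetherianRing R] [IsLocalRing R] [IsDomain R]
    (hCM : IsCMLocalRing R)
    [IsDomain (AdicCompletion (IsLocalRing.maximalIdeal R) R)]
    [IsIntegrallyClosed (AdicCompletion (IsLocalRing.maximalIdeal R) R)]
    (d : ℕ) (hd : ringKrullDim R = d)
    (I : Ideal R) (h2 : 2 ≤ ringKrullDim (R ⧸ I))
    (Q : Ideal R) (hQ : Q ∈ I.minimalPrimes) (hQ1 : ringKrullDim (R ⧸ Q) = 1) :
    ¬ Module.Finite R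
      ((R ⧸ I) →ₗ[R] ((localCohomology I (d - 1)).obj (ModuleCat.of R R))) := by
  intro hfin
  have hd2 : (2 : WithBot ℕ∞) ≤ (d : WithBot ℕ∞) := hd ▸ h2.trans (ringKrullDim_quotient_le I)
  have hd2' : 2 ≤ d := by exact_mod_cast hd2
  obtain ⟨p, rfl⟩ : ∃ p, d = p + 1 + 1 := ⟨d - 2, by omega⟩
  let J := InjectiveResolution.of (ModuleCat.of R R)
  obtain ⟨H, hH, hfg⟩ := exists_fg_of_finite_hom I (localCohomologyEquiv J I p) hfin
  exact InjRes.not_fg_of_minimalPrimes (InjRes.ofInjectiveResolution J) hd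
    (hCM.exists_isRegular hd) h2 hQ hQ1 H hH hfg
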